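/- Let n ≥ 2. There exist positive constants h_c ≤ 1/5, C_mc, c₂, C₂, C₅, C₇ depending only on n such that the following holds. Let h₀ > 0 and let V be strictly convex and C² on the closure of S(V, h₀), with B₁(ξ) ⊆ S(V, h₀) ⊆ B_n(ξ) for some ξ ∈ ℝⁿ, (det D²V)^{1/n} = Φ in S(V, h₀), D V(0) = 0, Φ(0) = 1, and δ₀ := sup_{S(V,h₀)} |Φ − 1| ≤ C_mc. Let w₀ be the convex function, smooth in S(V,h₀) and continuous on its closure, with det D²w₀ = 1 in S(V,h₀) and w₀ = 0 on ∂S(V,h₀), and for every k ≥ 1 let w_k be the analogous solution on S(V, h_c^k). Define iteratively P₀ := I, T_k := h_c^{−1/2}(D²(F_{P_k} w_k)(0))^{1/2}, P_{k+1} := T_k P_k, and set δ_k := sup_{S(V, h_c^k)} |Φ − 1| and M_k := exp(1.12 (C₅/h_c) Σ_{j=0}^{k−2} δ_j) (with M₁ := 1). Then, assuming each D²(F_{P_k} w_k)(0) is positive definite so the square roots are defined, for all k ≥ 1: (a) B₁ ⊆ P_k S(V, h_c^k) ⊆ B₂; (b) ‖T_k^{−1}‖ ≤ (6/5) h_c^{1/2}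 < 1; (c) ‖P̆_k‖² ≤ C₂ M_k and ‖P̆_k^{−1}‖² ≤ c₂^{−1} M_k; and for all k ≥ 0: (d) |D²(w_{k+1} − w_k)(0)| ≤ C₂ (M_{k+2} − M_{k+1}); (e) sup_{B_{1/4}} |D³(F_{P_{k+1}}(w_{k+1} − w_k))| ≤ C₇ δ_k / h_c. -/

import Mathlib

open scoped RealInnerProductSpace
noncomputable section

abbrev Euc (n : ℕ) := EuclideanSpace ℝ (Fin n)

/-- Hessian matrix of `u` at `x`. -/
def hessianMatrix {n : ℕ} (u : Euc n → ℝ) (x : Euc n) : Matrix (Fin n) (Fin n) ℝ :=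
  Matrix.of fun i j =>
    iteratedFDeriv ℝ 2 u x ![EuclideanSpace.single i 1, EuclideanSpace.single j 1]

/-- Determinant of the Hessian of `u` at `x`. -/
def hessDet {n : ℕ} (u : Euc n → ℝ) (x : Euc n) : ℝ := (hessianMatrix u x).det

/-- Operator norm of a matrix induced by the Euclidean vector norm. -/
def matOpNorm {n : ℕ} (A : Matrix (Fin n) (Fin n) ℝ) : ℝ :=
  ‖(Matrix.toEuclideanCLM (𝕜 := ℝ) A : Euc n →L[ℝ] Euc n)‖

/-- The action `(F_T u)(y) = (det T)^{2/n} u(T⁻¹ y)` of an invertible linear map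
(given by the matrix `A`) on functions. -/
def affFT {n : ℕ} (A : Matrix (Fin n) (Fin n) ℝ) (u : Euc n → ℝ) (y : Euc n) : ℝ :=
  A.det ^ ((2 : ℝ) / n) * u (Matrix.toEuclideanLin A⁻¹ y)

/-- The rescaled matrix `Ă := (det A)^{−1/n} A` of unit determinant. -/
def breve {n : ℕ} (A : Matrix (Fin n) (Fin n) ℝ) : Matrix (Fin n) (Fin n) ℝ :=
  A.det ^ (-(1 : ℝ) / n) • A

section SecQA
open Filter Topology Set

/-! ### Two-jets of functions of one real variable -/

def J2 (f : ℝ → ℝ) (a b c : ℝ) : Prop :=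
  ∃ f' : ℝ → ℝ, f 0 = a ∧ (∀ᶠ t in 𝓝 (0:ℝ), HasDerivAt f (f' t) t) ∧ f' 0 = b ∧ HasDerivAt f' c 0

namespace J2
variable {f g : ℝ → ℝ} {a b c a' b' c' : ℝ}

lemma cast (h : J2 f a b c) (ha : a = a') (hb : b = b') (hc : c = c') : J2 f a' b' c' := by
  subst ha hb hc; exact h

lemma const (k : ℝ) : J2 (fun _ => k) k 0 0 :=
  ⟨fun _ => 0, rfl, Eventually.of_forall fun t => hasDerivAt_const t k, rfl, hasDerivAt_const 0 0⟩

lemma id : J2 (fun t => t) 0 1 0 :=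
  ⟨fun _ => 1, rfl, Eventually.of_forall fun t => hasDerivAt_id t, rfl, hasDerivAt_const 0 1⟩

lemma congr (h : J2 f a b c) (hfg : g =ᶠ[𝓝 0] f) : J2 g a b c := by
  obtain ⟨f', h0, h1, h2, h3⟩ := h
  refine ⟨f', ?_, ?_, h2, h3⟩
  · rw [hfg.eq_of_nhds, h0]
  · filter_upwards [h1, hfg.eventually_nhds] with t ht hg
    exact ht.congr_of_eventuallyEq hg

lemma add (hf : J2 f a b c) (hg : J2 g a' b' c') :
    J2 (fun t => f t + g t) (a + a') (b + b') (c + c') := by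
  obtain ⟨f', h0, h1, h2, h3⟩ := hf
  obtain ⟨g', k0, k1, k2, k3⟩ := hg
  refine ⟨fun t => f' t + g' t, by simp [h0, k0], ?_, by simp [h2, k2], h3.add k3⟩
  filter_upwards [h1, k1] with t ht kt
  exact ht.add kt

lemma mul (hf : J2 f a b c) (hg : J2 g a' b' c') :
    J2 (fun t => f t * g t) (a * a') (b * a' + a * b') (c * a' + 2 * (b * b') + a * c') := by
  obtain ⟨f', h0, h1, h2, h3⟩ := hf
  obtain ⟨g', k0, k1, k2, k3⟩ := hg
  refine ⟨fun t => f' t * g t + f t * g' t, by simp [h0, k0], ?_, by simp [h0, h2, k0, k2], ?_⟩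
  · filter_upwards [h1, k1] with t ht kt
    exact ht.mul kt
  · have := (h3.mul k1.self_of_nhds).add (h1.self_of_nhds.mul k3)
    refine this.congr_deriv ?_
    rw [h0, h2, k0, k2]; ring

lemma smul (k : ℝ) (hf : J2 f a b c) : J2 (fun t => k * f t) (k * a) (k * b) (k * c) :=
  ((const k).mul hf).cast rfl (by ring) (by ring)

lemma neg (hf : J2 f a b c) : J2 (fun t => - f t) (-a) (-b) (-c) :=
  ((hf.smul (-1)).congr (Eventually.of_forall fun t => by ring)).cast (by ring) (by ring) (by ring)

lemma sub (hf : J2 f a b c) (hg : J2 g a' b' c') :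
    J2 (fun t => f t - g t) (a - a') (b - b') (c - c') :=
  ((hf.add hg.neg).congr (Eventually.of_forall fun t => by ring)).cast (by ring) (by ring) (by ring)

lemma sum {ι : Type*} (s : Finset ι) {F : ι → ℝ → ℝ} {A B C : ι → ℝ}
    (h : ∀ i ∈ s, J2 (F i) (A i) (B i) (C i)) :
    J2 (fun t => ∑ i ∈ s, F i t) (∑ i ∈ s, A i) (∑ i ∈ s, B i) (∑ i ∈ s, C i) := by
  classical
  induction s using Finset.induction_on with
  | empty => simpa using const 0
  | insert i s hi ih =>
    simp only [Finset.sum_insert hi]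
    exact (h i (by simp)).add (ih fun j hj => h j (by simp [hj]))

lemma continuousAt (hf : J2 f a b c) : ContinuousAt f 0 := by
  obtain ⟨f', h0, h1, h2, h3⟩ := hf
  exact h1.self_of_nhds.continuousAt

lemma log (hf : J2 f a b c) (ha : 0 < a) :
    J2 (fun t => Real.log (f t)) (Real.log a) (b / a) (c / a - (b / a) ^ 2) := by
  have hcont := hf.continuousAt
  obtain ⟨f', h0, h1, h2, h3⟩ := hf
  have hpos : ∀ᶠ t in 𝓝 (0:ℝ), 0 < f t := hcont.eventually (lt_mem_nhds (by rw [h0]; exact ha))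
  refine ⟨fun t => f' t / f t, by simp [h0], ?_, by simp [h0, h2], ?_⟩
  · filter_upwards [h1, hpos] with t ht hp
    exact ht.log hp.ne'
  · have := h3.div h1.self_of_nhds (by rw [h0]; exact ha.ne')
    refine this.congr_deriv ?_
    rw [h0, h2]; field_simp

lemma max (hf : J2 f a b c) (hm : IsLocalMax f 0) : b = 0 ∧ c ≤ 0 := by
  obtain ⟨f', h0, h1, h2, h3⟩ := hf
  have hb : b = 0 := by rw [← h2]; exact hm.hasDerivAt_eq_zero h1.self_of_nhds
  refine ⟨hb, ?_⟩
  by_contra hc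
  push Not at hc
  -- derivative positive right of 0
  have hder : ∀ᶠ t in 𝓝 (0:ℝ), deriv f t = f' t := h1.mono fun t ht => ht.deriv
  have h3' : HasDerivAt (deriv f) c 0 := h3.congr_of_eventuallyEq hder
  have hmin : IsLocalMin f 0 := by
    apply isLocalMin_of_deriv_deriv_pos
    · rw [h3'.deriv]; exact hc
    · rw [h1.self_of_nhds.deriv, h2, hb]
    · exact h1.self_of_nhds.continuousAt
  have hconst : ∀ᶠ t in 𝓝 (0:ℝ), f t = f 0 := by
    filter_upwards [hm, hmin] with t h1 h2
    exact le_antisymm h1 h2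
  have hd0 : ∀ᶠ t in 𝓝 (0:ℝ), deriv f t = 0 := by
    filter_upwards [hconst.eventually_nhds] with t ht
    have : f =ᶠ[𝓝 t] fun _ => f 0 := ht
    rw [this.deriv_eq]; simp
  have : deriv (deriv f) 0 = 0 := by
    have h : deriv f =ᶠ[𝓝 0] fun _ => (0:ℝ) := hd0
    rw [h.deriv_eq]; simp
  rw [h3'.deriv] at this
  linarith

end J2

/-! ### Directional derivatives -/

variable {n : ℕ}

def dd (v : Euc n) (f : Euc n → ℝ) : Euc n → ℝ := fun x => fderiv ℝ f x v

/-- smooth on U -/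
def Sm (U : Set (Euc n)) (f : Euc n → ℝ) : Prop := ContDiffOn ℝ (⊤ : ℕ∞) f U

lemma hasDerivAt_line {f : Euc n → ℝ} {x v : Euc n} {t : ℝ} (h : DifferentiableAt ℝ f (x + t • v)) :
    HasDerivAt (fun s : ℝ => f (x + s • v)) (dd v f (x + t • v)) t := by
  have h1 : HasDerivAt (fun s : ℝ => x + s • v) v t := by
    simpa using ((hasDerivAt_id t).smul_const v).const_add x
  exact h.hasFDerivAt.comp_hasDerivAt t h1

lemma line_tendsto (x v : Euc n) : Tendsto (fun t : ℝ => x + t • v) (𝓝 0) (𝓝 x) := by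
  have : ContinuousAt (fun t : ℝ => x + t • v) 0 := by fun_prop
  simpa [ContinuousAt] using this

lemma contDiffAt_dd {f : Euc n → ℝ} {x : Euc n} {m : WithTop ℕ∞} (h : ContDiffAt ℝ (m + 1) f x) (v : Euc n) :
    ContDiffAt ℝ m (dd v f) x := by
  have := h.fderiv_right (m := m) le_rfl
  exact this.clm_apply contDiffAt_const

lemma J2_line {f : Euc n → ℝ} {x : Euc n} (h : ContDiffAt ℝ 2 f x) (v : Euc n) :
    J2 (fun t => f (x + t • v)) (f x) (dd v f x) (dd v (dd v f) x) := by
  refine ⟨fun t => dd v f (x + t • v), by simp, ?_, by simp, ?_⟩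
  · have h1 : ∀ᶠ y in 𝓝 x, ContDiffAt ℝ 2 f y := h.eventually (by simp)
    filter_upwards [(line_tendsto x v).eventually h1] with t ht
    exact hasDerivAt_line (ht.differentiableAt (by norm_num))
  · have : ContDiffAt ℝ 1 (dd v f) x := contDiffAt_dd (by simpa [one_add_one_eq_two] using h) v
    have := hasDerivAt_line (f := dd v f) (x := x) (v := v) (t := 0)
      (by simpa using this.differentiableAt (by norm_num))
    simpa using this

lemma dd_add_left (u v : Euc n) (f : Euc n → ℝ) : dd (u + v) f = fun x => dd u f x + dd v f x := by
  ext x; simp [dd]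

lemma dd_smul_left (a : ℝ) (v : Euc n) (f : Euc n → ℝ) : dd (a • v) f = fun x => a * dd v f x := by
  ext x; simp [dd]

lemma dd_sum_left {ι : Type*} (s : Finset ι) (v : ι → Euc n) (f : Euc n → ℝ) :
    dd (∑ i ∈ s, v i) f = fun x => ∑ i ∈ s, dd (v i) f x := by
  ext x; simp [dd]

lemma dd_comm_at {f : Euc n → ℝ} {x : Euc n} (h : ContDiffAt ℝ 2 f x) (u v : Euc n) :
    dd u (dd v f) x = dd v (dd u f) x := by
  have hs : IsSymmSndFDerivAt ℝ f x := h.isSymmSndFDerivAt (by simp)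
  have hd : DifferentiableAt ℝ (fderiv ℝ f) x :=
    (h.fderiv_right (m := 1) (by norm_num)).differentiableAt (by norm_num)
  have key : ∀ a b : Euc n, dd a (dd b f) x = fderiv ℝ (fderiv ℝ f) x a b := by
    intro a b
    change fderiv ℝ (fun y => fderiv ℝ f y b) x a = _
    rw [fderiv_clm_apply hd (by fun_prop)]
    simp
  rw [key, key]; exact hs u v

lemma dd_congr {f g : Euc n → ℝ} {U : Set (Euc n)} (hU : IsOpen U) (h : ∀ x ∈ U, f x = g x) (v : Euc n) :
    ∀ x ∈ U, dd v f x = dd v g x := by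
  intro x hx
  have : f =ᶠ[𝓝 x] g := by
    filter_upwards [hU.mem_nhds hx] with y hy using h y hy
  simp [dd, this.fderiv_eq]

lemma hessianMatrix_apply {f : Euc n → ℝ} {x : Euc n} (h : ContDiffAt ℝ 2 f x) (i j : Fin n) :
    hessianMatrix f x i j = dd (EuclideanSpace.single i 1) (dd (EuclideanSpace.single j 1) f) x := by
  have hd : DifferentiableAt ℝ (fderiv ℝ f) x :=
    (h.fderiv_right (m := 1) (by norm_num)).differentiableAt (by norm_num)
  simp only [hessianMatrix, Matrix.of_apply, iteratedFDeriv_two_apply]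
  change _ = fderiv ℝ (fun y => fderiv ℝ f y _) x _
  rw [fderiv_clm_apply hd (by fun_prop)]
  simp

namespace Sm
variable {U : Set (Euc n)} {f g : Euc n → ℝ}

lemma cda (h : Sm U f) (hU : IsOpen U) {x : Euc n} (hx : x ∈ U) (m : ℕ) : ContDiffAt ℝ m f x :=
  (ContDiffOn.contDiffAt h (hU.mem_nhds hx)).of_le (by exact_mod_cast le_top)

lemma cda2 (h : Sm U f) (hU : IsOpen U) {x : Euc n} (hx : x ∈ U) : ContDiffAt ℝ 2 f x :=
  h.cda hU hx 2

lemma dd (h : Sm U f) (hU : IsOpen U) (v : Euc n) : Sm U (dd v f) := by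
  have := ContDiffOn.fderiv_of_isOpen (m := ((⊤ : ℕ∞) : WithTop ℕ∞)) h hU (by simp)
  exact ContDiffOn.clm_apply this contDiffOn_const

lemma mono {V : Set (Euc n)} (h : Sm U f) (hV : V ⊆ U) : Sm V f := ContDiffOn.mono h hV

lemma diff (h : Sm U f) (hU : IsOpen U) {x : Euc n} (hx : x ∈ U) : DifferentiableAt ℝ f x :=
  (h.cda hU hx 1).differentiableAt (by norm_num)

lemma cont (h : Sm U f) : ContinuousOn f U := ContDiffOn.continuousOn h

lemma add (hf : Sm U f) (hg : Sm U g) : Sm U (fun x => f x + g x) := ContDiffOn.add hf hg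
lemma sub (hf : Sm U f) (hg : Sm U g) : Sm U (fun x => f x - g x) := ContDiffOn.sub hf hg
lemma neg (hf : Sm U f) : Sm U (fun x => - f x) := ContDiffOn.neg hf
lemma mul (hf : Sm U f) (hg : Sm U g) : Sm U (fun x => f x * g x) := ContDiffOn.mul hf hg
lemma const (c : ℝ) : Sm U (fun _ => c) := contDiffOn_const
lemma sum {ι : Type*} (s : Finset ι) {F : ι → Euc n → ℝ} (h : ∀ i ∈ s, Sm U (F i)) :
    Sm U (fun x => ∑ i ∈ s, F i x) := ContDiffOn.sum h
lemma congr (hf : Sm U f) (h : ∀ x ∈ U, g x = f x) : Sm U g := ContDiffOn.congr hf h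
end Sm

section rules
variable {U : Set (Euc n)} {f g : Euc n → ℝ} {x : Euc n}

lemma dd_add (hf : DifferentiableAt ℝ f x) (hg : DifferentiableAt ℝ g x) (v : Euc n) :
    dd v (fun x => f x + g x) x = dd v f x + dd v g x := by
  simp only [dd]; rw [fderiv_fun_add hf hg]; rfl
lemma dd_sub (hf : DifferentiableAt ℝ f x) (hg : DifferentiableAt ℝ g x) (v : Euc n) :
    dd v (fun x => f x - g x) x = dd v f x - dd v g x := by
  simp only [dd]; rw [fderiv_fun_sub hf hg]; rfl
lemma dd_neg (v : Euc n) : dd v (fun x => - f x) x = - dd v f x := by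
  simp only [dd]; rw [fderiv_fun_neg]; rfl
lemma dd_mul (hf : DifferentiableAt ℝ f x) (hg : DifferentiableAt ℝ g x) (v : Euc n) :
    dd v (fun x => f x * g x) x = dd v f x * g x + f x * dd v g x := by
  simp only [dd]; rw [fderiv_fun_mul hf hg]; simp; ring
lemma dd_const (c : ℝ) (v : Euc n) : dd v (fun _ => c) x = 0 := by simp [dd]
lemma dd_cmul (hf : DifferentiableAt ℝ f x) (c : ℝ) (v : Euc n) :
    dd v (fun x => c * f x) x = c * dd v f x := by
  rw [dd_mul (by fun_prop) hf, dd_const]; ring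
lemma dd_sum {ι : Type*} (s : Finset ι) {F : ι → Euc n → ℝ} (h : ∀ i ∈ s, DifferentiableAt ℝ (F i) x) (v : Euc n) :
    dd v (fun x => ∑ i ∈ s, F i x) x = ∑ i ∈ s, dd v (F i) x := by
  simp only [dd]; rw [fderiv_fun_sum h]; simp
lemma dd_comm (hf : Sm U f) (hU : IsOpen U) (hx : x ∈ U) (u v : Euc n) :
    dd u (dd v f) x = dd v (dd u f) x := dd_comm_at (hf.cda2 hU hx) u v
end rules
end SecQA

section SecQB
open Filter Topology Set
variable {n : ℕ}

/-! ### Derivative of determinants and inverses, entrywise -/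

/-- entrywise derivative of matrix valued curve -/
def MD (M : ℝ → Matrix (Fin n) (Fin n) ℝ) (M' : Matrix (Fin n) (Fin n) ℝ) (t : ℝ) : Prop :=
  ∀ i j, HasDerivAt (fun s => M s i j) (M' i j) t

namespace MD
variable {M N : ℝ → Matrix (Fin n) (Fin n) ℝ} {M' N' : Matrix (Fin n) (Fin n) ℝ} {t : ℝ}

lemma mul (hM : MD M M' t) (hN : MD N N' t) : MD (fun s => M s * N s) (M' * N t + M t * N') t := by
  intro i j
  simp only [Matrix.mul_apply, Matrix.add_apply, ← Finset.sum_add_distrib]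
  exact HasDerivAt.fun_sum fun k _ => (hM i k).mul (hN k j)

lemma const (A : Matrix (Fin n) (Fin n) ℝ) : MD (fun _ => A) 0 t := fun i j => hasDerivAt_const t _

lemma congr (hM : MD M M' t) (h : N =ᶠ[𝓝 t] M) : MD N M' t := fun i j =>
  (hM i j).congr_of_eventuallyEq (by filter_upwards [h] with s hs; rw [hs])

lemma unique (hM : MD M M' t) (hN : MD M N' t) : M' = N' := by
  ext i j; exact (hM i j).unique (hN i j)

lemma trace (hM : MD M M' t) : HasDerivAt (fun s => (M s).trace) M'.trace t := by
  simp only [Matrix.trace, Matrix.diag]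
  exact HasDerivAt.fun_sum fun k _ => hM k k

lemma det_diff (hM : MD M M' t) : DifferentiableAt ℝ (fun s => (M s).det) t := by
  simp only [Matrix.det_apply]
  apply DifferentiableAt.fun_sum
  intro σ _
  apply DifferentiableAt.const_smul
  exact DifferentiableAt.fun_finsetProd fun i _ => (hM (σ i) i).differentiableAt

lemma det_one (hM : MD M M' t) (h1 : M t = 1) : HasDerivAt (fun s => (M s).det) M'.trace t := by
  let f : (Fin n → Fin n → ℝ) → ℝ := fun A => (Matrix.of A).det
  have hf : DifferentiableAt ℝ f (fun i j => (1 : Matrix (Fin n) (Fin n) ℝ) i j) := by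
    simp only [f, Matrix.det_apply]
    apply DifferentiableAt.fun_sum
    intro σ _
    apply DifferentiableAt.const_smul
    simp only [Matrix.of_apply]
    exact (contDiff_prod (n := 1) fun i _ => by fun_prop).contDiffAt.differentiableAt (by norm_num)
  have hX : ∀ X : Fin n → Fin n → ℝ, fderiv ℝ f (fun i j => (1 : Matrix (Fin n) (Fin n) ℝ) i j) X
      = (Matrix.of X).trace := by
    intro X
    have hl : HasDerivAt (fun s : ℝ => (fun i j => (1 : Matrix (Fin n) (Fin n) ℝ) i j + s * X i j)) X 0 := by
      rw [hasDerivAt_pi]; intro i; rw [hasDerivAt_pi]; intro j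
      simpa using ((hasDerivAt_id (0:ℝ)).mul_const (X i j)).const_add ((1 : Matrix (Fin n) (Fin n) ℝ) i j)
    have h2 := HasFDerivAt.comp_hasDerivAt_of_eq (0:ℝ) hf.hasFDerivAt hl (by ext i j; simp)
    have h3 : HasDerivAt (fun s : ℝ => (1 + s • Matrix.of X).det) (Matrix.of X).trace 0 := by
      set p := (Matrix.det (1 + (Polynomial.X : Polynomial ℝ) • (Matrix.of X).map Polynomial.C)).divX.divX
      have hp : HasDerivAt (fun s : ℝ => 1 + (Matrix.of X).trace * s + p.eval s * s ^ 2)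
          ((Matrix.of X).trace * 1 + ((p.derivative).eval 0 * 0 ^ 2 + p.eval 0 * (2 * 0 ^ (2-1) * 1))) 0 :=
        (((hasDerivAt_id (0:ℝ)).const_mul _).const_add 1).add ((p.hasDerivAt 0).mul ((hasDerivAt_id (0:ℝ)).pow 2))
      simp only [mul_one, ne_eq, OfNat.ofNat_ne_zero, not_false_eq_true, zero_pow, mul_zero, add_zero] at hp
      norm_num at hp
      refine hp.congr_of_eventuallyEq (Eventually.of_forall fun s => ?_)
      exact Matrix.det_one_add_smul s (Matrix.of X)
    refine h2.unique (h3.congr_of_eventuallyEq (Eventually.of_forall fun s => ?_))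
    simp only [f, Function.comp]
    congr 1
  have hc : HasDerivAt (fun s => (fun i j => M s i j)) (fun i j => M' i j) t := by
    rw [hasDerivAt_pi]; intro i; rw [hasDerivAt_pi]; intro j; exact hM i j
  have := HasFDerivAt.comp_hasDerivAt_of_eq t hf.hasFDerivAt hc (by rw [h1])
  rw [hX] at this
  exact this

lemma det (hM : MD M M' t) (hu : (M t).det ≠ 0) :
    HasDerivAt (fun s => (M s).det) ((M t).det * ((M t)⁻¹ * M').trace) t := by
  have hu' : IsUnit (M t).det := isUnit_iff_ne_zero.2 hu
  have h1 := ((const (t := t) ((M t)⁻¹)).mul hM).det_one (Matrix.nonsing_inv_mul _ hu')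
  have h2 := h1.const_mul ((M t).det)
  simp only [Matrix.det_mul, zero_mul, zero_add] at h2
  refine h2.congr_of_eventuallyEq (Eventually.of_forall fun s => ?_)
  have : (M t).det * ((M t)⁻¹).det = 1 := by
    rw [← Matrix.det_mul, Matrix.mul_nonsing_inv _ hu', Matrix.det_one]
  simp only []
  rw [← mul_assoc, this, one_mul]

lemma inv (hM : MD M M' t) (hu : (M t).det ≠ 0) :
    MD (fun s => (M s)⁻¹) (-((M t)⁻¹ * M' * (M t)⁻¹)) t := by
  have hu' : IsUnit (M t).det := isUnit_iff_ne_zero.2 hu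
  have hev : ∀ᶠ s in 𝓝 t, (M s).det ≠ 0 := hM.det_diff.continuousAt.eventually_ne hu
  -- differentiable
  have hd : ∀ i j, DifferentiableAt ℝ (fun s => (M s)⁻¹ i j) t := by
    intro i j
    simp only [Matrix.inv_def, Matrix.smul_apply, Ring.inverse_eq_inv', smul_eq_mul]
    refine (hM.det_diff.inv hu).mul ?_
    simp only [Matrix.adjugate_apply]
    simp only [Matrix.det_apply]
    apply DifferentiableAt.fun_sum
    intro σ _
    apply DifferentiableAt.const_smul
    apply DifferentiableAt.fun_finsetProd
    intro k _
    simp only [Matrix.updateRow_apply]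
    split_ifs
    · fun_prop
    · exact (hM _ _).differentiableAt
  let D : Matrix (Fin n) (Fin n) ℝ := Matrix.of fun i j => deriv (fun s => (M s)⁻¹ i j) t
  have hD : MD (fun s => (M s)⁻¹) D t := fun i j => (hd i j).hasDerivAt
  have h1 : MD (fun s => M s * (M s)⁻¹) 0 t := (const 1).congr (by
    filter_upwards [hev] with s hs
    exact Matrix.mul_nonsing_inv _ (isUnit_iff_ne_zero.2 hs))
  have h2 := (hM.mul hD).unique h1
  have h3 : D = -((M t)⁻¹ * M' * (M t)⁻¹) := by
    have : (M t)⁻¹ * (M' * (M t)⁻¹ + M t * D) = 0 := by rw [h2]; simp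
    rw [mul_add, ← mul_assoc, ← mul_assoc, Matrix.nonsing_inv_mul _ hu', one_mul] at this
    exact eq_neg_of_add_eq_zero_right this
  rw [← h3]; exact hD
end MD

/-- trace identities for curves of matrices with constant determinant -/
lemma trace_ids {M0 M1 M2 : ℝ → Matrix (Fin n) (Fin n) ℝ} {c : ℝ} (hc : c ≠ 0)
    (h0 : ∀ᶠ t in 𝓝 (0:ℝ), MD M0 (M1 t) t) (h1 : ∀ᶠ t in 𝓝 (0:ℝ), MD M1 (M2 t) t)
    (hdet : ∀ᶠ t in 𝓝 (0:ℝ), (M0 t).det = c) (hI : M0 0 = 1) :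
    (M1 0).trace = 0 ∧ (M2 0).trace = (M1 0 * M1 0).trace ∧
    ∀ M3, MD M2 M3 0 → M3.trace = 3 * (M1 0 * M2 0).trace - 2 * (M1 0 * M1 0 * M1 0).trace := by
  have e1 : ∀ᶠ t in 𝓝 (0:ℝ), ((M0 t)⁻¹ * M1 t).trace = 0 := by
    filter_upwards [h0, hdet.eventually_nhds] with t ht hd
    have hd0 := hd.self_of_nhds
    have := ht.det (by rw [hd0]; exact hc)
    have h2 : HasDerivAt (fun s => (M0 s).det) 0 t :=
      (hasDerivAt_const t c).congr_of_eventuallyEq hd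
    have h3 := this.unique h2
    rw [hd0] at h3
    exact (mul_eq_zero.1 h3).resolve_left hc
  have hd2 : ∀ᶠ t in 𝓝 (0:ℝ), MD (fun s => (M0 s)⁻¹ * M1 s)
      (-((M0 t)⁻¹ * M1 t * (M0 t)⁻¹) * M1 t + (M0 t)⁻¹ * M2 t) t := by
    filter_upwards [h0, h1, hdet] with t a b d
    exact (a.inv (by rw [d]; exact hc)).mul b
  have e2 : ∀ᶠ t in 𝓝 (0:ℝ), (-((M0 t)⁻¹ * M1 t * (M0 t)⁻¹) * M1 t + (M0 t)⁻¹ * M2 t).trace = 0 := by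
    filter_upwards [hd2, e1.eventually_nhds] with t a b
    exact a.trace.unique ((hasDerivAt_const t 0).congr_of_eventuallyEq b)
  refine ⟨by simpa [hI] using e1.self_of_nhds, ?_, ?_⟩
  · have := e2.self_of_nhds
    simp only [hI, Matrix.trace_add, inv_one, one_mul, mul_one, neg_mul, Matrix.trace_neg] at this
    linarith
  · intro M3 h3
    have hinv := h0.self_of_nhds.inv (by rw [hdet.self_of_nhds]; exact hc)
    have H := ((((((MD.const (t := 0) (-1)).mul hinv).mul h1.self_of_nhds).mul hinv).mul h1.self_of_nhds)).trace.add
      (hinv.mul h3).trace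
    have H2 := H.unique ((hasDerivAt_const 0 0).congr_of_eventuallyEq (by
      filter_upwards [e2] with t ht
      rw [Matrix.trace_add] at ht
      simp only [Pi.add_apply]
      rw [← ht]; congr 2; simp [mul_assoc]))
    simp only [hI, inv_one, one_mul, mul_one, zero_mul, zero_add, neg_mul, mul_neg, neg_neg, add_mul, mul_add,
      Matrix.trace_add, Matrix.trace_neg] at H2
    rw [Matrix.trace_mul_comm (M2 0) (M1 0)] at H2
    linarith
end SecQB

section SecQC
open Filter Topology Set
variable {n : ℕ}

/-! ### Linear algebra -/
open scoped MatrixOrder in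
lemma exists_frame {A : Matrix (Fin n) (Fin n) ℝ} (hA : A.PosDef) :
    ∃ R : Matrix (Fin n) (Fin n) ℝ, R.det ≠ 0 ∧ R.transpose * A * R = 1 := by
  obtain ⟨y, hy, hAy⟩ := CStarAlgebra.isStrictlyPositive_iff_eq_star_mul_self.mp hA.isStrictlyPositive
  have hu : IsUnit y.det := (Matrix.isUnit_iff_isUnit_det y).1 hy
  refine ⟨y⁻¹, ?_, ?_⟩
  · exact (Matrix.isUnit_nonsing_inv_det y hu).ne_zero
  · rw [hAy, Matrix.star_eq_conjTranspose, Matrix.conjTranspose_eq_transpose_of_trivial,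
      ← mul_assoc, mul_assoc, Matrix.mul_nonsing_inv _ hu, mul_one, Matrix.transpose_nonsing_inv,
      Matrix.nonsing_inv_mul]
    rw [Matrix.det_transpose]; exact hu

lemma symm_herm {A : Matrix (Fin n) (Fin n) ℝ} (h : A.transpose = A) : A.IsHermitian := by
  rw [Matrix.IsHermitian, Matrix.conjTranspose_eq_transpose_of_trivial, h]

lemma herm_symm {A : Matrix (Fin n) (Fin n) ℝ} (h : A.IsHermitian) : A.transpose = A := by
  rw [Matrix.IsHermitian, Matrix.conjTranspose_eq_transpose_of_trivial] at h; exact h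

lemma psd_of {A : Matrix (Fin n) (Fin n) ℝ} (h : A.transpose = A) (h2 : ∀ v, 0 ≤ v ⬝ᵥ (A.mulVec v)) :
    A.PosSemidef := Matrix.PosSemidef.of_dotProduct_mulVec_nonneg (symm_herm h) (by simpa using h2)

lemma pd_of {A : Matrix (Fin n) (Fin n) ℝ} (h : A.transpose = A) (h2 : ∀ v, v ≠ 0 → 0 < v ⬝ᵥ (A.mulVec v)) :
    A.PosDef := Matrix.PosDef.of_dotProduct_mulVec_pos (symm_herm h) (by simpa using h2)

lemma psd_qf {A : Matrix (Fin n) (Fin n) ℝ} (h : A.PosSemidef) (v : Fin n → ℝ) :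
    0 ≤ v ⬝ᵥ (A.mulVec v) := by simpa using h.dotProduct_mulVec_nonneg v

lemma pd_qf {A : Matrix (Fin n) (Fin n) ℝ} (h : A.PosDef) {v : Fin n → ℝ} (hv : v ≠ 0) :
    0 < v ⬝ᵥ (A.mulVec v) := by simpa using h.dotProduct_mulVec_pos hv

lemma eig_ge {A : Matrix (Fin n) (Fin n) ℝ} (hA : A.IsHermitian) {c : ℝ}
    (h : ∀ v : Fin n → ℝ, c * (v ⬝ᵥ v) ≤ v ⬝ᵥ (A.mulVec v)) (i : Fin n) : c ≤ hA.eigenvalues i := by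
  have h1 := hA.mulVec_eigenvectorBasis i
  have h2 := h (hA.eigenvectorBasis i)
  rw [h1] at h2
  have h3 : ((hA.eigenvectorBasis i : EuclideanSpace ℝ (Fin n)).ofLp ⬝ᵥ (hA.eigenvectorBasis i : EuclideanSpace ℝ (Fin n)).ofLp) = 1 := by
    have := hA.eigenvectorBasis.orthonormal.1 i
    have h4 : inner ℝ (hA.eigenvectorBasis i) (hA.eigenvectorBasis i) = (1:ℝ) := by
      rw [real_inner_self_eq_norm_sq, this]; norm_num
    rw [EuclideanSpace.inner_eq_star_dotProduct] at h4
    simpa using h4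
  simp only [dotProduct_smul, h3, smul_eq_mul, mul_one] at h2
  exact h2

lemma eig_le {A : Matrix (Fin n) (Fin n) ℝ} (hA : A.IsHermitian) {c : ℝ}
    (h : ∀ v : Fin n → ℝ, v ⬝ᵥ (A.mulVec v) ≤ c * (v ⬝ᵥ v)) (i : Fin n) : hA.eigenvalues i ≤ c := by
  have h1 := hA.mulVec_eigenvectorBasis i
  have h2 := h (hA.eigenvectorBasis i)
  rw [h1] at h2
  have h3 : ((hA.eigenvectorBasis i : EuclideanSpace ℝ (Fin n)).ofLp ⬝ᵥ (hA.eigenvectorBasis i : EuclideanSpace ℝ (Fin n)).ofLp) = 1 := by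
    have := hA.eigenvectorBasis.orthonormal.1 i
    have h4 : inner ℝ (hA.eigenvectorBasis i) (hA.eigenvectorBasis i) = (1:ℝ) := by
      rw [real_inner_self_eq_norm_sq, this]; norm_num
    rw [EuclideanSpace.inner_eq_star_dotProduct] at h4
    simpa using h4
  simp only [dotProduct_smul, h3, smul_eq_mul, mul_one] at h2
  exact h2

lemma det_ge_one {C : Matrix (Fin n) (Fin n) ℝ} (hC : C.transpose = C)
    (h : ∀ v : Fin n → ℝ, v ⬝ᵥ v ≤ v ⬝ᵥ (C.mulVec v)) : 1 ≤ C.det := by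
  rw [(symm_herm hC).det_eq_prod_eigenvalues]
  have : ∀ i, 1 ≤ (symm_herm hC).eigenvalues i := eig_ge _ (by simpa using h)
  simpa using Finset.prod_le_prod (s := Finset.univ) (f := fun _ : Fin n => (1:ℝ))
    (fun i _ => zero_le_one) (fun i _ => this i)

lemma qf_conj (R A : Matrix (Fin n) (Fin n) ℝ) (v : Fin n → ℝ) :
    v ⬝ᵥ ((R.transpose * A * R).mulVec v) = (R.mulVec v) ⬝ᵥ (A.mulVec (R.mulVec v)) := by
  rw [← Matrix.mulVec_mulVec, ← Matrix.mulVec_mulVec, Matrix.dotProduct_mulVec v,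
    Matrix.vecMul_transpose]

lemma det_mono {A B : Matrix (Fin n) (Fin n) ℝ} (hA : A.PosSemidef) (hB : B.transpose = B)
    (h : ∀ v, v ⬝ᵥ (A.mulVec v) ≤ v ⬝ᵥ (B.mulVec v)) : A.det ≤ B.det := by
  have hBp : B.PosSemidef := psd_of hB fun v => (psd_qf hA v).trans (h v)
  by_cases h0 : A.det = 0
  · rw [h0]; exact hBp.det_nonneg
  · have hp : A.PosDef := hA.posDef_iff_det_ne_zero.2 h0
    obtain ⟨R, hR, hRA⟩ := exists_frame hp
    have h1 : 1 ≤ (R.transpose * B * R).det := by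
      apply det_ge_one
      · simp [Matrix.transpose_mul, hB, mul_assoc]
      · intro v
        rw [qf_conj]
        refine le_trans ?_ (h _)
        rw [← qf_conj, hRA, Matrix.one_mulVec]
    have h2 : (R.transpose * A * R).det = 1 := by rw [hRA, Matrix.det_one]
    simp only [Matrix.det_mul, Matrix.det_transpose] at h1 h2
    have hR2 : 0 < R.det * R.det := mul_self_pos.2 hR
    nlinarith

lemma trace_ge {C : Matrix (Fin n) (Fin n) ℝ} (hC : C.PosDef) (hd : C.det = 1) : (n : ℝ) ≤ C.trace := by
  have h1 := hC.isHermitian.det_eq_prod_eigenvalues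
  rw [hC.isHermitian.trace_eq_sum_eigenvalues]
  simp only [RCLike.ofReal_real_eq_id, id] at h1 ⊢
  have h2 : ∑ i, Real.log (hC.isHermitian.eigenvalues i) = 0 := by
    rw [← Real.log_prod (fun i _ => (hC.eigenvalues_pos i).ne'), ← h1, hd, Real.log_one]
  have h3 : ∑ i, Real.log (hC.isHermitian.eigenvalues i) ≤ ∑ i, (hC.isHermitian.eigenvalues i - 1) :=
    Finset.sum_le_sum fun i _ => Real.log_le_sub_one_of_pos (hC.eigenvalues_pos i)
  rw [h2, Finset.sum_sub_distrib] at h3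
  simp at h3
  linarith

/-! ### Hessians and directional derivatives -/

lemma euc_sum (v : Euc n) : v = ∑ i, v i • (EuclideanSpace.single i (1:ℝ) : Euc n) := by
  ext j
  simp [Finset.sum_apply, Pi.single_apply]

lemma dd_exp {f : Euc n → ℝ} (v : Euc n) : dd v f = fun x => ∑ i, v i * dd (EuclideanSpace.single i 1) f x := by
  conv_lhs => rw [euc_sum v, dd_sum_left]
  simp only [dd_smul_left]

lemma ddd_exp {f : Euc n → ℝ} {x : Euc n} (h : ContDiffAt ℝ 2 f x) (u v : Euc n) :
    dd u (dd v f) x = ∑ i, ∑ j, u i * v j * hessianMatrix f x i j := by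
  have hdf : ∀ a, DifferentiableAt ℝ (dd a f) x := fun a =>
    (contDiffAt_dd (m := 1) (by simpa [one_add_one_eq_two] using h) a).differentiableAt (by norm_num)
  rw [dd_exp u]
  simp only
  refine Finset.sum_congr rfl fun i _ => ?_
  rw [dd_exp v, dd_sum _ (fun j _ => (hdf _).const_mul _), Finset.mul_sum]
  refine Finset.sum_congr rfl fun j _ => ?_
  rw [dd_cmul (hdf _), hessianMatrix_apply h]; ring

lemma qf_hess {f : Euc n → ℝ} {x : Euc n} (h : ContDiffAt ℝ 2 f x) (u v : Fin n → ℝ) :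
    u ⬝ᵥ ((hessianMatrix f x).mulVec v) = dd (WithLp.toLp 2 u) (dd (WithLp.toLp 2 v) f) x := by
  rw [ddd_exp h]
  simp only [dotProduct, Matrix.mulVec, Finset.mul_sum]
  refine Finset.sum_congr rfl fun i _ => Finset.sum_congr rfl fun j _ => ?_
  ring

lemma hess_symm {f : Euc n → ℝ} {x : Euc n} (h : ContDiffAt ℝ 2 f x) :
    (hessianMatrix f x).transpose = hessianMatrix f x := by
  ext i j
  rw [Matrix.transpose_apply, hessianMatrix_apply h, hessianMatrix_apply h, dd_comm_at h]

lemma hess_psd {f : Euc n → ℝ} {x : Euc n} (h : ContDiffAt ℝ 2 f x) (h2 : ∀ v, 0 ≤ dd v (dd v f) x) :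
    (hessianMatrix f x).PosSemidef :=
  psd_of (hess_symm h) fun v => by rw [qf_hess h]; exact h2 _

lemma hess_pd_of_det {f : Euc n → ℝ} {x : Euc n} (h : ContDiffAt ℝ 2 f x) (h2 : ∀ v, 0 ≤ dd v (dd v f) x)
    (hd : hessDet f x ≠ 0) : (hessianMatrix f x).PosDef :=
  (hess_psd h h2).posDef_iff_det_ne_zero.2 hd

lemma hess_pd_pos {f : Euc n → ℝ} {x : Euc n} (h : ContDiffAt ℝ 2 f x) (h2 : (hessianMatrix f x).PosDef)
    {v : Euc n} (hv : v ≠ 0) : 0 < dd v (dd v f) x := by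
  have := pd_qf h2 (v := v.ofLp) (by simpa using hv)
  rw [qf_hess h] at this
  simpa using this

lemma localMax_hess {f : Euc n → ℝ} {x : Euc n} (h : ContDiffAt ℝ 2 f x) (hm : IsLocalMax f x) (v : Euc n) :
    dd v f x = 0 ∧ dd v (dd v f) x ≤ 0 := by
  apply (J2_line h v).max
  have := (line_tendsto x v).eventually hm
  filter_upwards [this] with t ht
  simpa using ht

lemma dd_neg_left (v : Euc n) (f : Euc n → ℝ) : dd (-v) f = fun x => - dd v f x := by
  ext x; simp [dd]

lemma convex_hess {f : Euc n → ℝ} {U : Set (Euc n)} (hU : IsOpen U) (hc : ConvexOn ℝ U f) {x : Euc n}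
    (hx : x ∈ U) (h : ContDiffAt ℝ 2 f x) (v : Euc n) : 0 ≤ dd v (dd v f) x := by
  have h1 := (J2_line h v).add (J2_line h (-v))
  have hm : IsLocalMax (fun t : ℝ => -(f (x + t • v) + f (x + t • (-v)))) 0 := by
    filter_upwards [(line_tendsto x v).eventually (hU.mem_nhds hx),
      (line_tendsto x (-v)).eventually (hU.mem_nhds hx)] with t h1 h2
    have := hc.2 h1 h2 (by norm_num : (0:ℝ) ≤ 1/2) (by norm_num : (0:ℝ) ≤ 1/2) (by norm_num)
    have e : (1/2:ℝ) • (x + t • v) + (1/2:ℝ) • (x + t • (-v)) = x := by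
      simp only [smul_add, smul_neg, ← smul_smul]; module
    rw [e] at this
    simp only [zero_smul, add_zero, smul_eq_mul] at this ⊢
    linarith
  have h3 := (h1.neg.max hm).2
  have hdf : DifferentiableAt ℝ (dd v f) x :=
    (contDiffAt_dd (m := 1) (by simpa [one_add_one_eq_two] using h) v).differentiableAt (by norm_num)
  have h4 : dd (-v) (dd (-v) f) x = dd v (dd v f) x := by
    rw [dd_neg_left v f, dd_neg, dd_neg_left]; simp
  rw [h4] at h3
  linarith

theorem comparison {Ω : Set (Euc n)} (hΩ : IsOpen Ω) (hb : Bornology.IsBounded Ω) {b u : Euc n → ℝ}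
    (hbc : ContinuousOn b (closure Ω)) (huc : ContinuousOn u (closure Ω))
    (hb2 : ∀ x ∈ Ω, ContDiffAt ℝ 2 b x) (hu2 : ∀ x ∈ Ω, ContDiffAt ℝ 2 u x)
    (hconv : ∀ x ∈ Ω, ∀ v, 0 ≤ dd v (dd v b) x) (hdet : ∀ x ∈ Ω, hessDet u x < hessDet b x)
    (hbd : ∀ x ∈ frontier Ω, b x ≤ u x) : ∀ x ∈ closure Ω, b x ≤ u x := by
  intro x hx
  by_contra hlt
  push Not at hlt
  have hK : IsCompact (closure Ω) := hb.isCompact_closure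
  obtain ⟨y, hy, hmax⟩ := hK.exists_isMaxOn ⟨x, hx⟩ (hbc.sub huc)
  have hyv : 0 < b y - u y := lt_of_lt_of_le (by linarith : 0 < b x - u x) (hmax hx)
  have hyΩ : y ∈ Ω := by
    by_contra hn
    have : y ∈ frontier Ω := by rw [frontier, hΩ.interior_eq]; exact ⟨hy, hn⟩
    linarith [hbd y this]
  have hloc : IsLocalMax (fun z => b z - u z) y := by
    filter_upwards [hΩ.mem_nhds hyΩ] with z hz
    exact hmax (subset_closure hz)
  have h2 := hb2 y hyΩ
  have h3 := hu2 y hyΩ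
  have key : ∀ v, dd v (dd v b) y ≤ dd v (dd v u) y := by
    intro v
    have := (((J2_line h2 v).sub (J2_line h3 v)).max (by
      filter_upwards [(line_tendsto y v).eventually hloc] with t ht
      simpa using ht)).2
    linarith
  have := det_mono (hess_psd h2 (hconv y hyΩ)) (hess_symm h3) (by
    intro v; rw [qf_hess h2, qf_hess h3]; exact key _)
  exact absurd (hdet y hyΩ) (not_lt.2 this)
end SecQC

section SecQD
open Filter Topology Set
variable {n : ℕ}

/-! ### Solutions of the Monge-Ampere equation -/

structure MA (U : Set (Euc n)) (w : Euc n → ℝ) : Prop where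
  op : IsOpen U
  sm : Sm U w
  det : ∀ x ∈ U, hessDet w x = 1
  conv : ∀ x ∈ U, ∀ v, 0 ≤ dd v (dd v w) x

lemma MA.pd {U : Set (Euc n)} {w : Euc n → ℝ} (h : MA U w) {x : Euc n} (hx : x ∈ U) :
    (hessianMatrix w x).PosDef :=
  hess_pd_of_det (h.sm.cda2 h.op hx) (h.conv x hx) (by rw [h.det x hx]; norm_num)

lemma MA.mono {U U' : Set (Euc n)} {w : Euc n → ℝ} (h : MA U w) (hU' : IsOpen U') (hs : U' ⊆ U) : MA U' w :=
  ⟨hU', h.sm.mono hs, fun x hx => h.det x (hs hx), fun x hx => h.conv x (hs hx)⟩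

lemma line_eventually {U : Set (Euc n)} (hU : IsOpen U) {x : Euc n} (hx : x ∈ U) (v : Euc n) :
    ∀ᶠ t in 𝓝 (0:ℝ), x + t • v ∈ U := (line_tendsto x v).eventually (hU.mem_nhds hx)

structure Frame (w : Euc n → ℝ) (x : Euc n) (v : Fin n → Euc n) : Prop where
  orth : ∀ i j, dd (v i) (dd (v j) w) x = if i = j then 1 else 0
  span : ∀ z, z = ∑ i, dd z (dd (v i) w) x • v i
  tr1 : ∀ e, ∑ i, dd e (dd (v i) (dd (v i) w)) x = 0
  tr2 : ∀ e, ∑ i, dd e (dd e (dd (v i) (dd (v i) w))) x = ∑ i, ∑ j, (dd e (dd (v i) (dd (v j) w)) x) ^ 2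
  tr3 : ∀ e, ∑ i, dd e (dd e (dd e (dd (v i) (dd (v i) w)))) x =
    3 * ∑ i, ∑ j, dd e (dd (v i) (dd (v j) w)) x * dd e (dd e (dd (v i) (dd (v j) w))) x
    - 2 * ∑ i, ∑ j, ∑ k, dd e (dd (v i) (dd (v j) w)) x * dd e (dd (v j) (dd (v k) w)) x
      * dd e (dd (v k) (dd (v i) w)) x

lemma MA.frame {U : Set (Euc n)} {w : Euc n → ℝ} (h : MA U w) {x : Euc n} (hx : x ∈ U) :
    ∃ v, Frame w x v := by
  obtain ⟨R, hR, hRH⟩ := exists_frame (h.pd hx)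
  let v : Fin n → Euc n := fun i => WithLp.toLp 2 (fun k => R k i)
  have hM : ∀ y ∈ U, ∀ i j, dd (v i) (dd (v j) w) y = (R.transpose * hessianMatrix w y * R) i j := by
    intro y hy i j
    rw [ddd_exp (h.sm.cda2 h.op hy)]
    simp only [Matrix.mul_apply, Finset.sum_mul, Matrix.transpose_apply, v]
    rw [Finset.sum_comm]
    refine Finset.sum_congr rfl fun k _ => Finset.sum_congr rfl fun l _ => ?_
    ring
  have orth : ∀ i j, dd (v i) (dd (v j) w) x = if i = j then 1 else 0 := by
    intro i j; rw [hM x hx, hRH, Matrix.one_apply]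
  have hsm : ∀ i j, Sm U (dd (v i) (dd (v j) w)) := fun i j => (h.sm.dd h.op _).dd h.op _
  have symm : ∀ i j, ∀ y ∈ U, dd (v i) (dd (v j) w) y = dd (v j) (dd (v i) w) y := fun i j y hy =>
    dd_comm h.sm h.op hy _ _
  have symm1 : ∀ e i j, ∀ y ∈ U, dd e (dd (v i) (dd (v j) w)) y = dd e (dd (v j) (dd (v i) w)) y := fun e i j =>
    dd_congr h.op (symm i j) e
  have ids : ∀ e, _ := fun e => trace_ids (n := n)
    (M0 := fun t => Matrix.of fun i j => dd (v i) (dd (v j) w) (x + t • e))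
    (M1 := fun t => Matrix.of fun i j => dd e (dd (v i) (dd (v j) w)) (x + t • e))
    (M2 := fun t => Matrix.of fun i j => dd e (dd e (dd (v i) (dd (v j) w))) (x + t • e))
    (c := R.det * R.det) (mul_ne_zero hR hR)
    (by
      filter_upwards [line_eventually h.op hx e] with t ht i j
      exact hasDerivAt_line ((hsm i j).diff h.op ht))
    (by
      filter_upwards [line_eventually h.op hx e] with t ht i j
      exact hasDerivAt_line (((hsm i j).dd h.op e).diff h.op ht))
    (by
      filter_upwards [line_eventually h.op hx e] with t ht
      have : (Matrix.of fun i j => dd (v i) (dd (v j) w) (x + t • e)) =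
        R.transpose * hessianMatrix w (x + t • e) * R := by
        ext i j; exact hM _ ht i j
      have hd : (hessianMatrix w (x + t • e)).det = 1 := h.det _ ht
      rw [this, Matrix.det_mul, Matrix.det_mul, hd, Matrix.det_transpose, mul_one])
    (by
      ext i j
      simp only [Matrix.of_apply, zero_smul, add_zero]
      rw [orth, Matrix.one_apply])
  refine ⟨v, orth, ?_, ?_, ?_, ?_⟩
  · intro z
    have hz : ∃ c : Fin n → ℝ, z = ∑ i, c i • v i := by
      refine ⟨R⁻¹.mulVec z.ofLp, ?_⟩
      have h1 : R.mulVec (R⁻¹.mulVec z.ofLp) = z.ofLp := by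
        rw [Matrix.mulVec_mulVec, Matrix.mul_nonsing_inv _ (isUnit_iff_ne_zero.2 hR), Matrix.one_mulVec]
      ext k
      conv_lhs => rw [← h1]
      generalize R⁻¹.mulVec z.ofLp = c
      simp only [Matrix.mulVec, dotProduct, v, WithLp.ofLp_sum, WithLp.ofLp_smul, Finset.sum_apply,
        Pi.smul_apply, smul_eq_mul]
      exact Finset.sum_congr rfl fun i _ => mul_comm _ _
    obtain ⟨c, hc⟩ := hz
    have : ∀ j, dd z (dd (v j) w) x = c j := by
      intro j
      rw [hc, dd_sum_left]
      simp only [dd_smul_left, orth]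
      simp
    simp only [this]
    exact hc
  · intro e
    have := (ids e).1
    simpa [Matrix.trace] using this
  · intro e
    have := (ids e).2.1
    simp only [Matrix.trace, Matrix.diag, Matrix.mul_apply, Matrix.of_apply, zero_smul, add_zero] at this
    rw [this]
    refine Finset.sum_congr rfl fun i _ => Finset.sum_congr rfl fun j _ => ?_
    rw [symm1 e j i x hx]; ring
  · intro e
    have := (ids e).2.2 (Matrix.of fun i j => dd e (dd e (dd e (dd (v i) (dd (v j) w)))) x) (by
      intro i j
      have := hasDerivAt_line (x := x) (v := e) (t := 0) (f := dd e (dd e (dd (v i) (dd (v j) w))))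
        ((((hsm i j).dd h.op e).dd h.op e).diff h.op (by simpa using hx))
      simpa using this)
    simp only [Matrix.trace, Matrix.diag, Matrix.mul_apply, Matrix.of_apply, zero_smul, add_zero] at this
    rw [this]
    congr 2
    · rw [Finset.sum_comm]
      refine Finset.sum_congr rfl fun i _ => Finset.sum_congr rfl fun j _ => ?_
      rw [symm1 e j i x hx]
    · refine Finset.sum_congr rfl fun i _ => ?_
      simp only [Finset.sum_mul]
      rw [Finset.sum_comm]

/-! ### Pogorelov estimate -/

lemma mat_ineq (A : Fin n → Fin n → ℝ) (hs : ∀ i j, A i j = A j i) (α β : Fin n → ℝ)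
    (hβ : ∀ i, β i = ∑ j, A i j * α j) (ℓ s : ℝ) (hℓ : ℓ = ∑ i, α i ^ 2) (hp : 0 < ℓ) (hss : s = ∑ i, α i * β i) :
    2 * ℓ * ∑ i, β i ^ 2 ≤ ℓ ^ 2 * ∑ i, ∑ j, A i j ^ 2 + s ^ 2 := by
  have h1 : ∑ i, ∑ j, (ℓ * A i j - β i * α j) ^ 2 = ℓ * (ℓ * ∑ i, ∑ j, A i j ^ 2 - ∑ i, β i ^ 2) := by
    have : ∀ i, ∑ j, (ℓ * A i j - β i * α j) ^ 2 = ℓ * (ℓ * ∑ j, A i j ^ 2 - β i ^ 2) := by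
      intro i
      have e : ∀ j, (ℓ * A i j - β i * α j) ^ 2 = ℓ ^ 2 * A i j ^ 2 - 2 * ℓ * β i * (A i j * α j) + β i ^ 2 * α j ^ 2 := by
        intro j; ring
      simp only [e, Finset.sum_add_distrib, Finset.sum_sub_distrib, ← Finset.mul_sum]
      rw [← hβ, ← hℓ]; ring
    simp only [this, ← Finset.mul_sum, Finset.sum_sub_distrib]
  have h2 : ∀ j, (ℓ * β j - s * α j) ^ 2 ≤ ℓ * ∑ i, (ℓ * A i j - β i * α j) ^ 2 := by
    intro j
    have e : ℓ * β j - s * α j = ∑ i, α i * (ℓ * A i j - β i * α j) := by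
      have e2 : ∀ i, α i * (ℓ * A i j - β i * α j) = ℓ * (A j i * α i) - α j * (α i * β i) := by
        intro i; rw [hs i j]; ring
      simp only [e2, Finset.sum_sub_distrib, ← Finset.mul_sum]
      rw [← hβ, ← hss]; ring
    rw [e]
    conv_rhs => rw [hℓ]
    conv_rhs => enter [2]; rw [← hℓ]
    exact Finset.sum_mul_sq_le_sq_mul_sq _ _ _
  have h3 := Finset.sum_le_sum (s := Finset.univ) fun j _ => h2 j
  rw [← Finset.mul_sum, Finset.sum_comm, h1] at h3
  have h4 : ∑ j, (ℓ * β j - s * α j) ^ 2 = ℓ * (ℓ * ∑ i, β i ^ 2 - s ^ 2) := by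
    have e : ∀ j, (ℓ * β j - s * α j) ^ 2 = ℓ ^ 2 * β j ^ 2 - 2 * ℓ * s * (α j * β j) + s ^ 2 * α j ^ 2 := by
      intro j; ring
    simp only [e, Finset.sum_add_distrib, Finset.sum_sub_distrib, ← Finset.mul_sum]
    rw [← hss, ← hℓ]; ring
  rw [h4] at h3
  have h5 := le_of_mul_le_mul_left h3 hp
  nlinarith

lemma pogorelov_alg (A : Fin n → Fin n → ℝ) (hs : ∀ i j, A i j = A j i) (α β p : Fin n → ℝ)
    (hβ : ∀ i, β i = ∑ j, A i j * α j) (ℓ u we : ℝ) (hℓ : ℓ = ∑ i, α i ^ 2) (hp : 0 < ℓ) (hu : 0 < u)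
    (hwe : we = ∑ i, α i * p i)
    (h1 : ∀ i, -p i / u + β i / ℓ + we * α i = 0)
    (h2 : -(n:ℝ) / u - (∑ i, p i ^ 2) / u ^ 2 + (∑ i, ∑ j, A i j ^ 2) / ℓ - (∑ i, β i ^ 2) / ℓ ^ 2 + ℓ ≤ 0) :
    (u * ℓ) ^ 2 ≤ n * (u * ℓ) + we ^ 2 := by
  set s := ∑ i, α i * β i with hss
  have hm := mat_ineq A hs α β hβ ℓ s hℓ hp hss
  set B := ∑ i, β i ^ 2
  set A2 := ∑ i, ∑ j, A i j ^ 2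
  have e1 : ∀ i, p i = u * (β i / ℓ + we * α i) := by
    intro i; have := h1 i; field_simp at this ⊢; linarith
  have e2 : ∑ i, p i ^ 2 = u ^ 2 * (B / ℓ ^ 2 + 2 * we * s / ℓ + we ^ 2 * ℓ) := by
    have e : ∀ i, p i ^ 2 = (u ^ 2 / ℓ ^ 2) * β i ^ 2 + (2 * u ^ 2 * we / ℓ) * (α i * β i) + (u ^ 2 * we ^ 2) * α i ^ 2 := by
      intro i; rw [e1 i]; field_simp; ring
    simp only [e, Finset.sum_add_distrib, ← Finset.mul_sum]
    rw [← hss, ← hℓ]; field_simp; try ring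
  have e3 : we = u * (s / ℓ + we * ℓ) := by
    have e : ∀ i, α i * p i = (u / ℓ) * (α i * β i) + (u * we) * α i ^ 2 := by
      intro i; rw [e1 i]; field_simp
    conv_lhs => rw [hwe]
    simp only [e, Finset.sum_add_distrib, ← Finset.mul_sum]
    rw [← hss, ← hℓ]; field_simp
  rw [e2] at h2
  have e4 : (u ^ 2 * (B / ℓ ^ 2 + 2 * we * s / ℓ + we ^ 2 * ℓ)) / u ^ 2 = B / ℓ ^ 2 + 2 * we * s / ℓ + we ^ 2 * ℓ := by
    field_simp
  rw [e4] at h2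
  have h3 : A2 / ℓ - 2 * B / ℓ ^ 2 + s ^ 2 / ℓ ^ 3 ≥ 0 := by
    have : A2 / ℓ - 2 * B / ℓ ^ 2 + s ^ 2 / ℓ ^ 3 = (ℓ ^ 2 * A2 + s ^ 2 - 2 * ℓ * B) / ℓ ^ 3 := by
      field_simp; try ring
    rw [this]
    apply div_nonneg _ (by positivity)
    linarith
  have h4 : ℓ ≤ n / u + (s / ℓ + we * ℓ) ^ 2 / ℓ := by
    have : (s / ℓ + we * ℓ) ^ 2 / ℓ = s ^ 2 / ℓ ^ 3 + 2 * we * s / ℓ + we ^ 2 * ℓ := by field_simp; ring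
    rw [this]
    have h5 : -(n:ℝ) / u = -(n / u) := by ring
    rw [h5] at h2
    have h6 : 2 * B / ℓ ^ 2 = B / ℓ ^ 2 + B / ℓ ^ 2 := by ring
    linarith
  have h5 : we ^ 2 = u ^ 2 * (s / ℓ + we * ℓ) ^ 2 := by
    conv_lhs => rw [e3]
    ring
  rw [h5]
  have h6 : u ^ 2 * ℓ * ℓ ≤ u ^ 2 * ℓ * (n / u + (s / ℓ + we * ℓ) ^ 2 / ℓ) :=
    mul_le_mul_of_nonneg_left h4 (by positivity)
  have h7 : u ^ 2 * ℓ * (n / u + (s / ℓ + we * ℓ) ^ 2 / ℓ) = n * (u * ℓ) + u ^ 2 * (s / ℓ + we * ℓ) ^ 2 := by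
    field_simp
  nlinarith

theorem pogorelov {U K : Set (Euc n)} {w : Euc n → ℝ} (h : MA U w) (hK : IsCompact K) (hKU : K ⊆ U) {c G : ℝ}
    (hG0 : 0 ≤ G) (hsub : ∀ x ∈ U, w x < -c → x ∈ K) {e : Euc n} (he : e ≠ 0)
    (hG : ∀ x ∈ U, w x < -c → |dd e w x| ≤ G) :
    ∀ x ∈ U, w x < -c → (-c - w x) * dd e (dd e w) x ≤ (n + G) * Real.exp (1/2 * G ^ 2) := by
  intro y hy hyc
  have hop := h.op
  let f1 := dd e w
  let f2 := dd e (dd e w)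
  have hs1 : Sm U f1 := h.sm.dd hop e
  have hs2 : Sm U f2 := hs1.dd hop e
  have hpos : ∀ x ∈ U, 0 < f2 x := fun x hx => hess_pd_pos (h.sm.cda2 hop hx) (h.pd hx) he
  let ψ : Euc n → ℝ := fun x => (-c - w x) * f2 x * Real.exp (1/2 * (f1 x * f1 x))
  have hcont : ContinuousOn ψ K := by
    have a := h.sm.cont.mono hKU
    have b := hs2.cont.mono hKU
    have d := hs1.cont.mono hKU
    exact ((continuousOn_const.sub a).mul b).mul ((continuousOn_const.mul (d.mul d)).rexp)
  obtain ⟨x, hxK, hmax⟩ := hK.exists_isMaxOn ⟨y, hsub y hy hyc⟩ hcont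
  have hxU := hKU hxK
  have hψy : 0 < ψ y := by
    have := hpos y hy
    have h2 : 0 < -c - w y := by linarith
    positivity
  have hψx : ψ y ≤ ψ x := hmax (hsub y hy hyc)
  have hxc : w x < -c := by
    by_contra hn
    push Not at hn
    have h1 : ψ x ≤ 0 := by
      have := hpos x hxU
      apply mul_nonpos_of_nonpos_of_nonneg _ (Real.exp_pos _).le
      apply mul_nonpos_of_nonpos_of_nonneg _ this.le
      linarith
    linarith
  have hupos : 0 < -c - w x := by linarith
  obtain ⟨v, hv⟩ := h.frame hxU
  have hev : ∀ᶠ z in 𝓝 x, z ∈ U ∧ w z < -c :=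
    Filter.Eventually.and (hop.mem_nhds hxU)
      (((h.sm.diff hop hxU).continuousAt).eventually (gt_mem_nhds hxc))
  have hloc : ∀ v, IsLocalMax (fun t : ℝ => Real.log (-c - w (x + t • v)) + Real.log (f2 (x + t • v))
      + 1/2 * (f1 (x + t • v) * f1 (x + t • v))) 0 := by
    intro v
    filter_upwards [(line_tendsto x v).eventually hev] with t ht
    have e : ∀ z, z ∈ U → w z < -c → Real.log (-c - w z) + Real.log (f2 z) + 1/2 * (f1 z * f1 z) = Real.log (ψ z) := by
      intro z hz hzc
      have h1 := (hpos z hz).ne'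
      have h2 : (-c - w z) ≠ 0 := by linarith
      simp only [ψ]
      rw [Real.log_mul (mul_ne_zero h2 h1) (Real.exp_ne_zero _), Real.log_mul h2 h1, Real.log_exp]
    simp only [zero_smul, add_zero]
    rw [e _ ht.1 ht.2, e x hxU hxc]
    have h0 : 0 < ψ (x + t • v) := by
      have := hpos _ ht.1
      have h2 : 0 < -c - w (x + t • v) := by linarith [ht.2]
      positivity
    exact Real.log_le_log h0 (hmax (hsub _ ht.1 ht.2))
  have jets : ∀ i, _ ∧ _ := fun i => ((((J2.const (-c)).sub (J2_line (h.sm.cda2 hop hxU) (v i))).log hupos).add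
    ((J2_line (hs2.cda2 hop hxU) (v i)).log (hpos x hxU))).add
    (((J2_line (hs1.cda2 hop hxU) (v i)).mul (J2_line (hs1.cda2 hop hxU) (v i))).smul (1/2)) |>.max (hloc (v i))
  set α : Fin n → ℝ := fun i => dd e (dd (v i) w) x with hα
  set A : Fin n → Fin n → ℝ := fun i j => dd e (dd (v i) (dd (v j) w)) x with hA
  have hαi : ∀ i, dd (v i) f1 x = α i := fun i => dd_comm h.sm hop hxU _ _
  have hes : e = ∑ i, α i • v i := hv.span e
  have hℓ : f2 x = ∑ i, α i ^ 2 := by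
    have : dd e (dd e w) x = dd (∑ i, α i • v i) (dd e w) x := by rw [← hes]
    simp only [f2]
    rw [this, dd_sum_left]
    simp only [dd_smul_left]
    exact Finset.sum_congr rfl fun i _ => by rw [hαi i]; ring
  have hcomm : ∀ i, ∀ z ∈ U, dd (v i) f2 z = dd e (dd e (dd (v i) w)) z := by
    intro i z hz
    rw [dd_comm hs1 hop hz (v i) e]
    exact dd_congr hop (fun z hz => dd_comm h.sm hop hz _ _) e z hz
  have hβ : ∀ i, dd (v i) f2 x = ∑ j, A i j * α j := by
    intro i
    rw [hcomm i x hxU]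
    have : dd e (dd e (dd (v i) w)) x = dd (∑ j, α j • v j) (dd e (dd (v i) w)) x := by rw [← hes]
    rw [this, dd_sum_left]
    simp only [dd_smul_left]
    refine Finset.sum_congr rfl fun j _ => ?_
    rw [dd_comm (h.sm.dd hop _) hop hxU, mul_comm]
    congr 1
    exact dd_congr hop (fun z hz => dd_comm h.sm hop hz _ _) e x hxU
  have hsym : ∀ i j, A i j = A j i := fun i j => dd_congr hop (fun z hz => dd_comm h.sm hop hz _ _) e x hxU
  have hwe : f1 x = ∑ i, α i * dd (v i) w x := by
    have : dd e w x = dd (∑ i, α i • v i) w x := by rw [← hes]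
    simp only [f1]
    rw [this, dd_sum_left]
    simp only [dd_smul_left]
  have hii2 : ∑ i, dd (v i) (dd (v i) f2) x = ∑ i, ∑ j, A i j ^ 2 := by
    rw [← hv.tr2 e]
    refine Finset.sum_congr rfl fun i _ => ?_
    rw [dd_congr hop (hcomm i) (v i) x hxU, dd_comm ((h.sm.dd hop _).dd hop _) hop hxU]
    exact dd_congr hop (fun z hz => dd_comm (h.sm.dd hop _) hop hz _ _) e x hxU
  have hii1 : ∑ i, dd (v i) (dd (v i) f1) x = 0 := by
    rw [← hv.tr1 e]
    refine Finset.sum_congr rfl fun i _ => ?_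
    rw [dd_congr hop (fun z hz => dd_comm h.sm hop hz (v i) e) (v i) x hxU, dd_comm (h.sm.dd hop _) hop hxU]
  have key := pogorelov_alg A hsym α (fun i => dd (v i) f2 x) (fun i => dd (v i) w x) hβ (f2 x) (-c - w x) (f1 x)
    hℓ (hpos x hxU) hupos hwe
    (by
      intro i
      have := (jets i).1
      rw [hαi i] at this
      simp only [zero_sub] at this
      linarith)
    (by
      have hsum := Finset.sum_nonpos (s := Finset.univ) fun i _ => (jets i).2
      simp only [Finset.sum_add_distrib, Finset.sum_sub_distrib, ← Finset.sum_div, hαi, hv.orth, if_true, zero_sub,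
        div_pow, ← Finset.mul_sum, ← Finset.sum_mul, hii2, hii1, neg_sq, Finset.sum_const, Finset.card_univ,
        Fintype.card_fin, nsmul_eq_mul, mul_neg, mul_one, Finset.sum_neg_distrib] at hsum
      have e5 : ∑ i, α i * α i = f2 x := by rw [hℓ]; exact Finset.sum_congr rfl fun i _ => by ring
      rw [e5] at hsum
      linarith)
  have hGx := hG x hxU hxc
  have hsq : f1 x ^ 2 ≤ G ^ 2 := sq_le_sq' (abs_le.1 hGx).1 (abs_le.1 hGx).2
  set τ := (-c - w x) * f2 x with hτ
  have hτ0 : 0 < τ := mul_pos hupos (hpos x hxU)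
  have hτb : τ ≤ n + G := by
    by_contra hn
    push Not at hn
    have hn0 : (0:ℝ) ≤ n := Nat.cast_nonneg n
    nlinarith
  have h1 : (-c - w y) * f2 y ≤ ψ y := by
    have h2 : 0 < (-c - w y) * f2 y := mul_pos (by linarith) (hpos y hy)
    have h3 : 1 ≤ Real.exp (1/2 * (f1 y * f1 y)) := Real.one_le_exp (by nlinarith [mul_self_nonneg (f1 y)])
    simp only [ψ]
    nlinarith
  refine h1.trans (hψx.trans ?_)
  simp only [ψ]
  rw [← hτ]
  apply mul_le_mul hτb _ (Real.exp_pos _).le (by positivity)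
  apply Real.exp_le_exp.2
  nlinarith
end SecQD

section SecQE
open Filter Topology Set
variable {n : ℕ}

/-! ### Calabi estimate for third derivatives -/

section comm
variable {U : Set (Euc n)} {f : Euc n → ℝ}

lemma dd_move2 (hf : Sm U f) (hU : IsOpen U) (v e : Euc n) :
    ∀ x ∈ U, dd v (dd e (dd e f)) x = dd e (dd e (dd v f)) x := by
  intro x hx
  rw [dd_comm (hf.dd hU e) hU hx]
  exact dd_congr hU (fun z hz => dd_comm hf hU hz v e) e x hx

lemma dd_move3 (hf : Sm U f) (hU : IsOpen U) (v e : Euc n) :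
    ∀ x ∈ U, dd v (dd e (dd e (dd e f))) x = dd e (dd e (dd e (dd v f))) x := by
  intro x hx
  rw [dd_comm ((hf.dd hU e).dd hU e) hU hx]
  exact dd_congr hU (dd_move2 hf hU v e) e x hx

lemma dd_lin (hf : Sm U f) (hU : IsOpen U) (e b a : Euc n) (t : ℝ) :
    ∀ x ∈ U, dd a (dd (e + t • b) f) x = dd a (dd e f) x + t * dd a (dd b f) x := by
  intro x hx
  rw [dd_add_left, dd_smul_left]
  rw [dd_add ((hf.dd hU e).diff hU hx) (((hf.dd hU b).diff hU hx).const_mul t), dd_cmul ((hf.dd hU b).diff hU hx)]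

lemma cubic_exp (hf : Sm U f) (hU : IsOpen U) (e b : Euc n) (t : ℝ) {x : Euc n} (hx : x ∈ U) :
    dd (e + t • b) (dd (e + t • b) (dd (e + t • b) f)) x =
      dd e (dd e (dd e f)) x + t * (3 * dd b (dd e (dd e f)) x) + t * (t * (3 * dd b (dd b (dd e f)) x))
        + t * (t * (t * dd b (dd b (dd b f)) x)) := by
  have h1 : ∀ z ∈ U, dd (e + t • b) (dd (e + t • b) f) z
      = dd e (dd e f) z + t * (2 * dd b (dd e f) z) + t * (t * dd b (dd b f) z) := by
    intro z hz
    rw [dd_lin hf hU e b _ t z hz, dd_add_left, dd_add_left, dd_smul_left, dd_smul_left]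
    simp only
    rw [dd_comm hf hU hz e b]; ring
  have hee := (hf.dd hU e).dd hU e
  have hbe := (hf.dd hU e).dd hU b
  have hbb := (hf.dd hU b).dd hU b
  rw [dd_congr hU h1 _ x hx]
  have h2 : ∀ a, dd a (fun z => dd e (dd e f) z + t * (2 * dd b (dd e f) z) + t * (t * dd b (dd b f) z)) x
      = dd a (dd e (dd e f)) x + t * (2 * dd a (dd b (dd e f)) x) + t * (t * dd a (dd b (dd b f)) x) := by
    intro a
    have d1 := hee.diff hU hx
    have d2 := hbe.diff hU hx
    have d3 := hbb.diff hU hx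
    rw [dd_add (d1.fun_add ((d2.const_mul 2).const_mul t)) ((d3.const_mul t).const_mul t),
      dd_add d1 ((d2.const_mul 2).const_mul t), dd_cmul (d2.const_mul 2), dd_cmul d2, dd_cmul (d3.const_mul t), dd_cmul d3]
  rw [dd_add_left, dd_smul_left]
  simp only [h2]
  have c1 : dd e (dd b (dd e f)) x = dd b (dd e (dd e f)) x := dd_comm (hf.dd hU e) hU hx _ _
  have c2 : dd e (dd b (dd b f)) x = dd b (dd b (dd e f)) x := dd_move2 hf hU e b x hx
  rw [c1, c2]; ring

lemma quad_exp (hf : Sm U f) (hU : IsOpen U) (e b : Euc n) (t : ℝ) {x : Euc n} (hx : x ∈ U) :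
    dd (e + t • b) (dd (e + t • b) f) x
      = dd e (dd e f) x + t * (2 * dd b (dd e f) x) + t * (t * dd b (dd b f) x) := by
  rw [dd_lin hf hU e b _ t x hx, dd_add_left, dd_add_left, dd_smul_left, dd_smul_left]
  simp only
  rw [dd_comm hf hU hx e b]; ring

lemma d3_exp (hf : Sm U f) (hU : IsOpen U) (a b c : Euc n) {x : Euc n} (hx : x ∈ U) :
    dd a (dd b (dd c f)) x = ∑ i, ∑ j, ∑ k, a i * b j * c k *
      dd (EuclideanSpace.single i 1) (dd (EuclideanSpace.single j 1) (dd (EuclideanSpace.single k 1) f)) x := by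
  have h1 : ∀ z ∈ U, dd b (dd c f) z = ∑ j, ∑ k, b j * c k *
      dd (EuclideanSpace.single j 1) (dd (EuclideanSpace.single k 1) f) z := by
    intro z hz
    rw [ddd_exp (hf.cda2 hU hz)]
    refine Finset.sum_congr rfl fun i _ => Finset.sum_congr rfl fun j _ => ?_
    rw [hessianMatrix_apply (hf.cda2 hU hz)]
  rw [dd_exp a]
  simp only
  refine Finset.sum_congr rfl fun i _ => ?_
  rw [dd_congr hU h1 _ x hx]
  have hd : ∀ j k, DifferentiableAt ℝ (dd (EuclideanSpace.single j 1) (dd (EuclideanSpace.single k 1) f)) x :=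
    fun j k => ((hf.dd hU _).dd hU _).diff hU hx
  rw [dd_sum _ (fun j _ => DifferentiableAt.fun_sum fun k _ => (hd j k).const_mul _), Finset.mul_sum]
  refine Finset.sum_congr rfl fun j _ => ?_
  rw [dd_sum _ (fun k _ => (hd j k).const_mul _), Finset.mul_sum]
  refine Finset.sum_congr rfl fun k _ => ?_
  rw [dd_cmul (hd j k)]; ring

lemma d3_smul (hf : Sm U f) (hU : IsOpen U) (e : Euc n) (s : ℝ) {x : Euc n} (hx : x ∈ U) :
    dd (s • e) (dd (s • e) (dd (s • e) f)) x = s ^ 3 * dd e (dd e (dd e f)) x := by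
  rw [d3_exp hf hU _ _ _ hx, d3_exp hf hU _ _ _ hx, Finset.mul_sum]
  refine Finset.sum_congr rfl fun i _ => ?_
  rw [Finset.mul_sum]
  refine Finset.sum_congr rfl fun j _ => ?_
  rw [Finset.mul_sum]
  refine Finset.sum_congr rfl fun k _ => ?_
  simp only [PiLp.smul_apply, smul_eq_mul]; ring

lemma d2_smul {x : Euc n} (hf : ContDiffAt ℝ 2 f x) (e : Euc n) (s : ℝ) :
    dd (s • e) (dd (s • e) f) x = s ^ 2 * dd e (dd e f) x := by
  rw [ddd_exp hf, ddd_exp hf, Finset.mul_sum]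
  refine Finset.sum_congr rfl fun i _ => ?_
  rw [Finset.mul_sum]
  refine Finset.sum_congr rfl fun j _ => ?_
  simp only [PiLp.smul_apply, smul_eq_mul]; ring
end comm

lemma eta_J2 (y x v : Euc n) (r : ℝ) : J2 (fun t : ℝ => r ^ 2 - ‖x + t • v - y‖ ^ 2) (r ^ 2 - ‖x - y‖ ^ 2)
    (-2 * inner ℝ (x - y) v) (-2 * ‖v‖ ^ 2) := by
  have e : (fun t : ℝ => r ^ 2 - ‖x + t • v - y‖ ^ 2) =
      fun t : ℝ => (r ^ 2 - ‖x - y‖ ^ 2) + ((-2 * inner ℝ (x - y) v) * t + (-‖v‖ ^ 2) * (t * t)) := by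
    ext t
    have : x + t • v - y = (x - y) + t • v := by abel
    rw [this, norm_add_sq_real, inner_smul_right, norm_smul, Real.norm_eq_abs, mul_pow, sq_abs]; ring
  rw [e]
  exact ((J2.const _).add ((J2.id.smul _).add ((J2.id.mul J2.id).smul _))).cast (by ring) (by ring) (by ring)

/-- pure algebra of the Calabi maximum principle argument -/
lemma calabi_alg (A B : Fin n → Fin n → ℝ) (hs : ∀ i j, A i j = A j i) (α : Fin n → ℝ) (τ η : ℝ)
    (ηi ηii C1 C2 wee3 g2 wee2 : Fin n → ℝ) (hτ : 0 < τ) (hη : 0 < η)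
    (hα : ∑ i, α i ^ 2 = 1) (hAα : ∀ i, ∑ j, A i j * α j = τ * α i)
    (hw3 : ∑ i, wee3 i = 3 * ∑ i, ∑ j, A i j * B i j - 2 * ∑ i, ∑ j, ∑ k, A i j * A j k * A k i)
    (hw2 : ∑ i, wee2 i = ∑ i, ∑ j, A i j ^ 2)
    (htr : ∑ i, ∑ j, ∑ k, A i j * A j k * A k i ≤ τ * ∑ i, ∑ j, A i j ^ 2)
    (hC2 : ∀ i, C2 i = wee3 i + 6 * (-(1/2) * ∑ j, A i j * B i j) + 6 * (1/4 * ∑ j, ∑ k, A i j * A i k * A j k))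
    (hg2 : ∀ i, g2 i = wee2 i + 4 * (-(1/2) * ∑ j, A i j ^ 2) + 2 * (1/4 * ∑ j, A i j ^ 2))
    (h1 : ∀ i, 2 * (ηi i / η) + 2 * (C1 i / τ) = 0)
    (h2 : ∀ i, 2 * (ηii i / η - (ηi i / η) ^ 2) + 2 * (C2 i / τ - (C1 i / τ) ^ 2) - 3 * g2 i ≤ 0) :
    1 / 4 * τ ^ 2 ≤ ∑ i, (2 * (ηi i / η) ^ 2 - ηii i / η) := by
  set A2 := ∑ i, ∑ j, A i j ^ 2 with hA2
  have ht : τ ^ 2 ≤ A2 := by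
    have h3 : ∑ i, (∑ j, A i j * α j) ^ 2 ≤ ∑ i, (∑ j, A i j ^ 2) * (∑ j, α j ^ 2) :=
      Finset.sum_le_sum fun i _ => Finset.sum_mul_sq_le_sq_mul_sq _ _ _
    simp only [hAα, hα, mul_one, mul_pow, ← Finset.mul_sum] at h3
    exact h3
  have hS := Finset.sum_nonpos (s := Finset.univ) fun i _ => h2 i
  have e3 : ∑ i, ∑ j, ∑ k, A i j * A i k * A j k = ∑ i, ∑ j, ∑ k, A i j * A j k * A k i := by
    refine Finset.sum_congr rfl fun i _ => Finset.sum_congr rfl fun j _ => Finset.sum_congr rfl fun k _ => ?_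
    rw [hs k i]; ring
  have e1 : ∑ i, C2 i = -(1/2) * ∑ i, ∑ j, ∑ k, A i j * A j k * A k i := by
    simp only [hC2, Finset.sum_add_distrib, ← Finset.mul_sum, hw3, e3]; ring
  have e2 : ∑ i, g2 i = -(1/2) * A2 := by
    simp only [hg2, Finset.sum_add_distrib, ← Finset.mul_sum, hw2]
    rw [← hA2]; ring
  have hC1 : ∀ i, (C1 i / τ) ^ 2 = (ηi i / η) ^ 2 := by
    intro i
    have : C1 i / τ = - (ηi i / η) := by linarith [h1 i]
    rw [this]; ring
  simp only [hC1, Finset.sum_sub_distrib, Finset.sum_add_distrib, ← Finset.mul_sum, ← Finset.sum_div, e1, e2] at hS ⊢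
  have h5 : -(1/2) * (∑ i, ∑ j, ∑ k, A i j * A j k * A k i) / τ ≥ -(1/2) * A2 := by
    rw [ge_iff_le, le_div_iff₀ hτ]; nlinarith
  linarith
end SecQE

section SecQF
open Filter Topology Set
variable {n : ℕ}

lemma dd_lc_left {f : Euc n → ℝ} {x : Euc n} (c : Fin n → ℝ) (v : Fin n → Euc n) :
    dd (∑ j, c j • v j) f x = ∑ j, c j * dd (v j) f x := by
  rw [dd_sum_left]; simp only
  refine Finset.sum_congr rfl fun j _ => ?_
  rw [dd_smul_left]

lemma dd_lc_mid {U : Set (Euc n)} {f : Euc n → ℝ} (hf : Sm U f) (hU : IsOpen U) {x : Euc n} (hx : x ∈ U) (u : Euc n)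
    (c : Fin n → ℝ) (v : Fin n → Euc n) :
    dd u (dd (∑ j, c j • v j) f) x = ∑ j, c j * dd u (dd (v j) f) x := by
  rw [dd_comm hf hU hx, dd_lc_left]
  refine Finset.sum_congr rfl fun j _ => ?_
  rw [dd_comm hf hU hx]

lemma calabi_core {U : Set (Euc n)} {w : Euc n → ℝ} (h : MA U w) {x e1 : Euc n} (hxU : x ∈ U)
    {τ : ℝ} (hτ : 0 < τ) (hτe : dd e1 (dd e1 (dd e1 w)) x = τ) (hD2 : dd e1 (dd e1 w) x = 1) {v : Fin n → Euc n} (hv : Frame w x v)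
    (E1 E2 : Euc n → ℝ) (η : ℝ) (hη : 0 < η) (z1 : E1 0 = 0) (z2 : E2 0 = 0)
    (jets : ∀ (v b : Euc n),
    2 * (E1 v / η) +
            2 * ((dd v (dd e1 (dd e1 (dd e1 w))) x + 3 * dd b (dd e1 (dd e1 w)) x) / τ) -
          3 * ((dd v (dd e1 (dd e1 w)) x + 2 * dd b (dd e1 w) x) / 1) =
        0 ∧
      2 * (E2 v / η - (E1 v / η) ^ 2) +
            2 *
              ((dd v (dd v (dd e1 (dd e1 (dd e1 w)))) x + 6 * dd v (dd b (dd e1 (dd e1 w))) x +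
                    6 * dd b (dd b (dd e1 w)) x) /
                  τ -
                ((dd v (dd e1 (dd e1 (dd e1 w))) x + 3 * dd b (dd e1 (dd e1 w)) x) / τ) ^ 2) -
          3 *
            ((dd v (dd v (dd e1 (dd e1 w))) x + 4 * dd v (dd b (dd e1 w)) x + 2 * dd b (dd b w) x) / 1 -
              ((dd v (dd e1 (dd e1 w)) x + 2 * dd b (dd e1 w) x) / 1) ^ 2) ≤
        0) :
    1 / 4 * τ ^ 2 ≤ ∑ i, (2 * (E1 (v i) / η) ^ 2 - E2 (v i) / η) := by
  have hop := h.op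
  have hsm := h.sm
  have dz : ∀ f : Euc n → ℝ, ∀ x, dd 0 f x = 0 := by
    intro f x
    have := dd_smul_left 0 0 f
    rw [zero_smul] at this; rw [this]; simp
  have hA : ∀ z, dd z (dd e1 (dd e1 w)) x = τ * dd z (dd e1 w) x := by
    intro z
    have := (jets 0 z).1
    simp only [dz, z1] at this
    have e2 : 3 * dd z (dd e1 (dd e1 w)) x / τ = 3 * dd z (dd e1 w) x := by
      simp only [zero_add, zero_div, mul_zero] at this; linarith
    rw [div_eq_iff hτ.ne'] at e2
    linarith
  have hCS : ∀ z, (dd z (dd e1 w) x) ^ 2 ≤ dd z (dd z w) x := by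
    intro z
    have h1 := quad_exp hsm hop z e1 (-(dd z (dd e1 w) x)) hxU
    have h2 : 0 ≤ dd (z + -(dd z (dd e1 w) x) • e1) (dd (z + -(dd z (dd e1 w) x) • e1) w) x :=
      by
        by_cases h0 : z + -(dd z (dd e1 w) x) • e1 = 0
        · rw [h0, dz]
        · exact (hess_pd_pos (hsm.cda2 hop hxU) (h.pd hxU) h0).le
    rw [h1, hD2, dd_comm hsm hop hxU e1 z] at h2
    nlinarith
  have hB : ∀ z, dd z (dd z (dd e1 w)) x ≤ τ * dd z (dd z w) x := by
    intro z
    have h1 := (jets 0 z).2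
    simp only [dz, z1, z2, hA] at h1
    have h2 := hCS z
    have e4 : (0 + 3 * (τ * dd z (dd e1 w) x)) / τ = 3 * dd z (dd e1 w) x := by field_simp; ring
    rw [e4] at h1
    have h3 : 6 * dd z (dd z (dd e1 w)) x / τ ≤ 6 * dd z (dd z w) x := by
      simp only [zero_add, mul_zero, zero_div] at h1
      nlinarith
    rw [div_le_iff₀ hτ] at h3
    nlinarith
  let A : Fin n → Fin n → ℝ := fun i j => dd e1 (dd (v i) (dd (v j) w)) x
  let B : Fin n → Fin n → ℝ := fun i j => dd e1 (dd e1 (dd (v i) (dd (v j) w))) x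
  let α : Fin n → ℝ := fun i => dd e1 (dd (v i) w) x
  have hα' : ∀ i, dd (v i) (dd e1 w) x = α i := fun i => dd_comm hsm hop hxU _ _
  have hsp : e1 = ∑ i, α i • v i := hv.span e1
  have hs : ∀ i j, A i j = A j i := fun i j => dd_congr hop (fun z hz => dd_comm hsm hop hz _ _) e1 x hxU
  have A' : ∀ i j, dd (v i) (dd (v j) (dd e1 w)) x = A i j := by
    intro i j
    have : dd (v i) (dd (v j) (dd e1 w)) x = dd (v i) (dd e1 (dd (v j) w)) x :=
      dd_congr hop (fun z hz => dd_comm hsm hop hz _ _) _ x hxU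
    rw [this, dd_comm (hsm.dd hop _) hop hxU]
  have B' : ∀ i j, dd (v i) (dd (v j) (dd e1 (dd e1 w))) x = B i j := by
    intro i j
    have : dd (v i) (dd (v j) (dd e1 (dd e1 w))) x = dd (v i) (dd e1 (dd e1 (dd (v j) w))) x :=
      dd_congr hop (dd_move2 hsm hop _ _) _ x hxU
    rw [this, dd_move2 (hsm.dd hop _) hop _ _ x hxU]
  have hα : ∑ i, α i ^ 2 = 1 := by
    have h1 : dd e1 (dd e1 w) x = ∑ i, α i * dd (v i) (dd e1 w) x := by
      conv_lhs => rw [hsp]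
      rw [dd_lc_left, ← hsp]
    rw [hD2] at h1
    rw [h1]
    refine Finset.sum_congr rfl fun i _ => ?_
    rw [hα', sq]
  have hAα : ∀ i, ∑ j, A i j * α j = τ * α i := by
    intro i
    rw [← hα', ← hA, dd_comm (hsm.dd hop _) hop hxU]
    conv_rhs => rw [hsp]
    rw [dd_lc_left, ← hsp]
    refine Finset.sum_congr rfl fun j _ => ?_
    rw [A', hs]; ring
  let a : Fin n → Euc n := fun i => ∑ j, A i j • v j
  let b : Fin n → Euc n := fun i => ∑ j, (-(1/2) * A i j) • v j
  have hDaa : ∀ (c : Fin n → ℝ), dd (∑ j, c j • v j) (dd (∑ j, c j • v j) w) x = ∑ j, c j ^ 2 := by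
    intro c
    rw [dd_lc_left]
    refine Finset.sum_congr rfl fun i _ => ?_
    rw [dd_lc_mid hsm hop hxU]
    simp [hv.orth, sq]
  have hTaa : ∀ (c : Fin n → ℝ), dd (∑ j, c j • v j) (dd (∑ j, c j • v j) (dd e1 w)) x = ∑ j, ∑ k, c j * c k * A j k := by
    intro c
    rw [dd_lc_left]
    refine Finset.sum_congr rfl fun i _ => ?_
    rw [dd_lc_mid (hsm.dd hop _) hop hxU, Finset.mul_sum]
    refine Finset.sum_congr rfl fun j _ => ?_
    rw [A']; ring
  have htr : ∑ i, ∑ j, ∑ k, A i j * A j k * A k i ≤ τ * ∑ i, ∑ j, A i j ^ 2 := by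
    rw [Finset.mul_sum]
    refine Finset.sum_le_sum fun i _ => ?_
    have := hB (∑ j, A i j • v j)
    rw [hTaa, hDaa] at this
    refine le_trans (le_of_eq ?_) this
    refine Finset.sum_congr rfl fun j _ => Finset.sum_congr rfl fun k _ => ?_
    rw [hs k i]; ring
  have hg1 : ∀ i, dd (v i) (dd e1 (dd e1 w)) x + 2 * dd (b i) (dd e1 w) x = 0 := by
    intro i
    rw [hA, dd_lc_left, hα', ← hAα]
    simp only [hα', mul_assoc, ← Finset.mul_sum]; ring
  refine calabi_alg A B hs α τ η (fun i => E1 (v i)) (fun i => E2 (v i))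
    (fun i => dd (v i) (dd e1 (dd e1 (dd e1 w))) x + 3 * dd (b i) (dd e1 (dd e1 w)) x)
    (fun i => dd (v i) (dd (v i) (dd e1 (dd e1 (dd e1 w)))) x + 6 * dd (v i) (dd (b i) (dd e1 (dd e1 w))) x +
                    6 * dd (b i) (dd (b i) (dd e1 w)) x)
    (fun i => dd (v i) (dd (v i) (dd e1 (dd e1 (dd e1 w)))) x)
    (fun i => dd (v i) (dd (v i) (dd e1 (dd e1 w))) x + 4 * dd (v i) (dd (b i) (dd e1 w)) x + 2 * dd (b i) (dd (b i) w) x)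
    (fun i => dd (v i) (dd (v i) (dd e1 (dd e1 w))) x) hτ hη hα hAα ?_ ?_ htr ?_ ?_ ?_ ?_
  · rw [← hv.tr3]
    refine Finset.sum_congr rfl fun i _ => ?_
    have : dd (v i) (dd (v i) (dd e1 (dd e1 (dd e1 w)))) x = dd (v i) (dd e1 (dd e1 (dd e1 (dd (v i) w)))) x :=
      dd_congr hop (dd_move3 hsm hop _ _) _ x hxU
    rw [this, dd_move3 (hsm.dd hop _) hop _ _ x hxU]
  · rw [← hv.tr2]
    refine Finset.sum_congr rfl fun i _ => ?_
    rw [B']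
  · intro i
    simp only [b]
    rw [hTaa, dd_lc_mid ((hsm.dd hop _).dd hop _) hop hxU]
    simp only [B', Finset.mul_sum]
    congr 1
    · congr 1
      refine Finset.sum_congr rfl fun j _ => by ring
    · refine Finset.sum_congr rfl fun j _ => Finset.sum_congr rfl fun k _ => by ring
  · intro i
    simp only [b]
    rw [hDaa, dd_lc_mid (hsm.dd hop _) hop hxU]
    simp only [A', Finset.mul_sum]
    congr 1
    · congr 1
      refine Finset.sum_congr rfl fun j _ => by ring
    · refine Finset.sum_congr rfl fun j _ => by ring
  · intro i
    have := (jets (v i) (b i)).1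
    rw [hg1] at this
    linarith
  · intro i
    have := (jets (v i) (b i)).2
    rw [hg1] at this
    simp only [div_one, ne_eq, OfNat.ofNat_ne_zero, not_false_eq_true, zero_pow, sub_zero] at this ⊢
    linarith
theorem calabi {U : Set (Euc n)} {w : Euc n → ℝ} (h : MA U w) {y : Euc n} {r lam Lam : ℝ} (hr : 0 < r)
    (hl : 0 < lam) (hB : Metric.closedBall y r ⊆ U)
    (hlo : ∀ x ∈ Metric.closedBall y r, ∀ v, lam * ‖v‖ ^ 2 ≤ dd v (dd v w) x)
    (hhi : ∀ x ∈ Metric.closedBall y r, ∀ v, dd v (dd v w) x ≤ Lam * ‖v‖ ^ 2) (e : Euc n) (he : ‖e‖ = 1)  :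
    (dd e (dd e (dd e w)) y) ^ 2 ≤ 40 * n * Lam ^ 3 / (lam * r ^ 2) := by
  have hop := h.op
  -- reduce to positive value
  wlog hpos : 0 < dd e (dd e (dd e w)) y generalizing e with H
  · have hy : y ∈ U := hB (Metric.mem_closedBall_self hr.le)
    have hneg : dd (-e) (dd (-e) (dd (-e) w)) y = - dd e (dd e (dd e w)) y := by
      have := d3_smul h.sm hop e (-1) hy
      rw [neg_one_smul] at this; rw [this]; ring
    push Not at hpos
    rcases hpos.lt_or_eq with h1 | h1
    · have := H (-e) (by simpa using he) (by rw [hneg]; linarith)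
      rw [hneg] at this; linarith [neg_sq (dd e (dd e (dd e w)) y)]
    · rw [h1]
      have : 0 ≤ Lam := by
        have a := hlo y (Metric.mem_closedBall_self hr.le) e
        have b := hhi y (Metric.mem_closedBall_self hr.le) e
        rw [he] at a b; linarith
      rw [zero_pow two_ne_zero]; positivity
  let D3 : Euc n → Euc n → ℝ := fun e x => dd e (dd e (dd e w)) x
  let D2 : Euc n → Euc n → ℝ := fun e x => dd e (dd e w) x
  let η : Euc n → ℝ := fun x => r ^ 2 - ‖x - y‖ ^ 2
  let Ψ : Euc n × Euc n → ℝ := fun p => η p.1 ^ 2 * (D3 p.2 p.1 * |D3 p.2 p.1|) / D2 p.2 p.1 ^ 3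
  let K : Set (Euc n × Euc n) := Metric.closedBall y r ×ˢ Metric.sphere 0 1
  have hK : IsCompact K := (isCompact_closedBall y r).prod (isCompact_sphere 0 1)
  have D2pos : ∀ x ∈ U, ∀ e, e ≠ 0 → 0 < D2 e x := fun x hx e he => hess_pd_pos (h.sm.cda2 hop hx) (h.pd hx) he
  have sph : ∀ e : Euc n, e ∈ Metric.sphere (0 : Euc n) 1 → e ≠ 0 := by
    intro e he h0; rw [h0] at he; simp at he
  have D3c : ContinuousOn (fun p : Euc n × Euc n => D3 p.2 p.1) K := by
    refine ContinuousOn.congr (f := fun p : Euc n × Euc n => ∑ i, ∑ j, ∑ k, p.2 i * p.2 j * p.2 k *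
      dd (EuclideanSpace.single i 1) (dd (EuclideanSpace.single j 1) (dd (EuclideanSpace.single k 1) w)) p.1)
      ?_ (fun p hp => d3_exp h.sm hop _ _ _ (hB hp.1))
    refine continuousOn_finsetSum _ fun i _ => continuousOn_finsetSum _ fun j _ => continuousOn_finsetSum _ fun k _ => ?_
    refine ContinuousOn.mul (by fun_prop) ?_
    exact (((h.sm.dd hop _).dd hop _).dd hop _).cont.comp continuousOn_fst (fun p hp => hB hp.1)
  have D2c : ContinuousOn (fun p : Euc n × Euc n => D2 p.2 p.1) K := by
    refine ContinuousOn.congr (f := fun p : Euc n × Euc n => ∑ i, ∑ j, p.2 i * p.2 j *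
      dd (EuclideanSpace.single i 1) (dd (EuclideanSpace.single j 1) w) p.1)
      ?_ (fun p hp => ?_)
    · refine continuousOn_finsetSum _ fun i _ => continuousOn_finsetSum _ fun j _ => ?_
      refine ContinuousOn.mul (by fun_prop) ?_
      exact ((h.sm.dd hop _).dd hop _).cont.comp continuousOn_fst (fun p hp => hB hp.1)
    · have h2 := h.sm.cda2 hop (hB hp.1)
      simp only [D2]
      rw [ddd_exp h2]
      refine Finset.sum_congr rfl fun i _ => Finset.sum_congr rfl fun j _ => ?_
      rw [hessianMatrix_apply h2]
  have ηc : Continuous η := by fun_prop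
  have Ψc : ContinuousOn Ψ K :=
    (((ηc.comp continuous_fst).continuousOn.pow 2).mul (D3c.mul D3c.abs)).div (D2c.pow 3)
      (fun p hp => (pow_pos (D2pos _ (hB hp.1) _ (sph _ hp.2)) 3).ne')
  have hyB : y ∈ Metric.closedBall y r := Metric.mem_closedBall_self hr.le
  have hye : (y, e) ∈ K := ⟨hyB, by simpa using he⟩
  obtain ⟨⟨x, e0⟩, hxe, hmax⟩ := hK.exists_isMaxOn ⟨_, hye⟩ Ψc
  have hxB : x ∈ Metric.closedBall y r := hxe.1
  have hxU := hB hxB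
  have he0 : e0 ≠ 0 := sph _ hxe.2
  have hΨy : 0 < Ψ (y, e) := by
    have h1 : 0 < D2 e y := D2pos y (hB hyB) e (sph _ hye.2)
    have h2 : 0 < D3 e y := hpos
    have h3 : 0 < η y := by simp [η]; positivity
    simp only [Ψ]; positivity
  have hΨx : Ψ (y, e) ≤ Ψ (x, e0) := hmax hye
  -- rescale
  set s := (Real.sqrt (D2 e0 x))⁻¹ with hs
  have hsq : 0 < Real.sqrt (D2 e0 x) := Real.sqrt_pos.2 (D2pos x hxU e0 he0)
  have hspos : 0 < s := inv_pos.2 hsq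
  set e1 := s • e0 with he1
  have he1n : e1 ≠ 0 := smul_ne_zero hspos.ne' he0
  have hom : ∀ z ∈ U, ∀ a ≠ 0, ∀ c : ℝ, 0 < c → Ψ (z, c • a) = Ψ (z, a) := by
    intro z hz a ha c hc
    have h1 := d3_smul h.sm hop a c hz
    have h2 := d2_smul (h.sm.cda2 hop hz) a c
    simp only [Ψ, D3, D2]
    rw [h1, h2, abs_mul, abs_of_pos (pow_pos hc 3)]
    have h3 := (D2pos z hz a ha).ne'
    simp only [D2] at h3
    field_simp
  have hD2e1 : D2 e1 x = 1 := by
    simp only [D2, he1]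
    rw [d2_smul (h.sm.cda2 hop hxU)]
    have : D2 e0 x = Real.sqrt (D2 e0 x) ^ 2 := (Real.sq_sqrt (D2pos x hxU e0 he0).le).symm
    simp only [D2] at this
    rw [this, hs]
    simp only [D2] at hsq ⊢
    field_simp
  have hmax2 : ∀ z ∈ Metric.closedBall y r, ∀ a, a ≠ 0 → Ψ (z, a) ≤ Ψ (x, e1) := by
    intro z hz a ha
    have hna : 0 < ‖a‖ := norm_pos_iff.2 ha
    rw [he1, hom x hxU e0 he0 s hspos, ← hom z (hB hz) a ha _ (inv_pos.2 hna)]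
    refine hmax (show (z, ‖a‖⁻¹ • a) ∈ K from ⟨hz, ?_⟩)
    simp [norm_smul, hna.ne']
  have hΨ1 : 0 < Ψ (x, e1) := lt_of_lt_of_le hΨy (hmax2 y hyB e (sph _ hye.2))
  set τ := D3 e1 x with hτdef
  have hηnn : 0 ≤ η x := by
    have := hxB
    rw [Metric.mem_closedBall, dist_eq_norm] at this
    have h0 := norm_nonneg (x - y)
    simp only [η]; nlinarith
  have hΨval : Ψ (x, e1) = η x ^ 2 * (τ * |τ|) := by simp only [Ψ, hD2e1]; simp [hτdef]
  have hη : 0 < η x := by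
    rcases hηnn.lt_or_eq with h1 | h1
    · exact h1
    · rw [hΨval, ← h1] at hΨ1; simp at hΨ1
  have hτ : 0 < τ := by
    by_contra hn
    push Not at hn
    rw [hΨval] at hΨ1
    have : τ * |τ| ≤ 0 := mul_nonpos_of_nonpos_of_nonneg hn (abs_nonneg _)
    have h2 : η x ^ 2 * (τ * |τ|) ≤ 0 := mul_nonpos_of_nonneg_of_nonpos (sq_nonneg _) this
    linarith
  have hxball : x ∈ Metric.ball y r := by
    rw [Metric.mem_ball, dist_eq_norm]
    simp only [η] at hη
    have h0 := norm_nonneg (x - y)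
    nlinarith
  -- jets along (x + t v, e1 + t b)
  have jets : ∀ v b, _ ∧ _ := fun v b =>
    (show J2 (fun t : ℝ => 2 * Real.log (r ^ 2 - ‖x + t • v - y‖ ^ 2)
      + 2 * Real.log (dd e1 (dd e1 (dd e1 w)) (x + t • v) + t * (3 * dd b (dd e1 (dd e1 w)) (x + t • v))
        + t * (t * (3 * dd b (dd b (dd e1 w)) (x + t • v))) + t * (t * (t * dd b (dd b (dd b w)) (x + t • v))))
      - 3 * Real.log (dd e1 (dd e1 w) (x + t • v) + t * (2 * dd b (dd e1 w) (x + t • v))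
        + t * (t * dd b (dd b w) (x + t • v)))) _ _ _ from
    ((((eta_J2 y x v r).log hη).smul 2).add
      ((J2.cast (a' := τ) (b' := dd v (dd e1 (dd e1 (dd e1 w))) x + 3 * dd b (dd e1 (dd e1 w)) x)
        (c' := dd v (dd v (dd e1 (dd e1 (dd e1 w)))) x + 6 * dd v (dd b (dd e1 (dd e1 w))) x + 6 * dd b (dd b (dd e1 w)) x)
        ((((J2_line ((((h.sm.dd hop e1).dd hop e1).dd hop e1).cda2 hop hxU) v).add
        (J2.id.mul ((J2_line ((((h.sm.dd hop e1).dd hop e1).dd hop b).cda2 hop hxU) v).smul 3))).add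
        (J2.id.mul (J2.id.mul ((J2_line ((((h.sm.dd hop e1).dd hop b).dd hop b).cda2 hop hxU) v).smul 3)))).add
        (J2.id.mul (J2.id.mul (J2.id.mul (J2_line ((((h.sm.dd hop b).dd hop b).dd hop b).cda2 hop hxU) v)))))
        (by simp only [hτdef, D3]; ring) (by ring) (by ring)).log hτ |>.smul 2)).sub
      ((J2.cast (a' := 1) (b' := dd v (dd e1 (dd e1 w)) x + 2 * dd b (dd e1 w) x)
        (c' := dd v (dd v (dd e1 (dd e1 w))) x + 4 * dd v (dd b (dd e1 w)) x + 2 * dd b (dd b w) x)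
        (((J2_line (((h.sm.dd hop e1).dd hop e1).cda2 hop hxU) v).add
        (J2.id.mul ((J2_line (((h.sm.dd hop e1).dd hop b).cda2 hop hxU) v).smul 2))).add
        (J2.id.mul (J2.id.mul (J2_line (((h.sm.dd hop b).dd hop b).cda2 hop hxU) v))))
        (by rw [← hD2e1]; simp only [D2]; ring) (by ring) (by ring)).log one_pos |>.smul 3)).max
    (by
      have hev1 : ∀ᶠ t in 𝓝 (0:ℝ), e1 + t • b ≠ 0 :=
        (line_tendsto e1 b).eventually (isOpen_ne.mem_nhds he1n)
      have hev2 := line_eventually Metric.isOpen_ball hxball v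
      have c1 : ContinuousAt (fun t : ℝ => D3 (e1 + t • b) (x + t • v)) 0 := by
        have hc : ∀ {f : Euc n → ℝ}, Sm U f → ContinuousAt (fun t : ℝ => f (x + t • v)) 0 := fun hf =>
          (J2_line (hf.cda2 hop hxU) v).continuousAt
        have i1 := hc (((h.sm.dd hop e1).dd hop e1).dd hop e1)
        have i2 := hc (((h.sm.dd hop e1).dd hop e1).dd hop b)
        have i3 := hc (((h.sm.dd hop e1).dd hop b).dd hop b)
        have i4 := hc (((h.sm.dd hop b).dd hop b).dd hop b)
        have it : ContinuousAt (fun t : ℝ => t) 0 := continuousAt_id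
        refine ContinuousAt.congr ((((i1.add (it.mul (continuousAt_const (y := (3:ℝ)) |>.mul i2)))).add
          (it.mul (it.mul (continuousAt_const (y := (3:ℝ)) |>.mul i3)))).add
          (it.mul (it.mul (it.mul i4)))) ?_
        filter_upwards [line_eventually hop hxU v] with t ht
        exact (cubic_exp h.sm hop e1 b t ht).symm
      have hev3 : ∀ᶠ t in 𝓝 (0:ℝ), 0 < D3 (e1 + t • b) (x + t • v) :=
        c1.eventually (lt_mem_nhds (by simpa using hτ))
      filter_upwards [hev1, hev2, hev3] with t h1 h2 h3
      have h2' : x + t • v ∈ U := hB (Metric.ball_subset_closedBall h2)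
      have key : ∀ z a, z ∈ Metric.ball y r → a ≠ 0 → 0 < D3 a z → 0 < Ψ (z, a) ∧
          2 * Real.log (r ^ 2 - ‖z - y‖ ^ 2) + 2 * Real.log (D3 a z) - 3 * Real.log (D2 a z) = Real.log (Ψ (z, a)) := by
        intro z a hz ha h3
        have p1 : 0 < η z := by
          rw [Metric.mem_ball, dist_eq_norm] at hz
          have h0 := norm_nonneg (z - y)
          simp only [η]; nlinarith
        have p2 : 0 < D2 a z := D2pos z (hB (Metric.ball_subset_closedBall hz)) a ha
        refine ⟨by simp only [Ψ]; positivity, ?_⟩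
        simp only [Ψ]
        rw [abs_of_pos h3, Real.log_div (by positivity) (by positivity), Real.log_mul (by positivity) (by positivity),
          Real.log_mul h3.ne' h3.ne', Real.log_pow, Real.log_pow]
        push_cast
        ring
      have k1 := key _ _ h2 h1 h3
      have k2 := key x e1 hxball he1n hτ
      have t1 := cubic_exp h.sm hop e1 b t h2'
      have t2 := quad_exp h.sm hop e1 b t h2'
      rw [← t1, ← t2]
      simp only [zero_smul, add_zero, zero_mul]
      simp only [D3, D2] at k1 k2
      rw [k1.2, k2.2]
      exact Real.log_le_log k1.1 (hmax2 _ (Metric.ball_subset_closedBall h2) _ h1))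
  obtain ⟨v, hv⟩ := h.frame hxU
  have core := calabi_core h hxU hτ (hτdef.symm) hD2e1 hv (fun v => -2 * inner ℝ (x - y) v) (fun v => -2 * ‖v‖ ^ 2)
    (r ^ 2 - ‖x - y‖ ^ 2) hη (by simp) (by simp) jets
  have hvn : ∀ i, ‖v i‖ ^ 2 ≤ 1 / lam := by
    intro i
    have h1 := hlo x hxB (v i)
    rw [hv.orth, if_pos rfl] at h1
    rw [le_div_iff₀ hl]; linarith
  have hxr : ‖x - y‖ ^ 2 ≤ r ^ 2 := by simp only [η] at hη; linarith
  have hηr : η x ≤ r ^ 2 := by simp only [η]; nlinarith [sq_nonneg ‖x - y‖]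
  have hbound : η x ^ 2 * τ ^ 2 ≤ 40 * n * r ^ 2 / lam := by
    have h1 : ∀ i, (2 * (-2 * inner ℝ (x - y) (v i) / η x) ^ 2 - -2 * ‖v i‖ ^ 2 / η x) * η x ^ 2 ≤ 10 * r ^ 2 / lam := by
      intro i
      have h2 : (2 * (-2 * inner ℝ (x - y) (v i) / η x) ^ 2 - -2 * ‖v i‖ ^ 2 / η x) * η x ^ 2
        = 8 * (inner ℝ (x - y) (v i)) ^ 2 + 2 * ‖v i‖ ^ 2 * η x := by field_simp; ring
      have h3 : (inner ℝ (x - y) (v i)) ^ 2 ≤ ‖x - y‖ ^ 2 * ‖v i‖ ^ 2 := by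
        rw [← mul_pow, ← sq_abs]
        exact pow_le_pow_left₀ (abs_nonneg _) (abs_real_inner_le_norm _ _) 2
      have h4 : ‖x - y‖ ^ 2 * ‖v i‖ ^ 2 ≤ r ^ 2 * (1 / lam) :=
        mul_le_mul hxr (hvn i) (sq_nonneg _) (sq_nonneg _)
      have h5 : ‖v i‖ ^ 2 * η x ≤ (1 / lam) * r ^ 2 :=
        mul_le_mul (hvn i) hηr hη.le (by positivity)
      rw [h2]
      have : 10 * r ^ 2 / lam = 10 * (r ^ 2 * (1 / lam)) := by ring
      rw [this]; nlinarith
    have h6 := mul_le_mul_of_nonneg_right core (sq_nonneg (η x))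
    have h7 : (∑ i, (2 * (-2 * inner ℝ (x - y) (v i) / η x) ^ 2 - -2 * ‖v i‖ ^ 2 / η x)) * η x ^ 2 ≤ n * (10 * r ^ 2 / lam) := by
      rw [Finset.sum_mul]
      refine (Finset.sum_le_sum fun i _ => h1 i).trans ?_
      simp
    have h8 := h6.trans h7
    have : 40 * n * r ^ 2 / lam = 4 * (n * (10 * r ^ 2 / lam)) := by ring
    rw [this]; linarith
  have hfin := hmax2 y hyB e (sph _ hye.2)
  rw [hΨval, abs_of_pos hτ, ← sq] at hfin
  have hd : 0 < D2 e y := D2pos y (hB hyB) e (sph _ hye.2)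
  have hdL : D2 e y ≤ Lam := by
    have := hhi y hyB e
    rw [he] at this; simpa using this
  have hval : Ψ (y, e) = r ^ 4 * (dd e (dd e (dd e w)) y) ^ 2 / D2 e y ^ 3 := by
    simp only [Ψ, η, D3, sub_self, norm_zero]
    rw [abs_of_pos hpos]; ring
  rw [hval] at hfin
  have h9 := hfin.trans hbound
  rw [div_le_iff₀ (by positivity)] at h9
  have h10 : 40 * n * r ^ 2 / lam * D2 e y ^ 3 ≤ 40 * n * r ^ 2 / lam * Lam ^ 3 := by gcongr
  have h11 := h9.trans h10
  rw [le_div_iff₀ (by positivity)]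
  have h12 : r ^ 2 * (dd e (dd e (dd e w)) y ^ 2 * (lam * r ^ 2)) ≤ r ^ 2 * (40 * n * Lam ^ 3) := by
    calc r ^ 2 * (dd e (dd e (dd e w)) y ^ 2 * (lam * r ^ 2)) = lam * (r ^ 4 * dd e (dd e (dd e w)) y ^ 2) := by ring
      _ ≤ lam * (40 * n * r ^ 2 / lam * Lam ^ 3) := by gcongr
      _ = r ^ 2 * (40 * n * Lam ^ 3) := by field_simp
  exact le_of_mul_le_mul_left h12 (by positivity)
end SecQF

section SecQG
open Filter Topology Set
variable {n : ℕ}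

/-! ### Bernstein gradient estimate for systems -/

set_option maxHeartbeats 1600000 in
lemma bern_alg {lam Lam K0 A k K C c r N η u p F H T F2 F1 Q2 : ℝ} (hl : 0 < lam) (hL : 0 ≤ Lam) (hK0 : 0 ≤ K0)
    (hA : A = 12 * K0 * Lam / lam + 1) (hk : 0 ≤ k) (hK : 0 ≤ K) (hC : 0 ≤ C) (hc : 0 ≤ c) (hr : 0 < r) (hN : 0 ≤ N)
    (hη : 0 < η) (hηr : η ≤ r ^ 2) (hu : 0 < u) (hp : 0 ≤ p) (hF : 0 ≤ F) (hFK : F ≤ K0)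
    (hH : -(2 * N * Lam) ≤ H) (hT : T ≤ 4 * r ^ 2 * Lam) (hF2 : 2 * lam * u ^ 2 - 2 * k * K * C * (1 + u) ≤ F2)
    (hF1 : F1 ≤ 4 * F * Lam * u ^ 2) (hQ2 : 2 * lam * p ^ 2 - 2 * c * C * u * (1 + u ^ 2 + p) ≤ Q2)
    (hmain : 2 * (H / η) - 10 * (T / η ^ 2) + F2 / (A + F) - 3 * (F1 / (A + F) ^ 2) + Q2 / u ^ 2 ≤ 0) :
    η * u ≤ ((4 * N * Lam * r ^ 2 + 40 * r ^ 2 * Lam + (2 * k * K * C + 2 * c * C + (c * C) ^ 2 / (2 * lam)) * r ^ 4)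
      + (2 * k * K * C + 2 * c * C) * r ^ 2) / (lam / (A + K0)) + 1 + r ^ 2 := by
  have hA1 : 1 ≤ A := by rw [hA]; have : 0 ≤ 12 * K0 * Lam / lam := by positivity
                         linarith
  have hAF : 0 < A + F := by linarith
  have hrhs : 0 ≤ ((4 * N * Lam * r ^ 2 + 40 * r ^ 2 * Lam + (2 * k * K * C + 2 * c * C + (c * C) ^ 2 / (2 * lam)) * r ^ 4)
      + (2 * k * K * C + 2 * c * C) * r ^ 2) / (lam / (A + K0)) := by
    have : 0 < A + K0 := by linarith
    positivity
  rcases lt_or_ge u 1 with hu1 | hu1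
  · have : η * u ≤ r ^ 2 * 1 := mul_le_mul hηr hu1.le hu.le (by positivity)
    linarith
  have e1 : -(4 * N * Lam) / η ≤ 2 * (H / η) := by
    rw [← mul_div_assoc]; gcongr; linarith
  have e2 : T / η ^ 2 ≤ 4 * r ^ 2 * Lam / η ^ 2 := by gcongr
  have e3 : 3 * (F1 / (A + F) ^ 2) ≤ lam * u ^ 2 / (A + F) := by
    have h1 : 12 * F * Lam ≤ lam * (A + F) := by
      have : lam * A = 12 * K0 * Lam + lam := by rw [hA]; field_simp
      nlinarith [mul_nonneg hl.le hF, mul_le_mul_of_nonneg_right hFK hL]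
    rw [← mul_div_assoc, div_le_div_iff₀ (by positivity) hAF]
    have h2 : 3 * F1 ≤ lam * (A + F) * u ^ 2 := by nlinarith [mul_le_mul_of_nonneg_right h1 (sq_nonneg u)]
    calc 3 * F1 * (A + F) ≤ lam * (A + F) * u ^ 2 * (A + F) := by gcongr
      _ = lam * u ^ 2 * (A + F) ^ 2 := by ring
  have e4 : 2 * lam * u ^ 2 / (A + F) - 2 * k * K * C * (1 + u) ≤ F2 / (A + F) := by
    have h1 : (2 * lam * u ^ 2 - 2 * k * K * C * (1 + u)) / (A + F) ≤ F2 / (A + F) := by gcongr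
    rw [sub_div] at h1
    have h2 : 2 * k * K * C * (1 + u) / (A + F) ≤ 2 * k * K * C * (1 + u) :=
      div_le_self (by positivity) (by linarith)
    linarith
  have e5 : -(2 * c * C * (1 + u)) - (c * C) ^ 2 / (2 * lam) ≤ Q2 / u ^ 2 := by
    have h1 : (2 * lam * p ^ 2 - 2 * c * C * u * (1 + u ^ 2 + p)) / u ^ 2 ≤ Q2 / u ^ 2 := by gcongr
    refine le_trans ?_ h1
    set s := p / u with hs
    have h2 : (2 * lam * p ^ 2 - 2 * c * C * u * (1 + u ^ 2 + p)) / u ^ 2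
      = 2 * lam * s ^ 2 - 2 * c * C * s - 2 * c * C * (1 / u + u) := by rw [hs]; field_simp; ring
    have h3 : 1 / u ≤ 1 := by rw [div_le_one hu]; exact hu1
    have h4 : 2 * c * C * (1 / u + u) ≤ 2 * c * C * (1 + u) := by gcongr
    have h5 : -((c * C) ^ 2 / (2 * lam)) ≤ 2 * lam * s ^ 2 - 2 * c * C * s := by
      have h6 : (c * C) ^ 2 / (2 * lam) + (2 * lam * s ^ 2 - 2 * c * C * s) = (2 * lam * s - c * C) ^ 2 / (2 * lam) := by
        field_simp; ring
      have : 0 ≤ (2 * lam * s - c * C) ^ 2 / (2 * lam) := by positivity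
      linarith
    rw [h2]; linarith
  have hAK : 0 < A + K0 := by linarith
  have e6 : lam / (A + K0) * u ^ 2 ≤ lam * u ^ 2 / (A + F) := by
    rw [div_mul_eq_mul_div]; gcongr
  set c6 := 2 * k * K * C + 2 * c * C with hc6
  set c7 := (c * C) ^ 2 / (2 * lam) with hc7
  have hc6' : 0 ≤ c6 := by positivity
  have hc7' : 0 ≤ c7 := by positivity
  set α := lam / (A + K0) with hα
  have hα' : 0 < α := by positivity
  have key : α * u ^ 2 ≤ 4 * N * Lam / η + 40 * r ^ 2 * Lam / η ^ 2 + c6 * (1 + u) + c7 := by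
    have h1 : -(4 * N * Lam) / η = -(4 * N * Lam / η) := by ring
    have h2 : 40 * r ^ 2 * Lam / η ^ 2 = 10 * (4 * r ^ 2 * Lam / η ^ 2) := by ring
    have h3 : 2 * lam * u ^ 2 / (A + F) = 2 * (lam * u ^ 2 / (A + F)) := by ring
    rw [h1] at e1; rw [h2]; rw [h3] at e4
    have : c6 * (1 + u) = 2 * k * K * C * (1 + u) + 2 * c * C * (1 + u) := by rw [hc6]; ring
    rw [this]
    linarith
  set X := η * u with hX
  have hX0 : 0 < X := by positivity
  have key2 : α * X ^ 2 ≤ (4 * N * Lam * r ^ 2 + 40 * r ^ 2 * Lam + (c6 + c7) * r ^ 4) + c6 * r ^ 2 * X := by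
    have h1 := mul_le_mul_of_nonneg_right key (sq_nonneg η)
    have h2 : (4 * N * Lam / η + 40 * r ^ 2 * Lam / η ^ 2 + c6 * (1 + u) + c7) * η ^ 2
      = 4 * N * Lam * η + 40 * r ^ 2 * Lam + (c6 + c7) * η ^ 2 + c6 * η * X := by rw [hX]; field_simp; ring
    rw [h2] at h1
    have h3 : η ^ 2 ≤ r ^ 4 := by nlinarith
    have h4 : 4 * N * Lam * η ≤ 4 * N * Lam * r ^ 2 := by gcongr
    have h5 : (c6 + c7) * η ^ 2 ≤ (c6 + c7) * r ^ 4 := by gcongr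
    have h6 : c6 * η * X ≤ c6 * r ^ 2 * X := by gcongr
    have h7 : α * u ^ 2 * η ^ 2 = α * X ^ 2 := by rw [hX]; ring
    linarith
  rcases lt_or_ge X 1 with hX1 | hX1
  · have := sq_nonneg r
    linarith
  · have h8 : X ≤ ((4 * N * Lam * r ^ 2 + 40 * r ^ 2 * Lam + (c6 + c7) * r ^ 4) + c6 * r ^ 2) / α := by
      rw [le_div_iff₀ hα']
      have h9 : 0 ≤ (4 * N * Lam * r ^ 2 + 40 * r ^ 2 * Lam + (c6 + c7) * r ^ 4) := by positivity
      have h10 : (X * α) * X ≤ ((4 * N * Lam * r ^ 2 + 40 * r ^ 2 * Lam + (c6 + c7) * r ^ 4) + c6 * r ^ 2) * X := by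
        nlinarith
      exact le_of_mul_le_mul_right h10 hX0
    have := sq_nonneg r
    linarith

/-- basis vectors -/
def bv (i : Fin n) : Euc n := EuclideanSpace.single i 1

def gradSq {κ : Type} [Fintype κ] (f : κ → Euc n → ℝ) (x : Euc n) : ℝ := ∑ q : κ × Fin n, (dd (bv q.2) (f q.1) x) ^ 2
def hessSq {κ : Type} [Fintype κ] (f : κ → Euc n → ℝ) (x : Euc n) : ℝ :=
  ∑ q : κ × Fin n, ∑ k, (dd (bv k) (dd (bv q.2) (f q.1)) x) ^ 2

lemma dd_bv (v : Euc n) (f : Euc n → ℝ) (x : Euc n) : dd v f x = ∑ i, v i * dd (bv i) f x := by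
  rw [dd_exp v]; rfl

set_option maxHeartbeats 3200000 in
lemma bernst (κ : Type) [Fintype κ] (σ : Type) [Fintype σ] (n : ℕ) {lam Lam C K r : ℝ} (hl : 0 < lam) (hL : 0 ≤ Lam) (hC : 0 ≤ C)
    (hK : 0 ≤ K) (hr : 0 < r) : ∃ C' : ℝ, 0 ≤ C' ∧ ∀ (U : Set (Euc n)) (y : Euc n) (f : κ → Euc n → ℝ), IsOpen U →
    Metric.closedBall y r ⊆ U → (∀ i, Sm U (f i)) → (∀ i, ∀ x ∈ Metric.closedBall y r, |f i x| ≤ K) →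
    (∀ x ∈ Metric.closedBall y r, ∃ v : σ → Euc n, (∀ p : Euc n, lam * ‖p‖ ^ 2 ≤ ∑ s, (inner ℝ p (v s)) ^ 2) ∧
      (∀ p : Euc n, ∑ s, (inner ℝ p (v s)) ^ 2 ≤ Lam * ‖p‖ ^ 2) ∧
      (∀ i, |∑ s, dd (v s) (dd (v s) (f i)) x| ≤ C * (1 + √(gradSq f x))) ∧
      (∀ i k, |∑ s, dd (v s) (dd (v s) (dd (bv k) (f i))) x| ≤ C * (1 + gradSq f x + √(hessSq f x)))) →
    ∀ i k, |dd (bv k) (f i) y| ≤ C' := by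
  set cκ : ℝ := ((Fintype.card κ : ℕ) : ℝ)
  set cμ : ℝ := ((Fintype.card (κ × Fin n) : ℕ) : ℝ)
  set K0 : ℝ := cκ * K ^ 2 with hK0
  set A : ℝ := 12 * K0 * Lam / lam + 1 with hA
  set X0 : ℝ := ((4 * n * Lam * r ^ 2 + 40 * r ^ 2 * Lam + (2 * cκ * K * C + 2 * cμ * C + (cμ * C) ^ 2 / (2 * lam)) * r ^ 4)
      + (2 * cκ * K * C + 2 * cμ * C) * r ^ 2) / (lam / (A + K0)) + 1 + r ^ 2 with hX0
  have hcκ : 0 ≤ cκ := Nat.cast_nonneg _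
  have hcμ : 0 ≤ cμ := Nat.cast_nonneg _
  have hK0' : 0 ≤ K0 := by positivity
  have hA1 : 1 ≤ A := by
    have : 0 ≤ 12 * K0 * Lam / lam := by positivity
    linarith
  have hX0p : 0 ≤ X0 := by positivity
  refine ⟨√((A + K0) * X0 ^ 2 / (r ^ 4 * A)), Real.sqrt_nonneg _, ?_⟩
  intro U y f hU hB hf hfK hL2 i0 k0
  have hyB : y ∈ Metric.closedBall y r := Metric.mem_closedBall_self hr.le
  let F : Euc n → ℝ := fun x => ∑ i, f i x * f i x
  let Q : Euc n → ℝ := fun x => ∑ q : κ × Fin n, dd (bv q.2) (f q.1) x * dd (bv q.2) (f q.1) x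
  let η : Euc n → ℝ := fun x => r ^ 2 - ‖x - y‖ ^ 2
  have hQg : ∀ x, Q x = gradSq f x := fun x => by simp only [Q, gradSq, sq]
  have hFsm : Sm U F := Sm.sum _ fun i _ => (hf i).mul (hf i)
  have hQsm : Sm U Q := Sm.sum _ fun q _ => ((hf q.1).dd hU _).mul ((hf q.1).dd hU _)
  have hF0 : ∀ x, 0 ≤ F x := fun x => Finset.sum_nonneg fun i _ => mul_self_nonneg _
  have hQ0 : ∀ x, 0 ≤ Q x := fun x => Finset.sum_nonneg fun i _ => mul_self_nonneg _
  have hFK : ∀ x ∈ Metric.closedBall y r, F x ≤ K0 := by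
    intro x hx
    have : F x ≤ ∑ i : κ, K ^ 2 := Finset.sum_le_sum fun i _ => by
      rw [← sq, ← sq_abs]; exact pow_le_pow_left₀ (abs_nonneg _) (hfK i x hx) 2
    simpa [hK0, cκ] using this
  let Ψ : Euc n → ℝ := fun x => η x ^ 2 * (A + F x) * Q x
  have Ψc : ContinuousOn Ψ (Metric.closedBall y r) := by
    refine ((Continuous.continuousOn (by fun_prop)).mul (continuousOn_const.add (hFsm.cont.mono hB))).mul (hQsm.cont.mono hB)
  obtain ⟨x, hx, hmax⟩ := (isCompact_closedBall y r).exists_isMaxOn ⟨y, hyB⟩ Ψc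
  have hηy : η y = r ^ 2 := by simp [η]
  have hηr : η x ≤ r ^ 2 := by simp only [η]; nlinarith [sq_nonneg ‖x - y‖]
  have hηnn : 0 ≤ η x := by
    have := hx
    rw [Metric.mem_closedBall, dist_eq_norm] at this
    have h0 := norm_nonneg (x - y)
    simp only [η]; nlinarith
  suffices hX : η x * √(Q x) ≤ X0 by
    have h1 : Ψ x ≤ (A + K0) * X0 ^ 2 := by
      have h2 : Ψ x = (A + F x) * (η x * √(Q x)) ^ 2 := by
        simp only [Ψ]; rw [mul_pow, Real.sq_sqrt (hQ0 x)]; ring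
      rw [h2]
      have := hFK x hx
      have h3 : 0 ≤ η x * √(Q x) := mul_nonneg hηnn (Real.sqrt_nonneg _)
      have := hF0 x
      gcongr
    have h4 : r ^ 4 * A * Q y ≤ Ψ y := by
      simp only [Ψ]; rw [hηy]
      have := hF0 y
      have h5 : r ^ 4 * A * Q y ≤ r ^ 4 * (A + F y) * Q y := by
        have := hQ0 y
        gcongr; linarith
      calc _ ≤ _ := h5
        _ = _ := by ring
    have h6 : Q y ≤ (A + K0) * X0 ^ 2 / (r ^ 4 * A) := by
      rw [le_div_iff₀ (by positivity)]
      have h7 : Ψ y ≤ Ψ x := hmax hyB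
      linarith
    refine Real.abs_le_sqrt (le_trans ?_ h6)
    have := Finset.single_le_sum (f := fun q : κ × Fin n => dd (bv q.2) (f q.1) y * dd (bv q.2) (f q.1) y)
      (fun q _ => mul_self_nonneg _) (Finset.mem_univ (i0, k0))
    rw [sq]; exact this
  rcases hηnn.eq_or_lt with hη | hη
  · rw [← hη, zero_mul]; exact hX0p
  rcases (hQ0 x).eq_or_lt with hQ | hQ
  · rw [← hQ, Real.sqrt_zero, mul_zero]; exact hX0p
  have hxU := hB hx
  have hxball : x ∈ Metric.ball y r := by
    rw [Metric.mem_ball, dist_eq_norm]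
    simp only [η] at hη
    have h0 := norm_nonneg (x - y)
    nlinarith
  have hAF : 0 < A + F x := by linarith [hF0 x]
  obtain ⟨v, hv1, hv2, hv3, hv4⟩ := hL2 x hx
  have jets : ∀ s, _ ∧ _ := fun s =>
    (show J2 (fun t : ℝ => 2 * Real.log (r ^ 2 - ‖x + t • v s - y‖ ^ 2) + Real.log (A + F (x + t • v s))
        + Real.log (Q (x + t • v s))) _ _ _ from
      ((((eta_J2 y x (v s) r).log hη).smul 2).add
        (((J2.const A).add (J2.sum Finset.univ fun i _ => (J2_line ((hf i).cda2 hU hxU) (v s)).mul (J2_line ((hf i).cda2 hU hxU) (v s)))).log hAF)).add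
        ((J2.sum Finset.univ fun q _ => (J2_line (((hf q.1).dd hU (bv q.2)).cda2 hU hxU) (v s)).mul (J2_line (((hf q.1).dd hU (bv q.2)).cda2 hU hxU) (v s))).log hQ)).max (by
      have hev2 := line_eventually Metric.isOpen_ball hxball (v s)
      have hev3 : ∀ᶠ t in 𝓝 (0:ℝ), 0 < Q (x + t • v s) :=
        (J2_line (hQsm.cda2 hU hxU) (v s)).continuousAt.eventually (lt_mem_nhds (by simpa using hQ))
      filter_upwards [hev2, hev3] with t h2 h3
      have key : ∀ z, z ∈ Metric.ball y r → 0 < Q z → 0 < Ψ z ∧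
          2 * Real.log (r ^ 2 - ‖z - y‖ ^ 2) + Real.log (A + F z) + Real.log (Q z) = Real.log (Ψ z) := by
        intro z hz h3
        have p1 : 0 < η z := by
          rw [Metric.mem_ball, dist_eq_norm] at hz
          have h0 := norm_nonneg (z - y)
          simp only [η]; nlinarith
        have p2 : 0 < A + F z := by linarith [hF0 z]
        refine ⟨by simp only [Ψ]; positivity, ?_⟩
        simp only [Ψ]
        rw [Real.log_mul (by positivity) (by positivity), Real.log_mul (by positivity) (by positivity), Real.log_pow]
        push_cast
        ring
      have k1 := key _ h2 h3
      have k2 := key x hxball hQ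
      simp only [zero_smul, add_zero]
      rw [k1.2, k2.2]
      exact Real.log_le_log k1.1 (hmax (Metric.ball_subset_closedBall h2)))
  have hxr : ‖x - y‖ ^ 2 ≤ r ^ 2 := by simp only [η] at hη; linarith
  have hu : 0 < √(Q x) := Real.sqrt_pos.2 hQ
  have husq : √(Q x) ^ 2 = Q x := Real.sq_sqrt hQ.le
  have hR0 : 0 ≤ hessSq f x := Finset.sum_nonneg fun _ _ => Finset.sum_nonneg fun _ _ => sq_nonneg _
  have hpsq : √(hessSq f x) ^ 2 = hessSq f x := Real.sq_sqrt hR0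
  -- gradient vectors
  have grad : ∀ (g : Euc n → ℝ), lam * ∑ k, (dd (bv k) g x) ^ 2 ≤ ∑ s, (dd (v s) g x) ^ 2 ∧
      ∑ s, (dd (v s) g x) ^ 2 ≤ Lam * ∑ k, (dd (bv k) g x) ^ 2 := by
    intro g
    have h1 := hv1 (WithLp.toLp 2 fun k => dd (bv k) g x)
    have h2 := hv2 (WithLp.toLp 2 fun k => dd (bv k) g x)
    have h3 : ‖(WithLp.toLp 2 fun k => dd (bv k) g x : Euc n)‖ ^ 2 = ∑ k, (dd (bv k) g x) ^ 2 := by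
      rw [EuclideanSpace.norm_sq_eq]; simp
    have h4 : ∀ s, inner ℝ (WithLp.toLp 2 fun k => dd (bv k) g x : Euc n) (v s) = dd (v s) g x := by
      intro s
      rw [dd_bv, PiLp.inner_apply]; simp
    simp only [h3, h4] at h1 h2
    exact ⟨h1, h2⟩
  have hvn : ∑ s, ‖v s‖ ^ 2 ≤ n * Lam := by
    have h1 : ∀ s, ‖v s‖ ^ 2 = ∑ i, (inner ℝ (bv i) (v s)) ^ 2 := by
      intro s; rw [EuclideanSpace.norm_sq_eq]
      refine Finset.sum_congr rfl fun i _ => ?_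
      simp [bv, EuclideanSpace.inner_single_left]
    simp only [h1]
    rw [Finset.sum_comm]
    refine (Finset.sum_le_sum fun i _ => hv2 (bv i)).trans ?_
    simp [bv]
  have habs : ∀ q : κ × Fin n, |dd (bv q.2) (f q.1) x| ≤ √(Q x) := by
    intro q
    refine Real.abs_le_sqrt ?_
    have := Finset.single_le_sum (f := fun q : κ × Fin n => dd (bv q.2) (f q.1) x * dd (bv q.2) (f q.1) x)
      (fun q _ => mul_self_nonneg _) (Finset.mem_univ q)
    rw [sq]; exact this
  have hQsum : Q x = ∑ i, ∑ k, (dd (bv k) (f i) x) ^ 2 := by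
    rw [hQg, gradSq, Fintype.sum_prod_type]
  refine bern_alg (H := ∑ s, -2 * ‖v s‖ ^ 2) (T := ∑ s, (-2 * inner ℝ (x - y) (v s)) ^ 2)
    (F2 := ∑ s, ∑ i, (dd (v s) (dd (v s) (f i)) x * f i x + 2 * (dd (v s) (f i) x * dd (v s) (f i) x) + f i x * dd (v s) (dd (v s) (f i)) x))
    (F1 := ∑ s, (∑ i, (dd (v s) (f i) x * f i x + f i x * dd (v s) (f i) x)) ^ 2)
    (Q2 := ∑ s, ∑ q : κ × Fin n, (dd (v s) (dd (v s) (dd (bv q.2) (f q.1))) x * dd (bv q.2) (f q.1) x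
      + 2 * (dd (v s) (dd (bv q.2) (f q.1)) x * dd (v s) (dd (bv q.2) (f q.1)) x)
      + dd (bv q.2) (f q.1) x * dd (v s) (dd (v s) (dd (bv q.2) (f q.1))) x))
    (p := √(hessSq f x)) (F := F x)
    hl hL hK0' hA hcκ hK hC hcμ hr (Nat.cast_nonneg n) hη hηr hu (Real.sqrt_nonneg _) (hF0 x) (hFK x hx) ?_ ?_ ?_ ?_ ?_ ?_
  · rw [← Finset.mul_sum]; linarith
  · have h1 := hv2 (x - y)
    simp only [mul_pow, ← Finset.mul_sum]
    nlinarith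
  · have h1 : ∑ s, ∑ i, (dd (v s) (dd (v s) (f i)) x * f i x + 2 * (dd (v s) (f i) x * dd (v s) (f i) x) + f i x * dd (v s) (dd (v s) (f i)) x)
      = ∑ i, (2 * ∑ s, (dd (v s) (f i) x) ^ 2 + 2 * (f i x * ∑ s, dd (v s) (dd (v s) (f i)) x)) := by
      rw [Finset.sum_comm]
      refine Finset.sum_congr rfl fun i _ => ?_
      simp only [Finset.mul_sum, ← Finset.sum_add_distrib]
      refine Finset.sum_congr rfl fun s _ => by ring
    rw [h1, husq]
    have h2 : ∀ i, 2 * (lam * ∑ k, (dd (bv k) (f i) x) ^ 2) - 2 * (K * (C * (1 + √(Q x)))) ≤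
        2 * ∑ s, (dd (v s) (f i) x) ^ 2 + 2 * (f i x * ∑ s, dd (v s) (dd (v s) (f i)) x) := by
      intro i
      have h3 := (grad (f i)).1
      have h4 : |f i x * ∑ s, dd (v s) (dd (v s) (f i)) x| ≤ K * (C * (1 + √(Q x))) := by
        rw [abs_mul, hQg]; exact mul_le_mul (hfK i x hx) (hv3 i) (abs_nonneg _) hK
      have := (abs_le.1 h4).1
      linarith
    refine le_trans (le_of_eq ?_) (Finset.sum_le_sum fun i _ => h2 i)
    rw [Finset.sum_sub_distrib, ← Finset.mul_sum, ← Finset.mul_sum, ← hQsum]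
    simp [cκ]; ring
  · rw [husq]
    have h1 : ∀ s, (∑ i, (dd (v s) (f i) x * f i x + f i x * dd (v s) (f i) x)) ^ 2 ≤ 4 * (F x * ∑ i, (dd (v s) (f i) x) ^ 2) := by
      intro s
      have h2 : ∑ i, (dd (v s) (f i) x * f i x + f i x * dd (v s) (f i) x) = 2 * ∑ i, f i x * dd (v s) (f i) x := by
        rw [Finset.mul_sum]; exact Finset.sum_congr rfl fun i _ => by ring
      have h3 := Finset.sum_mul_sq_le_sq_mul_sq Finset.univ (fun i => f i x) (fun i => dd (v s) (f i) x)
      have h4 : F x = ∑ i, f i x ^ 2 := by simp only [F, sq]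
      rw [h2, h4, mul_pow]; linarith
    refine (Finset.sum_le_sum fun s _ => h1 s).trans ?_
    rw [← Finset.mul_sum, ← Finset.mul_sum, Finset.sum_comm]
    have h5 : ∑ i, ∑ s, (dd (v s) (f i) x) ^ 2 ≤ Lam * Q x := by
      rw [hQsum, Finset.mul_sum]; exact Finset.sum_le_sum fun i _ => (grad (f i)).2
    have := mul_le_mul_of_nonneg_left h5 (hF0 x)
    linarith
  · have h1 : ∑ s, ∑ q : κ × Fin n, (dd (v s) (dd (v s) (dd (bv q.2) (f q.1))) x * dd (bv q.2) (f q.1) x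
      + 2 * (dd (v s) (dd (bv q.2) (f q.1)) x * dd (v s) (dd (bv q.2) (f q.1)) x)
      + dd (bv q.2) (f q.1) x * dd (v s) (dd (v s) (dd (bv q.2) (f q.1))) x)
      = ∑ q : κ × Fin n, (2 * ∑ s, (dd (v s) (dd (bv q.2) (f q.1)) x) ^ 2
        + 2 * (dd (bv q.2) (f q.1) x * ∑ s, dd (v s) (dd (v s) (dd (bv q.2) (f q.1))) x)) := by
      rw [Finset.sum_comm]
      refine Finset.sum_congr rfl fun i _ => ?_
      simp only [Finset.mul_sum, ← Finset.sum_add_distrib]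
      refine Finset.sum_congr rfl fun s _ => by ring
    rw [h1, hpsq, husq]
    have h2 : ∀ q : κ × Fin n, 2 * (lam * ∑ k, (dd (bv k) (dd (bv q.2) (f q.1)) x) ^ 2)
        - 2 * (√(Q x) * (C * (1 + Q x + √(hessSq f x)))) ≤
        (2 * ∑ s, (dd (v s) (dd (bv q.2) (f q.1)) x) ^ 2
        + 2 * (dd (bv q.2) (f q.1) x * ∑ s, dd (v s) (dd (v s) (dd (bv q.2) (f q.1))) x)) := by
      intro q
      have h3 := (grad (dd (bv q.2) (f q.1))).1
      have h4 : |dd (bv q.2) (f q.1) x * ∑ s, dd (v s) (dd (v s) (dd (bv q.2) (f q.1))) x| ≤ √(Q x) * (C * (1 + Q x + √(hessSq f x))) := by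
        rw [abs_mul]; refine mul_le_mul (habs q) ?_ (abs_nonneg _) hu.le
        rw [hQg]; exact hv4 q.1 q.2
      have := (abs_le.1 h4).1
      linarith
    refine le_trans (le_of_eq ?_) (Finset.sum_le_sum fun i _ => h2 i)
    rw [Finset.sum_sub_distrib, ← Finset.mul_sum, ← Finset.mul_sum]
    rw [Finset.sum_const, Finset.card_univ, nsmul_eq_mul]
    simp only [hessSq, cμ]; ring
  · have hs := Finset.sum_nonpos (s := Finset.univ) fun s _ => (jets s).2
    refine le_trans ?_ hs
    rw [husq]
    simp only [Finset.sum_div, Finset.mul_sum (s := (Finset.univ : Finset σ)), ← Finset.sum_add_distrib, ← Finset.sum_sub_distrib]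
    refine Finset.sum_le_sum fun s _ => ?_
    have j1 := (jets s).1
    simp only [zero_add] at j1 ⊢
    have e1 : (-2 * inner ℝ (x - y) (v s)) ^ 2 / η x ^ 2 = (-2 * inner ℝ (x - y) (v s) / η x) ^ 2 := by rw [div_pow]
    have e2 : (∑ i, (dd (v s) (f i) x * f i x + f i x * dd (v s) (f i) x)) ^ 2 / (A + F x) ^ 2
      = ((∑ i, (dd (v s) (f i) x * f i x + f i x * dd (v s) (f i) x)) / (A + F x)) ^ 2 := by rw [div_pow]
    rw [e1, e2]
    simp only [← Finset.sum_div]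
    have alg : ∀ h1 a b h2 f2 q2 : ℝ, 2 * h1 + a + b = 0 →
      2 * h2 - 10 * h1 ^ 2 + f2 - 3 * a ^ 2 + q2 ≤ 2 * (h2 - h1 ^ 2) + (f2 - a ^ 2) + (q2 - b ^ 2) := by
      intro h1 a b h2 f2 q2 h
      have : b = - (2 * h1) - a := by linarith
      rw [this]; nlinarith [sq_nonneg (2 * h1 - a)]
    exact alg _ _ _ _ _ _ j1
end SecQG

section SecQH
open Filter Topology Set
variable {n : ℕ}

/-! ### Symbolic differential polynomials with a grading -/

inductive Ex (n : ℕ) (τ : Type) : Type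
  | con (r : ℝ) : Ex n τ
  | atm (a : τ) : Ex n τ
  | add (a b : Ex n τ) : Ex n τ
  | mul (a b : Ex n τ) : Ex n τ
  | sum (f : Fin n → Ex n τ) : Ex n τ

namespace Ex
variable {τ : Type}

def eval (ev : τ → Euc n → ℝ) : Ex n τ → Euc n → ℝ
  | con r => fun _ => r
  | atm a => ev a
  | add a b => fun x => eval ev a x + eval ev b x
  | mul a b => fun x => eval ev a x * eval ev b x
  | sum f => fun x => ∑ i, eval ev (f i) x

def grade (gr : τ → ℕ) : Ex n τ → ℕ
  | con _ => 0
  | atm a => gr a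
  | add a b => max (grade gr a) (grade gr b)
  | mul a b => grade gr a + grade gr b
  | sum f => Finset.univ.sup fun i => grade gr (f i)

def der (dr : Fin n → τ → Ex n τ) (k : Fin n) : Ex n τ → Ex n τ
  | con _ => con 0
  | atm a => dr k a
  | add a b => add (der dr k a) (der dr k b)
  | mul a b => add (mul (der dr k a) b) (mul a (der dr k b))
  | sum f => sum fun i => der dr k (f i)

lemma grade_der {gr : τ → ℕ} {dr : Fin n → τ → Ex n τ} (h : ∀ k a, grade gr (dr k a) ≤ gr a + 1) (k : Fin n) (e : Ex n τ) :
    grade gr (der dr k e) ≤ grade gr e + 1 := by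
  induction e with
  | con r => simp [grade, der]
  | atm a => exact h k a
  | add a b ha hb => simp only [grade, der]; omega
  | mul a b ha hb => simp only [grade, der]; omega
  | sum f hf =>
    simp only [grade, der]
    refine Finset.sup_le fun i _ => (hf i).trans ?_
    have := Finset.le_sup (f := fun i => grade gr (f i)) (Finset.mem_univ i)
    omega

lemma sm {ev : τ → Euc n → ℝ} {U : Set (Euc n)} (h : ∀ a, Sm U (ev a)) (e : Ex n τ) : Sm U (eval ev e) := by
  induction e with
  | con r => exact Sm.const r
  | atm a => exact h a
  | add a b ha hb => exact ha.add hb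
  | mul a b ha hb => exact ha.mul hb
  | sum f hf => exact Sm.sum _ fun i _ => hf i

lemma eval_der {ev : τ → Euc n → ℝ} {U : Set (Euc n)} (hU : IsOpen U) (h : ∀ a, Sm U (ev a)) {dr : Fin n → τ → Ex n τ}
    (hd : ∀ k a, ∀ x ∈ U, dd (bv k) (ev a) x = eval ev (dr k a) x) (k : Fin n) (e : Ex n τ) :
    ∀ x ∈ U, dd (bv k) (eval ev e) x = eval ev (der dr k e) x := by
  induction e with
  | con r => intro x hx; simp only [eval, der]; exact dd_const _ _
  | atm a => exact hd k a
  | add a b ha hb =>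
    intro x hx
    simp only [eval, der]
    rw [dd_add ((sm h a).diff hU hx) ((sm h b).diff hU hx), ha x hx, hb x hx]
  | mul a b ha hb =>
    intro x hx
    simp only [eval, der]
    rw [dd_mul ((sm h a).diff hU hx) ((sm h b).diff hU hx), ha x hx, hb x hx]
  | sum f hf =>
    intro x hx
    simp only [eval, der]
    rw [dd_sum _ (fun i _ => (sm h (f i)).diff hU hx)]
    exact Finset.sum_congr rfl fun i _ => hf i x hx

lemma bound (gr : τ → ℕ) (K C0 : ℝ) (hK : 0 ≤ K) (hC0 : 0 ≤ C0) (p0 : ℕ) (e : Ex n τ) (he : grade gr e ≤ p0) :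
    ∃ C : ℝ, 0 ≤ C ∧ ∀ (ev : τ → Euc n → ℝ) (N : ℕ → ℝ) (x : Euc n), (∀ p, 1 ≤ N p) → Monotone N →
      (∀ a b, a + b ≤ p0 → N a * N b ≤ C0 * N (a + b)) → (∀ a, gr a ≤ p0 → |ev a x| ≤ K * N (gr a)) →
      |eval ev e x| ≤ C * N (grade gr e) := by
  induction e with
  | con r =>
    refine ⟨|r|, abs_nonneg _, fun ev N x h1 _ _ _ => ?_⟩
    simp only [eval]
    exact le_mul_of_one_le_right (abs_nonneg _) (h1 _)
  | atm a => exact ⟨K, hK, fun ev N x _ _ _ h => h a he⟩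
  | add a b ha hb =>
    simp only [grade] at he
    obtain ⟨Ca, ha0, ha⟩ := ha (by omega)
    obtain ⟨Cb, hb0, hb⟩ := hb (by omega)
    refine ⟨Ca + Cb, by positivity, fun ev N x h1 h2 h3 h4 => ?_⟩
    have i1 := ha ev N x h1 h2 h3 h4
    have i2 := hb ev N x h1 h2 h3 h4
    simp only [eval, grade]
    have j1 : N (grade gr a) ≤ N (max (grade gr a) (grade gr b)) := h2 (le_max_left _ _)
    have j2 : N (grade gr b) ≤ N (max (grade gr a) (grade gr b)) := h2 (le_max_right _ _)
    refine (abs_add_le _ _).trans ?_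
    nlinarith
  | mul a b ha hb =>
    simp only [grade] at he
    obtain ⟨Ca, ha0, ha⟩ := ha (by omega)
    obtain ⟨Cb, hb0, hb⟩ := hb (by omega)
    refine ⟨Ca * Cb * C0, by positivity, fun ev N x h1 h2 h3 h4 => ?_⟩
    have i1 := ha ev N x h1 h2 h3 h4
    have i2 := hb ev N x h1 h2 h3 h4
    have i3 := h3 _ _ he
    simp only [eval, grade]
    rw [abs_mul]
    calc |eval ev a x| * |eval ev b x| ≤ (Ca * N (grade gr a)) * (Cb * N (grade gr b)) :=
          mul_le_mul i1 i2 (abs_nonneg _) ((abs_nonneg _).trans i1)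
      _ = Ca * Cb * (N (grade gr a) * N (grade gr b)) := by ring
      _ ≤ Ca * Cb * (C0 * N (grade gr a + grade gr b)) := by gcongr
      _ = _ := by ring
  | sum f hf =>
    simp only [grade] at he
    have hle : ∀ i, grade gr (f i) ≤ Finset.univ.sup fun i => grade gr (f i) := fun i =>
      Finset.le_sup (f := fun i => grade gr (f i)) (Finset.mem_univ i)
    have h' := fun i => hf i ((hle i).trans he)
    choose C hC0' hC using h'
    refine ⟨∑ i, C i, Finset.sum_nonneg fun i _ => hC0' i, fun ev N x h1 h2 h3 h4 => ?_⟩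
    simp only [eval, grade]
    refine (Finset.abs_sum_le_sum_abs _ _).trans ?_
    rw [Finset.sum_mul]
    refine Finset.sum_le_sum fun i _ => (hC i ev N x h1 h2 h3 h4).trans ?_
    have := h2 (hle i)
    have := hC0' i
    gcongr
end Ex
end SecQH

section SecQI
open Filter Topology Set
variable {n : ℕ}

/-! ### The inverse Hessian -/

def GI (w : Euc n → ℝ) (i j : Fin n) : Euc n → ℝ := fun x => (hessianMatrix w x)⁻¹ i j

lemma Sm.det {U : Set (Euc n)} {M : Fin n → Fin n → Euc n → ℝ} (h : ∀ i j, Sm U (M i j)) :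
    Sm U (fun x => (Matrix.of fun i j => M i j x).det) := by
  simp only [Matrix.det_apply, Matrix.of_apply, Units.smul_def, zsmul_eq_mul]
  refine Sm.sum _ fun s _ => (Sm.const _).mul ?_
  exact contDiffOn_prod fun i _ => h _ _

lemma hess_sm {U : Set (Euc n)} {w : Euc n → ℝ} (hU : IsOpen U) (h : Sm U w) (i j : Fin n) :
    Sm U (fun x => hessianMatrix w x i j) :=
  ((h.dd hU (bv j)).dd hU (bv i)).congr fun x hx => hessianMatrix_apply (h.cda2 hU hx) i j

lemma MA.GI_sm {U : Set (Euc n)} {w : Euc n → ℝ} (h : MA U w) (i j : Fin n) : Sm U (GI w i j) := by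
  have h1 : Sm U (fun x => (Matrix.of fun a b => if a = j then (Pi.single i (1:ℝ) : Fin n → ℝ) b else hessianMatrix w x a b).det) := by
    refine Sm.det fun a b => ?_
    by_cases hab : a = j
    · simp only [hab, if_true]; exact Sm.const _
    · simp only [hab, if_false]; exact hess_sm h.op h.sm a b
  refine h1.congr fun x hx => ?_
  have hd : (hessianMatrix w x).det = 1 := h.det x hx
  unfold GI
  rw [Matrix.inv_def, hd, Ring.inverse_one, one_smul, Matrix.adjugate_apply]
  congr 1
  ext a b
  rw [Matrix.updateRow_apply]; rfl

lemma MA.MDl {U : Set (Euc n)} {w : Euc n → ℝ} (h : MA U w) {x : Euc n} (hx : x ∈ U) (e : Euc n) :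
    MD (fun t : ℝ => hessianMatrix w (x + t • e)) (Matrix.of fun i j => dd e (dd (bv i) (dd (bv j) w)) x) 0 := by
  intro i j
  have hs := (h.sm.dd h.op (bv j)).dd h.op (bv i)
  have h1 := hasDerivAt_line (f := dd (bv i) (dd (bv j) w)) (x := x) (v := e) (t := 0) (by simpa using hs.diff h.op hx)
  simp only [zero_smul, add_zero] at h1
  refine h1.congr_of_eventuallyEq ?_
  filter_upwards [line_eventually h.op hx e] with t ht
  exact hessianMatrix_apply (h.sm.cda2 h.op ht) i j

lemma MA.GI_dd {U : Set (Euc n)} {w : Euc n → ℝ} (h : MA U w) {x : Euc n} (hx : x ∈ U) (k i j : Fin n) :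
    dd (bv k) (GI w i j) x = ∑ p, ∑ q, (-1) * ((GI w i p x * dd (bv k) (dd (bv p) (dd (bv q) w)) x) * GI w q j x) := by
  have hdet : (hessianMatrix w x).det = 1 := h.det x hx
  have h1 := (h.MDl hx (bv k)).inv (by simp [hdet]) i j
  have h2 := hasDerivAt_line (f := GI w i j) (x := x) (v := bv k) (t := 0) (by simpa using (h.GI_sm i j).diff h.op hx)
  simp only [zero_smul, add_zero] at h1 h2
  have := h2.unique h1
  rw [show dd (bv k) (GI w i j) x = _ from this]
  simp only [Matrix.neg_apply, Matrix.mul_apply, Matrix.of_apply, Finset.sum_mul]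
  rw [← Finset.sum_neg_distrib, ]
  rw [Finset.sum_comm' (s := Finset.univ) (t := fun _ => Finset.univ) (t' := Finset.univ) (s' := fun _ => Finset.univ) (by simp)]
  simp only [← Finset.sum_neg_distrib]
  refine Finset.sum_congr rfl fun p _ => Finset.sum_congr rfl fun q _ => ?_
  simp only [GI]; ring

lemma MA.GI_tr {U : Set (Euc n)} {w : Euc n → ℝ} (h : MA U w) {x : Euc n} (hx : x ∈ U) (e : Euc n) :
    ∑ i, ∑ j, GI w i j x * dd e (dd (bv i) (dd (bv j) w)) x = 0 := by
  have hdet : (hessianMatrix w x).det = 1 := h.det x hx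
  have h1 := (h.MDl hx e).det (by simp [hdet])
  simp only [zero_smul, add_zero] at h1
  have h2 : HasDerivAt (fun t : ℝ => (hessianMatrix w (x + t • e)).det) 0 0 := by
    refine (hasDerivAt_const (0:ℝ) (1:ℝ)).congr_of_eventuallyEq ?_
    filter_upwards [line_eventually h.op hx e] with t ht
    exact h.det _ ht
  have := h1.unique h2
  rw [hdet, one_mul] at this
  simp only [Matrix.trace, Matrix.diag, Matrix.mul_apply, Matrix.of_apply] at this
  rw [← this]
  refine Finset.sum_congr rfl fun i _ => Finset.sum_congr rfl fun j _ => ?_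
  rw [dd_congr h.op (fun z hz => dd_comm h.sm h.op hz (bv i) (bv j)) e x hx]; rfl

/-- the frame representation of the linearized operator -/
lemma MA.Gframe {U : Set (Euc n)} {w : Euc n → ℝ} (h : MA U w) {x : Euc n} (hx : x ∈ U) {lam Lam : ℝ} (hl : 0 < lam) (hL : 0 < Lam)
    (hlo : ∀ v, lam * ‖v‖ ^ 2 ≤ dd v (dd v w) x)
    (hhi : ∀ v, dd v (dd v w) x ≤ Lam * ‖v‖ ^ 2) : ∃ v : Fin n → Euc n, (∀ i j, ∑ s, v s i * v s j = GI w i j x) ∧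
    (∀ p : Euc n, ‖p‖ ^ 2 ≤ Lam * ∑ s, (inner ℝ p (v s)) ^ 2) ∧
      (∀ p : Euc n, ∑ s, (inner ℝ p (v s)) ^ 2 ≤ lam⁻¹ * ‖p‖ ^ 2) := by
  obtain ⟨v, hv⟩ := h.frame hx
  have hcd := h.sm.cda2 h.op hx
  refine ⟨v, ?_, ?_, ?_⟩
  · let B : Matrix (Fin n) (Fin n) ℝ := Matrix.of fun i j => ∑ s, v s i * v s j
    have hB : B * hessianMatrix w x = 1 := by
      ext i j
      have := congrArg (fun z : Euc n => z i) (hv.span (bv j))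
      simp only [PiLp.smul_apply, smul_eq_mul, WithLp.ofLp_sum, Finset.sum_apply, WithLp.ofLp_smul, Pi.smul_apply] at this
      rw [Matrix.mul_apply, Matrix.one_apply]
      have e1 : (bv j : Euc n) i = if i = j then 1 else 0 := by simp [bv, Pi.single_apply]
      rw [← e1, this]
      simp only [B, Matrix.of_apply, Finset.sum_mul]
      rw [Finset.sum_comm]
      refine Finset.sum_congr rfl fun s _ => ?_
      rw [dd_comm_at hcd, dd_exp (v s)]
      simp only
      rw [Finset.sum_mul]
      refine Finset.sum_congr rfl fun k _ => ?_
      rw [hessianMatrix_apply hcd]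
      simp only [bv]; ring
    intro i j
    rw [show ∑ s, v s i * v s j = B i j from rfl, GI, Matrix.inv_eq_left_inv hB]
  · intro p
    set c : Fin n → ℝ := fun i => dd p (dd (v i) w) x with hc
    have e1 : ‖p‖ ^ 2 = ∑ i, c i * inner ℝ p (v i) := by
      rw [← real_inner_self_eq_norm_sq]
      conv_lhs => arg 3; rw [hv.span p]
      rw [inner_sum]
      simp only [inner_smul_right, hc]
    have e2 : dd p (dd p w) x = ∑ i, c i ^ 2 := by
      conv_lhs => arg 1; rw [hv.span p]
      rw [dd_lc_left]
      refine Finset.sum_congr rfl fun i _ => ?_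
      rw [dd_comm_at hcd (v i) p]; simp only [hc]; ring
    have e3 := Finset.sum_mul_sq_le_sq_mul_sq Finset.univ c (fun i => inner ℝ p (v i))
    rw [← e1, ← e2] at e3
    have e4 := hhi p
    have e5 : 0 ≤ ∑ s, (inner ℝ p (v s)) ^ 2 := Finset.sum_nonneg fun _ _ => sq_nonneg _
    rcases eq_or_lt_of_le (sq_nonneg ‖p‖) with e6 | e6
    · rw [← e6]
      exact mul_nonneg hL.le e5
    · have : ‖p‖ ^ 2 * ‖p‖ ^ 2 ≤ ‖p‖ ^ 2 * (Lam * ∑ s, (inner ℝ p (v s)) ^ 2) := by nlinarith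
      exact le_of_mul_le_mul_left this e6
  · intro p
    set c : Fin n → ℝ := fun i => inner ℝ p (v i) with hc
    set y : Euc n := ∑ i, c i • v i with hy
    have e1 : inner ℝ p y = ∑ i, c i ^ 2 := by
      rw [hy, inner_sum]
      simp only [inner_smul_right, hc, sq]
    have e2 : dd y (dd y w) x = ∑ i, c i ^ 2 := by
      rw [hy, dd_lc_left]
      refine Finset.sum_congr rfl fun i _ => ?_
      rw [dd_lc_mid h.sm h.op hx]
      simp [hv.orth, sq]
    have e3 := abs_real_inner_le_norm p y
    have e4 := hlo y
    rw [e2] at e4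
    rw [e1] at e3
    set Q := ∑ i, c i ^ 2 with hQ
    have hQ0 : 0 ≤ Q := Finset.sum_nonneg fun _ _ => sq_nonneg _
    rw [abs_of_nonneg hQ0] at e3
    rw [← div_eq_inv_mul, le_div_iff₀ hl]
    rcases eq_or_lt_of_le hQ0 with e6 | e6
    · rw [← e6]; simp; 
    · have h1 : Q ^ 2 ≤ ‖p‖ ^ 2 * ‖y‖ ^ 2 := by rw [← mul_pow]; exact pow_le_pow_left₀ hQ0 e3 2
      have h2 : Q * (Q * lam) ≤ Q * ‖p‖ ^ 2 := by nlinarith [sq_nonneg ‖p‖]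
      exact le_of_mul_le_mul_left h2 e6
end SecQI

section SecQJ
open Filter Topology Set
variable {n : ℕ}

/-! ### Atoms, and the higher derivative engine -/

inductive Atm (n : ℕ) : Type
  | G (b : Bool) (i j : Fin n) : Atm n
  | D (b : Bool) (i j : Fin n) (l : List (Fin n)) : Atm n
  | Z (k : Fin n) (l : List (Fin n)) : Atm n

def dl : List (Fin n) → (Euc n → ℝ) → Euc n → ℝ
  | [], f => f
  | k :: l, f => dd (bv k) (dl l f)

namespace Atm

def ev (w : Bool → Euc n → ℝ) (z : Euc n → ℝ) : Atm n → Euc n → ℝ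
  | G b i j => GI (w b) i j
  | D b i j l => dl l (dd (bv i) (dd (bv j) (w b)))
  | Z k l => dl l (dd (bv k) z)

def gr : Atm n → ℕ
  | G _ _ _ => 0
  | D _ _ _ l => l.length - 1
  | Z _ l => l.length

def dr (k : Fin n) : Atm n → Ex n (Atm n)
  | G b i j => .sum fun p => .sum fun q => .mul (.con (-1)) (.mul (.mul (.atm (G b i p)) (.atm (D b p q [k]))) (.atm (G b q j)))
  | D b i j l => .atm (D b i j (k :: l))
  | Z i l => .atm (Z i (k :: l))

end Atm

open Atm Ex

abbrev AEx (n : ℕ) := Ex n (Atm n)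

lemma gr_dr (k : Fin n) (a : Atm n) : Ex.grade gr (dr k a) ≤ gr a + 1 := by
  cases a with
  | G b i j =>
    simp only [dr, Ex.grade, gr]
    refine Finset.sup_le fun p _ => Finset.sup_le fun q _ => ?_
    simp
  | D b i j l => simp only [dr, Ex.grade, gr, List.length_cons]; omega
  | Z i l => simp only [dr, Ex.grade, gr, List.length_cons]; omega

/-- a configuration: two solutions and a smooth function -/
structure Cfg (U : Set (Euc n)) (w : Bool → Euc n → ℝ) (z : Euc n → ℝ) : Prop where
  ma : ∀ b, MA U (w b)
  sz : Sm U z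

namespace Cfg
variable {U : Set (Euc n)} {w : Bool → Euc n → ℝ} {z : Euc n → ℝ}

lemma op (h : Cfg U w z) : IsOpen U := (h.ma true).op

lemma smdl (hU : IsOpen U) {f : Euc n → ℝ} (hf : Sm U f) (l : List (Fin n)) : Sm U (dl l f) := by
  induction l with
  | nil => exact hf
  | cons k l ih => exact ih.dd hU _

lemma sm (h : Cfg U w z) (a : Atm n) : Sm U (ev w z a) := by
  cases a with
  | G b i j => exact (h.ma b).GI_sm i j
  | D b i j l => exact smdl h.op (((h.ma b).sm.dd h.op _).dd h.op _) l
  | Z k l => exact smdl h.op (h.sz.dd h.op _) l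

lemma hd (h : Cfg U w z) (k : Fin n) (a : Atm n) : ∀ x ∈ U, dd (bv k) (ev w z a) x = eval (ev w z) (dr k a) x := by
  intro x hx
  cases a with
  | G b i j => exact (h.ma b).GI_dd hx k i j
  | D b i j l => rfl
  | Z i l => rfl

lemma hde (h : Cfg U w z) (k : Fin n) (e : AEx n) : ∀ x ∈ U, dd (bv k) (eval (ev w z) e) x = eval (ev w z) (der dr k e) x :=
  eval_der h.op h.sm h.hd k e

end Cfg

/-- the linearized operator -/
def LL (w : Bool → Euc n → ℝ) (f : Euc n → ℝ) (x : Euc n) : ℝ := ∑ i, ∑ j, GI (w true) i j x * dd (bv i) (dd (bv j) f) x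

/-- commuted equation -/
def stepE (k : Fin n) (E : AEx n) (F : Fin n → Fin n → Atm n) : AEx n :=
  .add (der dr k E) (.sum fun i => .sum fun j => .mul (.con (-1)) (.mul (dr k (G true i j)) (.atm (F i j))))

lemma LL_step {U : Set (Euc n)} {w : Bool → Euc n → ℝ} {z : Euc n → ℝ} (h : Cfg U w z) (k : Fin n) (f : Euc n → ℝ) (hf : Sm U f)
    (E : AEx n) (hE : ∀ x ∈ U, LL w f x = eval (ev w z) E x) (F : Fin n → Fin n → Atm n)
    (hF : ∀ i j, ∀ x ∈ U, dd (bv i) (dd (bv j) f) x = ev w z (F i j) x) :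
    ∀ x ∈ U, LL w (dd (bv k) f) x = eval (ev w z) (stepE k E F) x := by
  intro x hx
  have hU := h.op
  have h1 := dd_congr hU hE (bv k) x hx
  rw [h.hde k E x hx] at h1
  have hg := fun i j => ((h.ma true).GI_sm i j).diff hU hx
  have hff := fun i j => ((hf.dd hU (bv j)).dd hU (bv i)).diff hU hx
  have h2 : dd (bv k) (LL w f) x = ∑ i, ∑ j, (dd (bv k) (GI (w true) i j) x * dd (bv i) (dd (bv j) f) x
      + GI (w true) i j x * dd (bv i) (dd (bv j) (dd (bv k) f)) x) := by
    have : LL w f = fun x => ∑ i, ∑ j, GI (w true) i j x * dd (bv i) (dd (bv j) f) x := rfl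
    rw [this, dd_sum _ (fun i _ => DifferentiableAt.fun_sum fun j _ => (hg i j).fun_mul (hff i j))]
    refine Finset.sum_congr rfl fun i _ => ?_
    rw [dd_sum _ (fun j _ => (hg i j).fun_mul (hff i j))]
    refine Finset.sum_congr rfl fun j _ => ?_
    rw [dd_mul (hg i j) (hff i j)]
    congr 2
    rw [dd_comm (hf.dd hU (bv j)) hU hx]
    exact dd_congr hU (fun y hy => dd_comm hf hU hy _ _) _ x hx
  simp only [Finset.sum_add_distrib] at h2
  unfold stepE
  simp only [eval]
  rw [← h1, h2]
  unfold LL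
  have h3 : ∀ i j, eval (ev w z) (dr k (G true i j)) x = dd (bv k) (GI (w true) i j) x := fun i j => (h.hd k (G true i j) x hx).symm
  simp only [h3, ← hF _ _ x hx]
  simp only [neg_mul, one_mul, Finset.sum_neg_distrib]
  ring

lemma grade_stepE (k : Fin n) (E : AEx n) (F : Fin n → Fin n → Atm n) (p : ℕ) (hE : Ex.grade gr E + 1 ≤ p) (hF : ∀ i j, gr (F i j) ≤ p) :
    Ex.grade gr (stepE k E F) ≤ p := by
  simp only [stepE, Ex.grade]
  refine max_le ((grade_der gr_dr k E).trans hE) ?_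
  refine Finset.sup_le fun i _ => Finset.sup_le fun j _ => ?_
  have : Ex.grade gr (dr k (G true i j)) = 0 := by
    simp only [dr, Ex.grade, gr]
    refine Nat.le_zero.1 ?_
    refine Finset.sup_le fun p _ => Finset.sup_le fun q _ => ?_
    simp
  have := hF i j
  omega

def LwE (p q : Fin n) : List (Fin n) → AEx n
  | [] => .sum fun i => .sum fun j => .mul (.con (-1)) (.mul (dr p (G true i j)) (.atm (D true i j [q])))
  | k :: l => stepE k (LwE p q l) fun i j => D true p q (i :: j :: l)

lemma grade_LwE (p q : Fin n) (l : List (Fin n)) : Ex.grade gr (LwE p q l) ≤ l.length := by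
  induction l with
  | nil =>
    simp only [LwE, Ex.grade]
    refine Finset.sup_le fun i _ => Finset.sup_le fun j _ => ?_
    simp only [dr, Ex.grade, gr]
    simp only [List.length_cons, List.length_nil, zero_add]
    have : (Finset.univ.sup fun p : Fin n => Finset.univ.sup fun q : Fin n => (1 - 1 + 0 : ℕ)) ≤ 0 :=
      Finset.sup_le fun p _ => Finset.sup_le fun q _ => by simp
    simpa using this
  | cons k l ih =>
    refine grade_stepE _ _ _ _ (by simpa using ih) fun i j => ?_
    simp [gr]

lemma LL_w {U : Set (Euc n)} {w : Bool → Euc n → ℝ} {z : Euc n → ℝ} (h : Cfg U w z) (p q : Fin n) (l : List (Fin n)) :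
    ∀ x ∈ U, LL w (ev w z (D true p q l)) x = eval (ev w z) (LwE p q l) x := by
  induction l with
  | nil =>
    have hU := h.op
    have hw := (h.ma true).sm
    have h0 : ∀ x ∈ U, LL w (dd (bv q) (w true)) x = eval (ev w z) (.con 0) x := by
      intro x hx
      rw [← show _ = (eval (ev w z) (.con 0) x) from (h.ma true).GI_tr hx (bv q)]
      refine Finset.sum_congr rfl fun i _ => Finset.sum_congr rfl fun j _ => ?_
      congr 1
      rw [dd_comm (hw.dd hU (bv j)) hU hx (bv q)]
      exact (dd_congr hU (fun y hy => dd_comm hw hU hy _ _) _ x hx)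
    have h1 := LL_step h p (dd (bv q) (w true)) (hw.dd hU _) (.con 0) h0 (fun i j => D true i j [q]) (by
      intro i j x hx
      simp only [ev, dl]
      rw [dd_comm (hw.dd hU (bv j)) hU hx (bv q)]
      exact (dd_congr hU (fun y hy => dd_comm hw hU hy _ _) _ x hx))
    intro x hx
    simp only [ev, dl]
    rw [h1 x hx]
    simp only [stepE, LwE, eval, der, zero_add]
  | cons k l ih =>
    exact LL_step h k _ (h.sm (D true p q l)) _ ih _ (fun i j x hx => rfl)
end SecQJ

section SecQK
open Filter Topology Set
variable {n : ℕ}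
open Atm Ex

def LzE (k : Fin n) : List (Fin n) → AEx n
  | [] => .sum fun i => .sum fun j => .sum fun p => .sum fun q =>
      .mul (.mul (.mul (.atm (G true i p)) (.atm (Z q [p]))) (.atm (G false q j))) (.atm (D false i j [k]))
  | a :: l => stepE a (LzE k l) fun i j => Z k (i :: j :: l)

lemma grade_LzE (k : Fin n) (l : List (Fin n)) : Ex.grade gr (LzE k l) ≤ l.length + 1 := by
  induction l with
  | nil =>
    simp only [LzE, Ex.grade]
    refine Finset.sup_le fun i _ => Finset.sup_le fun j _ => Finset.sup_le fun p _ => Finset.sup_le fun q _ => ?_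
    simp [gr]
  | cons a l ih =>
    refine grade_stepE _ _ _ _ (by simpa using ih) fun i j => ?_
    simp [gr]

/-- relation between the two solutions -/
def ZRel (U : Set (Euc n)) (w : Bool → Euc n → ℝ) (z : Euc n → ℝ) : Prop :=
  ∃ ε c : ℝ, ε ≠ 0 ∧ ∀ x ∈ U, w true x - w false x = ε * z x + c

lemma ZRel.d1 {U : Set (Euc n)} {f g z : Euc n → ℝ} (hU : IsOpen U) (hf : Sm U f) (hg : Sm U g) (hz : Sm U z) {ε c : ℝ}
    (h : ∀ x ∈ U, f x - g x = ε * z x + c) (v : Euc n) : ∀ x ∈ U, dd v f x - dd v g x = ε * dd v z x + 0 := by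
  intro x hx
  have h1 := dd_congr hU h v x hx
  rw [dd_sub (hf.diff hU hx) (hg.diff hU hx), dd_add ((hz.diff hU hx).const_mul ε) (differentiableAt_const c), dd_cmul (hz.diff hU hx), dd_const] at h1
  exact h1

/-- linearized equation for the derivative of the difference -/
lemma LL_z0 {U : Set (Euc n)} {w : Bool → Euc n → ℝ} {z : Euc n → ℝ} (h : Cfg U w z) (hr : ZRel U w z) (k : Fin n) :
    ∀ x ∈ U, LL w (dd (bv k) z) x = ∑ i, ∑ j, ∑ p, ∑ q, GI (w true) i p x * dd (bv p) (dd (bv q) z) x * GI (w false) q j x *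
      dd (bv k) (dd (bv i) (dd (bv j) (w false))) x := by
  intro x hx
  obtain ⟨ε, c, hε, h0⟩ := hr
  have hU := h.op
  have s1 := (h.ma true).sm
  have s2 := (h.ma false).sm
  have sz := h.sz
  have r2 : ∀ i j, ∀ y ∈ U, dd (bv i) (dd (bv j) (w true)) y - dd (bv i) (dd (bv j) (w false)) y = ε * dd (bv i) (dd (bv j) z) y + 0 :=
    fun i j => ZRel.d1 hU (s1.dd hU _) (s2.dd hU _) (sz.dd hU _) (ZRel.d1 hU s1 s2 sz h0 _) _
  have r3 : ∀ i j, dd (bv k) (dd (bv i) (dd (bv j) (w true))) x - dd (bv k) (dd (bv i) (dd (bv j) (w false))) x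
      = ε * dd (bv k) (dd (bv i) (dd (bv j) z)) x + 0 := fun i j =>
    ZRel.d1 hU ((s1.dd hU _).dd hU _) ((s2.dd hU _).dd hU _) ((sz.dd hU _).dd hU _) (r2 i j) _ x hx
  have t1 := (h.ma true).GI_tr hx (bv k)
  have t2 := (h.ma false).GI_tr hx (bv k)
  have e0 : ε * LL w (dd (bv k) z) x = ∑ i, ∑ j, (GI (w false) i j x - GI (w true) i j x) * dd (bv k) (dd (bv i) (dd (bv j) (w false))) x := by
    have : ε * LL w (dd (bv k) z) x = ∑ i, ∑ j, GI (w true) i j x * dd (bv k) (dd (bv i) (dd (bv j) (w true))) x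
        - ∑ i, ∑ j, GI (w true) i j x * dd (bv k) (dd (bv i) (dd (bv j) (w false))) x := by
      unfold LL
      rw [Finset.mul_sum, ← Finset.sum_sub_distrib]
      refine Finset.sum_congr rfl fun i _ => ?_
      rw [Finset.mul_sum, ← Finset.sum_sub_distrib]
      refine Finset.sum_congr rfl fun j _ => ?_
      have e1 : dd (bv i) (dd (bv j) (dd (bv k) z)) x = dd (bv k) (dd (bv i) (dd (bv j) z)) x := by
        rw [dd_comm (sz.dd hU (bv j)) hU hx (bv k)]
        exact (dd_congr hU (fun y hy => dd_comm sz hU hy _ _) _ x hx)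
      rw [e1]
      linear_combination (-GI (w true) i j x) * r3 i j
    rw [this, t1]
    simp only [sub_mul, Finset.sum_sub_distrib]
    rw [t2]
  have e1 : ∀ i j, GI (w false) i j x - GI (w true) i j x = ε * ∑ p, ∑ q, GI (w true) i p x * dd (bv p) (dd (bv q) z) x * GI (w false) q j x := by
    intro i j
    have d1 : IsUnit (hessianMatrix (w true) x).det := by rw [show (hessianMatrix (w true) x).det = (1:ℝ) from (h.ma true).det x hx]; exact isUnit_one
    have d2 : IsUnit (hessianMatrix (w false) x).det := by rw [show (hessianMatrix (w false) x).det = (1:ℝ) from (h.ma false).det x hx]; exact isUnit_one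
    have m : (hessianMatrix (w false) x)⁻¹ - (hessianMatrix (w true) x)⁻¹
        = (hessianMatrix (w true) x)⁻¹ * (hessianMatrix (w true) x - hessianMatrix (w false) x) * (hessianMatrix (w false) x)⁻¹ := by
      rw [Matrix.mul_sub, Matrix.sub_mul, Matrix.nonsing_inv_mul _ d1, one_mul, Matrix.mul_assoc, Matrix.mul_nonsing_inv _ d2, mul_one]
    have := congrFun (congrFun m i) j
    rw [Matrix.sub_apply] at this
    unfold GI
    rw [this]
    simp only [Matrix.mul_apply, Matrix.sub_apply, Finset.mul_sum, Finset.sum_mul]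
    rw [Finset.sum_comm]
    refine Finset.sum_congr rfl fun p _ => Finset.sum_congr rfl fun q _ => ?_
    rw [hessianMatrix_apply (s1.cda2 hU hx), hessianMatrix_apply (s2.cda2 hU hx)]
    have := r2 p q x hx
    simp only [bv] at this ⊢
    rw [this]; ring
  refine mul_left_cancel₀ hε ?_
  rw [e0]
  simp only [e1, Finset.mul_sum, Finset.sum_mul]
  refine Finset.sum_congr rfl fun i _ => Finset.sum_congr rfl fun j _ => Finset.sum_congr rfl fun p _ => Finset.sum_congr rfl fun q _ => ?_
  ring

lemma LL_z {U : Set (Euc n)} {w : Bool → Euc n → ℝ} {z : Euc n → ℝ} (h : Cfg U w z) (hr : ZRel U w z) (k : Fin n) (l : List (Fin n)) :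
    ∀ x ∈ U, LL w (ev w z (Z k l)) x = eval (ev w z) (LzE k l) x := by
  induction l with
  | nil => exact LL_z0 h hr k
  | cons a l ih =>
    exact LL_step h a _ (h.sm (Z k l)) _ ih _ (fun i j x hx => rfl)

/-- two-sided Hessian bounds -/
def Ell (B : Set (Euc n)) (w : Euc n → ℝ) (lam Lam : ℝ) : Prop :=
  ∀ x ∈ B, ∀ v, lam * ‖v‖ ^ 2 ≤ dd v (dd v w) x ∧ dd v (dd v w) x ≤ Lam * ‖v‖ ^ 2

lemma frame_LL {w : Bool → Euc n → ℝ} {x : Euc n} {v : Fin n → Euc n} (hv : ∀ i j, ∑ s, v s i * v s j = GI (w true) i j x)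
    {f : Euc n → ℝ} (hf : ContDiffAt ℝ 2 f x) : ∑ s, dd (v s) (dd (v s) f) x = LL w f x := by
  unfold LL
  have e : ∀ i j, dd (bv i) (dd (bv j) f) x = hessianMatrix f x i j := fun i j => (hessianMatrix_apply hf i j).symm
  simp only [e]
  simp only [ddd_exp hf, ← hv, Finset.sum_mul]
  rw [Finset.sum_comm]
  refine Finset.sum_congr rfl fun i _ => ?_
  rw [Finset.sum_comm]

def NN {κ : Type} [Fintype κ] (f : κ → Euc n → ℝ) (m : ℕ) (x : Euc n) (p : ℕ) : ℝ :=
  if p < m then 1 else if p = m then 1 + √(gradSq f x) else 2 * (1 + gradSq f x + √(hessSq f x))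

lemma gradSq_nonneg {κ : Type} [Fintype κ] (f : κ → Euc n → ℝ) (x : Euc n) : 0 ≤ gradSq f x := Finset.sum_nonneg fun _ _ => sq_nonneg _

lemma NN_one {κ : Type} [Fintype κ] (f : κ → Euc n → ℝ) (m : ℕ) (x : Euc n) (p : ℕ) : 1 ≤ NN f m x p := by
  unfold NN
  have := gradSq_nonneg f x
  have h1 := Real.sqrt_nonneg (gradSq f x)
  have h2 := Real.sqrt_nonneg (hessSq f x)
  split_ifs <;> linarith

lemma NN_aux {κ : Type} [Fintype κ] (f : κ → Euc n → ℝ) (x : Euc n) :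
    (1 + √(gradSq f x)) * (1 + √(gradSq f x)) ≤ 2 * (1 + gradSq f x + √(hessSq f x)) := by
  have := Real.sq_sqrt (gradSq_nonneg f x)
  have h1 := Real.sqrt_nonneg (gradSq f x)
  have h2 := Real.sqrt_nonneg (hessSq f x)
  nlinarith [sq_nonneg (1 - √(gradSq f x))]

lemma NN_mono {κ : Type} [Fintype κ] (f : κ → Euc n → ℝ) (m : ℕ) (x : Euc n) : Monotone (NN f m x) := by
  intro p q hpq
  have := gradSq_nonneg f x
  have h0 := NN_aux f x
  have h1 := Real.sqrt_nonneg (gradSq f x)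
  have h2 := Real.sqrt_nonneg (hessSq f x)
  unfold NN
  split_ifs <;> first | omega | nlinarith

lemma NN_mul {κ : Type} [Fintype κ] (f : κ → Euc n → ℝ) (m : ℕ) (hm : 1 ≤ m) (x : Euc n) (a b : ℕ) (hab : a + b ≤ m + 1) :
    NN f m x a * NN f m x b ≤ 2 * NN f m x (a + b) := by
  have := gradSq_nonneg f x
  have h0 := NN_aux f x
  have h1 := Real.sqrt_nonneg (gradSq f x)
  have h2 := Real.sqrt_nonneg (hessSq f x)
  unfold NN
  split_ifs <;> first | omega | nlinarith

lemma engine (κ : Type) [Fintype κ] (m : ℕ) (hm : 1 ≤ m) (fa : κ → Atm n) (E : κ → AEx n) (E1 : κ → Fin n → AEx n)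
    (hE : ∀ i, Ex.grade gr (E i) ≤ m) (hE1 : ∀ i k, Ex.grade gr (E1 i k) ≤ m + 1) {r K lam Lam : ℝ} (hr : 0 < r) (hK : 0 ≤ K)
    (hl : 0 < lam) (hL : 0 < Lam) : ∃ C' : ℝ, 0 ≤ C' ∧ ∀ (U : Set (Euc n)) (w : Bool → Euc n → ℝ) (z : Euc n → ℝ) (y : Euc n),
      Cfg U w z → Metric.closedBall y r ⊆ U → Ell (Metric.closedBall y r) (w true) lam Lam →
      (∀ i, ∀ x ∈ Metric.closedBall y r, |ev w z (fa i) x| ≤ K) →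
      (∀ i, ∀ x ∈ U, LL w (ev w z (fa i)) x = eval (ev w z) (E i) x) →
      (∀ i k, ∀ x ∈ U, LL w (dd (bv k) (ev w z (fa i))) x = eval (ev w z) (E1 i k) x) →
      (∀ x ∈ Metric.closedBall y r, ∀ a, gr a ≤ m + 1 → |ev w z a x| ≤ K * NN (fun i => ev w z (fa i)) m x (gr a)) →
      ∀ i k, |dd (bv k) (ev w z (fa i)) y| ≤ C' := by
  choose B hB0 hB using fun i => Ex.bound gr K 2 hK (by norm_num) (m + 1) (E i) ((hE i).trans (by omega))
  choose B1 hB10 hB1 using fun i k => Ex.bound gr K 2 hK (by norm_num) (m + 1) (E1 i k) (hE1 i k)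
  set C := ∑ i, B i + ∑ i, ∑ k, 2 * B1 i k with hC
  have hC0 : 0 ≤ C := add_nonneg (Finset.sum_nonneg fun i _ => hB0 i)
    (Finset.sum_nonneg fun i _ => Finset.sum_nonneg fun k _ => mul_nonneg (by norm_num) (hB10 i k))
  have hCB : ∀ i, B i ≤ C := by
    intro i
    have h1 := Finset.single_le_sum (fun i _ => hB0 i) (Finset.mem_univ i)
    have h2 : 0 ≤ ∑ i, ∑ k, 2 * B1 i k := (Finset.sum_nonneg fun i _ => Finset.sum_nonneg fun k _ => mul_nonneg (by norm_num) (hB10 i k))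
    rw [hC]; linarith
  have hCB1 : ∀ i k, 2 * B1 i k ≤ C := by
    intro i k
    have h1 := Finset.single_le_sum (f := fun k => 2 * B1 i k) (fun k _ => mul_nonneg (by norm_num) (hB10 i k)) (Finset.mem_univ k)
    have h2 := Finset.single_le_sum (f := fun i => ∑ k, 2 * B1 i k) (fun i _ => Finset.sum_nonneg fun k _ => mul_nonneg (by norm_num) (hB10 i k)) (Finset.mem_univ i)
    have h3 : 0 ≤ ∑ i, B i := (Finset.sum_nonneg fun i _ => hB0 i)
    rw [hC]; linarith
  obtain ⟨C', hC'0, hC'⟩ := bernst κ (Fin n) n (lam := Lam⁻¹) (Lam := lam⁻¹) (by positivity) (by positivity) hC0 hK hr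
  refine ⟨C', hC'0, fun U w z y hcfg hBU hell hf hL1 hL2 hat => ?_⟩
  refine hC' U y (fun i => ev w z (fa i)) hcfg.op hBU (fun i => hcfg.sm _) hf ?_
  intro x hx
  have hxU := hBU hx
  obtain ⟨v, hv1, hv2, hv3⟩ := (hcfg.ma true).Gframe hxU hl hL (fun v => (hell x hx v).1) (fun v => (hell x hx v).2)
  refine ⟨v, fun p => ?_, hv3, fun i => ?_, fun i k => ?_⟩
  · rw [← div_eq_inv_mul, div_le_iff₀ hL]
    linarith [hv2 p]
  · rw [frame_LL hv1 ((hcfg.sm _).cda2 hcfg.op hxU), hL1 i x hxU]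
    have h1 := hB i (ev w z) (NN (fun i => ev w z (fa i)) m x) x (NN_one _ _ _) (NN_mono _ _ _) (NN_mul _ _ hm _) (hat x hx)
    have h2 := NN_mono (fun i => ev w z (fa i)) m x (hE i)
    have h3 : NN (fun i => ev w z (fa i)) m x m = 1 + √(gradSq (fun i => ev w z (fa i)) x) := by simp [NN]
    rw [h3] at h2
    have h4 := NN_one (fun i => ev w z (fa i)) m x (Ex.grade gr (E i))
    have h5 := hCB i
    have h6 := hB0 i
    refine h1.trans (mul_le_mul h5 h2 (by linarith) hC0)
  · rw [frame_LL hv1 (((hcfg.sm _).dd hcfg.op _).cda2 hcfg.op hxU), hL2 i k x hxU]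
    have h1 := hB1 i k (ev w z) (NN (fun i => ev w z (fa i)) m x) x (NN_one _ _ _) (NN_mono _ _ _) (NN_mul _ _ hm _) (hat x hx)
    have h2 := NN_mono (fun i => ev w z (fa i)) m x (hE1 i k)
    have h3 : NN (fun i => ev w z (fa i)) m x (m + 1) = 2 * (1 + gradSq (fun i => ev w z (fa i)) x + √(hessSq (fun i => ev w z (fa i)) x)) := by simp [NN]
    rw [h3] at h2
    have h4 := NN_one (fun i => ev w z (fa i)) m x (Ex.grade gr (E1 i k))
    have h5 := hCB1 i k
    have h6 := hB10 i k
    refine h1.trans ?_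
    calc _ ≤ B1 i k * (2 * (1 + gradSq (fun i => ev w z (fa i)) x + √(hessSq (fun i => ev w z (fa i)) x))) := by gcongr
      _ = (2 * B1 i k) * (1 + gradSq (fun i => ev w z (fa i)) x + √(hessSq (fun i => ev w z (fa i)) x)) := by ring
      _ ≤ _ := by
        gcongr
        linarith
end SecQK

section SecQL
open Filter Topology Set
variable {n : ℕ}
open Atm Ex

lemma bv_norm (i : Fin n) : ‖(bv i : Euc n)‖ = 1 := by simp [bv]

lemma MA.GI_bound {U : Set (Euc n)} {w : Euc n → ℝ} (h : MA U w) {x : Euc n} (hx : x ∈ U) {lam Lam : ℝ} (hl : 0 < lam) (hL : 0 < Lam)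
    (hell : Ell {x} w lam Lam) (i j : Fin n) : |GI w i j x| ≤ lam⁻¹ := by
  obtain ⟨v, hv1, hv2, hv3⟩ := h.Gframe hx hl hL (fun v => (hell x rfl v).1) (fun v => (hell x rfl v).2)
  have hi : ∀ i, ∑ s, (v s i) ^ 2 ≤ lam⁻¹ := by
    intro i
    have := hv3 (bv i)
    rw [bv_norm] at this
    simpa [bv, EuclideanSpace.inner_single_left] using this
  rw [← hv1]
  have h1 := hi i
  have h2 := hi j
  have h3 : ∑ s, v s i * v s j ≤ ∑ s, ((v s i) ^ 2 + (v s j) ^ 2) / 2 := Finset.sum_le_sum fun s _ => by nlinarith [sq_nonneg (v s i - v s j)]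
  have h4 : ∑ s, -(((v s i) ^ 2 + (v s j) ^ 2) / 2) ≤ ∑ s, v s i * v s j := Finset.sum_le_sum fun s _ => by nlinarith [sq_nonneg (v s i + v s j)]
  rw [Finset.sum_neg_distrib] at h4
  have h5 : ∑ s, ((v s i) ^ 2 + (v s j) ^ 2) / 2 = (∑ s, (v s i) ^ 2 + ∑ s, (v s j) ^ 2) / 2 := by
    rw [← Finset.sum_add_distrib, Finset.sum_div]
  rw [h5] at h3 h4
  rw [abs_le]; constructor <;> linarith

lemma le_gradSq {κ : Type} [Fintype κ] (f : κ → Euc n → ℝ) (x : Euc n) (i : κ) (k : Fin n) : |dd (bv k) (f i) x| ≤ √(gradSq f x) := by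
  apply Real.abs_le_sqrt
  exact Finset.single_le_sum (f := fun q : κ × Fin n => (dd (bv q.2) (f q.1) x) ^ 2) (fun _ _ => sq_nonneg _) (Finset.mem_univ (i, k))

lemma le_hessSq {κ : Type} [Fintype κ] (f : κ → Euc n → ℝ) (x : Euc n) (i : κ) (k j : Fin n) : |dd (bv j) (dd (bv k) (f i)) x| ≤ √(hessSq f x) := by
  apply Real.abs_le_sqrt
  have h1 := Finset.single_le_sum (f := fun q : κ × Fin n => ∑ j, (dd (bv j) (dd (bv q.2) (f q.1)) x) ^ 2) (fun _ _ => Finset.sum_nonneg fun _ _ => sq_nonneg _) (Finset.mem_univ (i, k))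
  have h2 := Finset.single_le_sum (f := fun j => (dd (bv j) (dd (bv k) (f i)) x) ^ 2) (fun _ _ => sq_nonneg _) (Finset.mem_univ j)
  exact h2.trans h1

lemma dl_zero (l : List (Fin n)) : dl l (fun _ : Euc n => (0:ℝ)) = fun _ => 0 := by
  induction l with
  | nil => rfl
  | cons k l ih => simp only [dl, ih]; funext x; exact dd_const _ _

lemma Ell.mono {B B' : Set (Euc n)} {w : Euc n → ℝ} {lam Lam : ℝ} (h : Ell B w lam Lam) (hs : B' ⊆ B) : Ell B' w lam Lam :=
  fun x hx => h x (hs hx)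

lemma NN_lo {κ : Type} [Fintype κ] (f : κ → Euc n → ℝ) (m : ℕ) (x : Euc n) (p : ℕ) {K a : ℝ} (hK : 0 ≤ K) (h : a ≤ K) : a ≤ K * NN f m x p := by
  have := NN_one f m x p
  nlinarith

lemma wstep (n m : ℕ) (hm : 1 ≤ m) {r K lam Lam : ℝ} (hr : 0 < r) (hK : 0 ≤ K) (hl : 0 < lam) (hL : 0 < Lam) :
    ∃ C' : ℝ, 0 ≤ C' ∧ ∀ (U : Set (Euc n)) (w : Euc n → ℝ) (y : Euc n), MA U w → Metric.closedBall y r ⊆ U →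
      Ell (Metric.closedBall y r) w lam Lam →
      (∀ p q l, l.length ≤ m → ∀ x ∈ Metric.closedBall y r, |dl l (dd (bv p) (dd (bv q) w)) x| ≤ K) →
      ∀ p q l, l.length = m + 1 → |dl l (dd (bv p) (dd (bv q) w)) y| ≤ C' := by
  obtain ⟨C', hC'0, hC'⟩ := engine (n := n) (Fin n × Fin n × List.Vector (Fin n) m) m hm (fun a => D true a.1 a.2.1 a.2.2.toList)
    (fun a => LwE a.1 a.2.1 a.2.2.toList) (fun a k => LwE a.1 a.2.1 (k :: a.2.2.toList))
    (fun a => (grade_LwE _ _ _).trans (by simp)) (fun a k => (grade_LwE _ _ _).trans (by simp)) (r := r) (K := K + 1 + lam⁻¹) hr (by positivity) hl hL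
  refine ⟨C', hC'0, fun U w y hw hBU hell hbd p q l hlen => ?_⟩
  have hcfg : Cfg U (fun _ => w) (fun _ => 0) := ⟨fun _ => hw, Sm.const 0⟩
  have hli : 0 < lam⁻¹ := by positivity
  obtain ⟨k, l', rfl⟩ : ∃ k l', l = k :: l' := by
    cases l with
    | nil => simp at hlen
    | cons k l' => exact ⟨k, l', rfl⟩
  refine hC' U (fun _ => w) (fun _ => 0) y hcfg hBU hell ?_ (fun i => LL_w hcfg _ _ _) (fun i k => LL_w hcfg _ _ (k :: _)) ?_ (p, q, ⟨l', by simpa using hlen⟩) k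
  · intro i x hx
    exact (hbd _ _ _ (by simp) x hx).trans (by linarith)
  · intro x hx a ha
    have hKp : 0 ≤ K + 1 + lam⁻¹ := by positivity
    cases a with
    | G b i j =>
      refine NN_lo _ _ _ _ hKp ?_
      exact (hw.GI_bound (hBU hx) hl hL (hell.mono (by simpa using hx)) i j).trans (by linarith)
    | Z i l =>
      refine NN_lo _ _ _ _ hKp ?_
      simp only [ev]
      rw [show dd (bv i) (fun _ : Euc n => (0:ℝ)) = fun _ => 0 from by funext x; exact dd_const _ _, dl_zero]
      simpa using hKp
    | D b i j l =>
      by_cases h1 : l.length ≤ m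
      · exact NN_lo _ _ _ _ hKp ((hbd _ _ _ h1 x hx).trans (by linarith))
      simp only [gr] at ha
      by_cases h2 : l.length = m + 1
      · obtain ⟨k, l', rfl⟩ : ∃ k l', l = k :: l' := by
          cases l with
          | nil => simp at h2
          | cons k l' => exact ⟨k, l', rfl⟩
        have h3 := le_gradSq (fun a : Fin n × Fin n × List.Vector (Fin n) m => ev (fun _ => w) (fun _ => 0) (D true a.1 a.2.1 a.2.2.toList)) x (i, j, ⟨l', by simpa using h2⟩) k
        have h4 : gr (D b i j (k :: l')) = m := by simp only [gr]; omega
        rw [h4]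
        simp only [NN, lt_irrefl, if_false, if_true]
        refine (show _ ≤ _ from h3).trans ?_
        have := Real.sqrt_nonneg (gradSq (fun a : Fin n × Fin n × List.Vector (Fin n) m => ev (fun _ => w) (fun _ => 0) (D true a.1 a.2.1 a.2.2.toList)) x)
        nlinarith
      · obtain ⟨k, k2, l', rfl⟩ : ∃ k k2 l', l = k :: k2 :: l' := by
          rcases l with _ | ⟨k, _ | ⟨k2, l'⟩⟩
          · simp at h1
          · simp at h1; omega
          · exact ⟨k, k2, l', rfl⟩
        simp only [List.length_cons] at h1 h2 ha
        have h3 := le_hessSq (fun a : Fin n × Fin n × List.Vector (Fin n) m => ev (fun _ => w) (fun _ => 0) (D true a.1 a.2.1 a.2.2.toList)) x (i, j, ⟨l', by omega⟩) k2 k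
        have h4 : gr (D b i j (k :: k2 :: l')) = m + 1 := by simp only [gr, List.length_cons]; omega
        rw [h4]
        have h5 : ¬ (m + 1 < m) := by omega
        have h6 : ¬ (m + 1 = m) := by omega
        simp only [NN, h5, h6, if_false]
        refine (show _ ≤ _ from h3).trans ?_
        have := Real.sqrt_nonneg (hessSq (fun a : Fin n × Fin n × List.Vector (Fin n) m => ev (fun _ => w) (fun _ => 0) (D true a.1 a.2.1 a.2.2.toList)) x)
        have := gradSq_nonneg (fun a : Fin n × Fin n × List.Vector (Fin n) m => ev (fun _ => w) (fun _ => 0) (D true a.1 a.2.1 a.2.2.toList)) x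
        nlinarith

lemma d3_bound {U : Set (Euc n)} {w : Euc n → ℝ} (h : MA U w) {y : Euc n} {r lam Lam : ℝ} (hr : 0 < r)
    (hl : 0 < lam) (hB : Metric.closedBall y r ⊆ U) (hell : Ell (Metric.closedBall y r) w lam Lam) (v : Euc n) :
    |dd v (dd v (dd v w)) y| ≤ √(40 * n * Lam ^ 3 / (lam * r ^ 2)) * ‖v‖ ^ 3 := by
  have hy : y ∈ U := hB (Metric.mem_closedBall_self hr.le)
  by_cases hv : v = 0
  · subst hv
    have := d3_smul h.sm h.op (0 : Euc n) 0 hy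
    simp only [zero_smul] at this
    rw [this]; simp
  have hv0 : 0 < ‖v‖ := norm_pos_iff.2 hv
  have h1 := calabi h hr hl hB (fun x hx v => (hell x hx v).1) (fun x hx v => (hell x hx v).2) (‖v‖⁻¹ • v) (by
    rw [norm_smul, norm_inv, norm_norm, inv_mul_cancel₀ hv0.ne'])
  have h2 : v = ‖v‖ • (‖v‖⁻¹ • v) := by rw [smul_smul, mul_inv_cancel₀ hv0.ne', one_smul]
  have h3 := d3_smul h.sm h.op (‖v‖⁻¹ • v) ‖v‖ hy
  rw [← h2] at h3
  rw [h3, abs_mul, mul_comm, abs_of_pos (by positivity : 0 < ‖v‖ ^ 3)]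
  gcongr
  exact Real.abs_le_sqrt h1

/-- polarization of cubic forms -/
lemma d3_polar {U : Set (Euc n)} {f : Euc n → ℝ} (hf : Sm U f) (hU : IsOpen U) {x : Euc n} (hx : x ∈ U) {C : ℝ} (hC : 0 ≤ C)
    (hb : ∀ v, |dd v (dd v (dd v f)) x| ≤ C * ‖v‖ ^ 3) (a b c : Euc n) (ha : ‖a‖ ≤ 1) (hb1 : ‖b‖ ≤ 1) (hc : ‖c‖ ≤ 1) :
    |dd a (dd b (dd c f)) x| ≤ 64 * C := by
  have q : ∀ v, ‖v‖ ≤ 3 → |dd v (dd v (dd v f)) x| ≤ 27 * C := fun v hv => by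
    refine (hb v).trans ?_
    have : ‖v‖ ^ 3 ≤ 3 ^ 3 := pow_le_pow_left₀ (norm_nonneg _) hv 3
    nlinarith
  have q2 : ∀ v, ‖v‖ ≤ 2 → |dd v (dd v (dd v f)) x| ≤ 8 * C := fun v hv => by
    refine (hb v).trans ?_
    have : ‖v‖ ^ 3 ≤ 2 ^ 3 := pow_le_pow_left₀ (norm_nonneg _) hv 3
    nlinarith
  have q1 : ∀ v, ‖v‖ ≤ 1 → |dd v (dd v (dd v f)) x| ≤ C := fun v hv => by
    refine (hb v).trans ?_
    have : ‖v‖ ^ 3 ≤ 1 ^ 3 := pow_le_pow_left₀ (norm_nonneg _) hv 3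
    nlinarith
  have key : 6 * dd a (dd b (dd c f)) x = dd (a + b + c) (dd (a + b + c) (dd (a + b + c) f)) x
      - dd (a + b) (dd (a + b) (dd (a + b) f)) x - dd (a + c) (dd (a + c) (dd (a + c) f)) x - dd (b + c) (dd (b + c) (dd (b + c) f)) x
      + dd a (dd a (dd a f)) x + dd b (dd b (dd b f)) x + dd c (dd c (dd c f)) x := by
    have e1 := cubic_exp hf hU (a + b) c 1 hx
    have e2 := cubic_exp hf hU a c 1 hx
    have e3 := cubic_exp hf hU b c 1 hx
    simp only [one_smul, one_mul] at e1 e2 e3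
    have f1 : dd c (dd (a + b) (dd (a + b) f)) x = dd (a + b) (dd (a + b) (dd c f)) x := dd_move2 hf hU _ _ x hx
    have f2 : dd c (dd a (dd a f)) x = dd a (dd a (dd c f)) x := dd_move2 hf hU _ _ x hx
    have f3 : dd c (dd b (dd b f)) x = dd b (dd b (dd c f)) x := dd_move2 hf hU _ _ x hx
    have f4 := quad_exp (hf.dd hU c) hU a b 1 hx
    simp only [one_smul, one_mul] at f4
    have f5 : dd c (dd c (dd (a + b) f)) x = dd c (dd c (dd a f)) x + dd c (dd c (dd b f)) x := by
      rw [← dd_move2 hf hU _ c x hx, ← dd_move2 hf hU _ c x hx, ← dd_move2 hf hU _ c x hx, dd_add_left]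
    have f6 : dd b (dd a (dd c f)) x = dd a (dd b (dd c f)) x := dd_comm (hf.dd hU c) hU hx _ _
    rw [e1, e2, e3, f1, f4, f5, f2, f3, f6]; ring
  have n1 : ‖a + b‖ ≤ 2 := (norm_add_le _ _).trans (by linarith)
  have n2 : ‖a + c‖ ≤ 2 := (norm_add_le _ _).trans (by linarith)
  have n3 : ‖b + c‖ ≤ 2 := (norm_add_le _ _).trans (by linarith)
  have n4 : ‖a + b + c‖ ≤ 3 := (norm_add_le _ _).trans (by linarith)
  have p1 := abs_le.1 (q _ n4)
  have p2 := abs_le.1 (q2 _ n1)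
  have p3 := abs_le.1 (q2 _ n2)
  have p4 := abs_le.1 (q2 _ n3)
  have p5 := abs_le.1 (q1 _ ha)
  have p6 := abs_le.1 (q1 _ hb1)
  have p7 := abs_le.1 (q1 _ hc)
  rw [abs_le]
  constructor <;> linarith [key]

lemma d2_polar {f : Euc n → ℝ} {U : Set (Euc n)} (hf : Sm U f) (hU : IsOpen U) {x : Euc n} (hx : x ∈ U) {C : ℝ} (hC : 0 ≤ C)
    (hb : ∀ v, |dd v (dd v f) x| ≤ C * ‖v‖ ^ 2) (a b : Euc n) (ha : ‖a‖ ≤ 1) (hb1 : ‖b‖ ≤ 1) :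
    |dd a (dd b f) x| ≤ 3 * C := by
  have q2 : ∀ v, ‖v‖ ≤ 2 → |dd v (dd v f) x| ≤ 4 * C := fun v hv => by
    refine (hb v).trans ?_
    have : ‖v‖ ^ 2 ≤ 2 ^ 2 := pow_le_pow_left₀ (norm_nonneg _) hv 2
    nlinarith
  have q1 : ∀ v, ‖v‖ ≤ 1 → |dd v (dd v f) x| ≤ C := fun v hv => by
    refine (hb v).trans ?_
    have : ‖v‖ ^ 2 ≤ 1 ^ 2 := pow_le_pow_left₀ (norm_nonneg _) hv 2
    nlinarith
  have e1 := quad_exp hf hU a b 1 hx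
  simp only [one_smul, one_mul] at e1
  rw [dd_comm hf hU hx b a] at e1
  have p1 := abs_le.1 (q2 _ ((norm_add_le a b).trans (by linarith)))
  have p2 := abs_le.1 (q1 _ ha)
  have p3 := abs_le.1 (q1 _ hb1)
  rw [abs_le]
  constructor <;> linarith

/-- interior estimates of all orders for Monge-Ampere solutions with two-sided Hessian bounds -/
lemma wbd (n m : ℕ) {lam Lam : ℝ} (hl : 0 < lam) (hL : 0 < Lam) : ∀ r : ℝ, 0 < r → ∃ K : ℝ, 0 ≤ K ∧
    ∀ (U : Set (Euc n)) (w : Euc n → ℝ) (y : Euc n), MA U w → Metric.closedBall y r ⊆ U →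
      Ell (Metric.closedBall y r) w lam Lam →
      ∀ p q l, l.length ≤ m → |dl l (dd (bv p) (dd (bv q) w)) y| ≤ K := by
  have base : ∀ r : ℝ, 0 < r → ∃ K : ℝ, 0 ≤ K ∧
    ∀ (U : Set (Euc n)) (w : Euc n → ℝ) (y : Euc n), MA U w → Metric.closedBall y r ⊆ U →
      Ell (Metric.closedBall y r) w lam Lam →
      ∀ p q l, l.length ≤ 1 → |dl l (dd (bv p) (dd (bv q) w)) y| ≤ K := by
    intro r hr
    refine ⟨3 * Lam + 64 * √(40 * n * Lam ^ 3 / (lam * r ^ 2)), by positivity, ?_⟩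
    intro U w y hw hBU hell p q l hlen
    have hy : y ∈ U := hBU (Metric.mem_closedBall_self hr.le)
    have hs := Real.sqrt_nonneg (40 * n * Lam ^ 3 / (lam * r ^ 2))
    rcases l with _ | ⟨k, _ | ⟨k2, l⟩⟩
    · simp only [dl]
      refine (d2_polar hw.sm hw.op hy hL.le (fun v => ?_) _ _ (bv_norm _).le (bv_norm _).le).trans (by linarith)
      rw [abs_of_nonneg (hw.conv y hy v)]
      exact (hell y (Metric.mem_closedBall_self hr.le) v).2
    · simp only [dl]
      refine (d3_polar hw.sm hw.op hy hs (d3_bound hw hr hl hBU hell) _ _ _ (bv_norm _).le (bv_norm _).le (bv_norm _).le).trans (by linarith)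
    · simp at hlen
  rcases Nat.lt_or_ge m 1 with h0 | h1
  · intro r hr
    obtain ⟨K, hK, hb⟩ := base r hr
    exact ⟨K, hK, fun U w y hw hBU hell p q l hlen => hb U w y hw hBU hell p q l (by omega)⟩
  induction m, h1 using Nat.le_induction with
  | base => exact base
  | succ m hm ih =>
    intro r hr
    obtain ⟨K, hK, hb⟩ := ih (r / 2) (by positivity)
    obtain ⟨C, hC, hc⟩ := wstep n m hm (r := r / 2) (by positivity) hK hl hL
    refine ⟨K + C, by positivity, fun U w y hw hBU hell p q l hlen => ?_⟩
    have hsub : ∀ x ∈ Metric.closedBall y (r / 2), Metric.closedBall x (r / 2) ⊆ Metric.closedBall y r := by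
      intro x hx
      refine Metric.closedBall_subset_closedBall' ?_
      have := Metric.mem_closedBall.1 hx
      linarith
    have hb' : ∀ p q l, l.length ≤ m → ∀ x ∈ Metric.closedBall y (r / 2), |dl l (dd (bv p) (dd (bv q) w)) x| ≤ K := by
      intro p q l hl x hx
      exact hb U w x hw ((hsub x hx).trans hBU) (hell.mono (hsub x hx)) p q l hl
    have hyy : y ∈ Metric.closedBall y (r / 2) := Metric.mem_closedBall_self (by positivity)
    rcases Nat.lt_or_ge l.length (m + 1) with h | h
    · exact (hb' p q l (by omega) y hyy).trans (by linarith)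
    · exact (hc U w y hw ((hsub y hyy).trans hBU) (hell.mono (hsub y hyy)) hb' p q l (by omega)).trans (by linarith)
end SecQL

section SecQM
open Filter Topology Set
variable {n : ℕ}
open Atm Ex

lemma zstep (n m : ℕ) {r K lam Lam : ℝ} (hr : 0 < r) (hK : 0 ≤ K) (hl : 0 < lam) (hL : 0 < Lam) :
    ∃ C' : ℝ, 0 ≤ C' ∧ ∀ (U : Set (Euc n)) (w : Bool → Euc n → ℝ) (z : Euc n → ℝ) (y : Euc n), Cfg U w z → ZRel U w z → Metric.closedBall y r ⊆ U →
      (∀ b, Ell (Metric.closedBall y r) (w b) lam Lam) →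
      (∀ b p q l, l.length ≤ m + 3 → ∀ x ∈ Metric.closedBall y r, |dl l (dd (bv p) (dd (bv q) (w b))) x| ≤ K) →
      (∀ k l, l.length ≤ m → ∀ x ∈ Metric.closedBall y r, |dl l (dd (bv k) z) x| ≤ K) →
      ∀ k l, l.length = m + 1 → |dl l (dd (bv k) z) y| ≤ C' := by
  obtain ⟨C', hC'0, hC'⟩ := engine (n := n) (Fin n × List.Vector (Fin n) m) (m + 1) (by omega) (fun a => Z a.1 a.2.toList)
    (fun a => LzE a.1 a.2.toList) (fun a k => LzE a.1 (k :: a.2.toList))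
    (fun a => (grade_LzE _ _).trans (by simp)) (fun a k => (grade_LzE _ _).trans (by simp)) (r := r) (K := K + 1 + lam⁻¹) hr (by positivity) hl hL
  refine ⟨C', hC'0, fun U w z y hcfg hrel hBU hell hbd hbz k l hlen => ?_⟩
  have hli : 0 < lam⁻¹ := by positivity
  obtain ⟨k', l', rfl⟩ : ∃ k l', l = k :: l' := by
    cases l with
    | nil => simp at hlen
    | cons k l' => exact ⟨k, l', rfl⟩
  refine hC' U w z y hcfg hBU (hell true) ?_ (fun i => LL_z hcfg hrel _ _) (fun i k => LL_z hcfg hrel _ (k :: _)) ?_ (k, ⟨l', by simpa using hlen⟩) k'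
  · intro i x hx
    exact (hbz _ _ (by simp) x hx).trans (by linarith)
  · intro x hx a ha
    have hKp : 0 ≤ K + 1 + lam⁻¹ := by positivity
    cases a with
    | G b i j =>
      refine NN_lo _ _ _ _ hKp ?_
      exact ((hcfg.ma b).GI_bound (hBU hx) hl hL ((hell b).mono (by simpa using hx)) i j).trans (by linarith)
    | D b i j l =>
      refine NN_lo _ _ _ _ hKp ?_
      simp only [gr] at ha
      exact (hbd b i j l (by omega) x hx).trans (by linarith)
    | Z j l =>
      by_cases h1 : l.length ≤ m
      · exact NN_lo _ _ _ _ hKp ((hbz _ _ h1 x hx).trans (by linarith))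
      simp only [gr] at ha
      by_cases h2 : l.length = m + 1
      · obtain ⟨k, l', rfl⟩ : ∃ k l', l = k :: l' := by
          cases l with
          | nil => simp at h2
          | cons k l' => exact ⟨k, l', rfl⟩
        have h3 := le_gradSq (fun a : Fin n × List.Vector (Fin n) m => ev w z (Z a.1 a.2.toList)) x (j, ⟨l', by simpa using h2⟩) k
        have h4 : gr (Z j (k :: l')) = m + 1 := by simp only [gr]; omega
        rw [h4]
        simp only [NN, lt_irrefl, if_false, if_true]
        refine (show _ ≤ _ from h3).trans ?_
        have := Real.sqrt_nonneg (gradSq (fun a : Fin n × List.Vector (Fin n) m => ev w z (Z a.1 a.2.toList)) x)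
        nlinarith
      · obtain ⟨k, k2, l', rfl⟩ : ∃ k k2 l', l = k :: k2 :: l' := by
          rcases l with _ | ⟨k, _ | ⟨k2, l'⟩⟩
          · simp at h1
          · simp only [List.length_cons, List.length_nil] at h1 h2; omega
          · exact ⟨k, k2, l', rfl⟩
        simp only [List.length_cons] at h1 h2 ha
        have h3 := le_hessSq (fun a : Fin n × List.Vector (Fin n) m => ev w z (Z a.1 a.2.toList)) x (j, ⟨l', by omega⟩) k2 k
        have h4 : gr (Z j (k :: k2 :: l')) = m + 1 + 1 := by simp only [gr, List.length_cons]; omega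
        rw [h4]
        have h5 : ¬ (m + 1 + 1 < m + 1) := by omega
        have h6 : ¬ (m + 1 + 1 = m + 1) := by omega
        simp only [NN, h5, h6, if_false]
        refine (show _ ≤ _ from h3).trans ?_
        have := Real.sqrt_nonneg (hessSq (fun a : Fin n × List.Vector (Fin n) m => ev w z (Z a.1 a.2.toList)) x)
        have := gradSq_nonneg (fun a : Fin n × List.Vector (Fin n) m => ev w z (Z a.1 a.2.toList)) x
        nlinarith

lemma frame_trace {U : Set (Euc n)} {w w' : Euc n → ℝ} (h : MA U w) (h' : MA U w') {x : Euc n} (hx : x ∈ U) {v : Fin n → Euc n}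
    (hv : ∀ i j, ∑ s, v s i * v s j = GI w i j x) : (n : ℝ) ≤ ∑ s, dd (v s) (dd (v s) w') x ∧ ∑ s, dd (v s) (dd (v s) w) x = n := by
  have hcd' := h'.sm.cda2 h'.op hx
  have hcd := h.sm.cda2 h.op hx
  let R : Matrix (Fin n) (Fin n) ℝ := Matrix.of fun i s => v s i
  have hd : (hessianMatrix w x).det = 1 := h.det x hx
  have hd' : (hessianMatrix w' x).det = 1 := h'.det x hx
  have hR : R * R.transpose = (hessianMatrix w x)⁻¹ := by
    ext i j
    rw [show (hessianMatrix w x)⁻¹ i j = GI w i j x from rfl, ← hv, Matrix.mul_apply]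
    rfl
  have hRd : R.det * R.det = 1 := by
    have := congrArg Matrix.det hR
    rw [Matrix.det_mul, Matrix.det_transpose, Matrix.det_nonsing_inv, hd, Ring.inverse_one] at this
    exact this
  have hR0 : R.det ≠ 0 := by intro h; rw [h] at hRd; simp at hRd
  have hq : ∀ (u : Euc n → ℝ), ContDiffAt ℝ 2 u x → ∀ s, (R.transpose * hessianMatrix u x * R) s s = dd (v s) (dd (v s) u) x := by
    intro u hu s
    rw [ddd_exp hu]
    simp only [Matrix.mul_apply, Matrix.transpose_apply, R, Matrix.of_apply, Finset.sum_mul]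
    rw [Finset.sum_comm]
    refine Finset.sum_congr rfl fun i _ => Finset.sum_congr rfl fun j _ => by ring
  have hq2 : ∀ (u : Euc n → ℝ), ContDiffAt ℝ 2 u x → (R.transpose * hessianMatrix u x * R).trace = ∑ s, dd (v s) (dd (v s) u) x := by
    intro u hu
    simp only [Matrix.trace, Matrix.diag, hq u hu]
  constructor
  · rw [← hq2 w' hcd']
    refine trace_ge ?_ ?_
    · refine pd_of ?_ ?_
      · rw [Matrix.transpose_mul, Matrix.transpose_mul, Matrix.transpose_transpose, hess_symm hcd', Matrix.mul_assoc]
      · intro u hu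
        rw [qf_conj]
        refine pd_qf (h'.pd hx) ?_
        intro h0
        exact hR0 (Matrix.exists_mulVec_eq_zero_iff.1 ⟨u, hu, h0⟩)
    · rw [Matrix.det_mul, Matrix.det_mul, Matrix.det_transpose, hd']
      linarith
  · rw [← hq2 w hcd, Matrix.trace_mul_comm, ← Matrix.mul_assoc, hR, Matrix.nonsing_inv_mul _ (by rw [hd]; exact isUnit_one)]
    simp

lemma exists_comb {a b : ℝ} (h : a * b ≤ 0) : ∃ s : ℝ, 0 ≤ s ∧ s ≤ 1 ∧ (1 - s) * a + s * b = 0 := by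
  by_cases h0 : a = b
  · have : a = 0 := by subst h0; nlinarith [sq_nonneg a]
    exact ⟨0, le_rfl, zero_le_one, by simp [this]⟩
  · have hab : a - b ≠ 0 := sub_ne_zero.2 h0
    have hp : 0 < (a - b) ^ 2 := by positivity
    refine ⟨a / (a - b), ?_, ?_, ?_⟩
    · rw [show a / (a - b) = a * (a - b) / (a - b) ^ 2 from by field_simp]
      apply div_nonneg _ hp.le; nlinarith [sq_nonneg a]
    · rw [show a / (a - b) = a * (a - b) / (a - b) ^ 2 from by field_simp]
      rw [div_le_one hp]; nlinarith [sq_nonneg b]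
    · field_simp; ring

lemma LLz_bound {U : Set (Euc n)} {w : Bool → Euc n → ℝ} {z : Euc n → ℝ} (h : Cfg U w z) (hrel : ZRel U w z) {x : Euc n} (hx : x ∈ U)
    {lam Lam K p : ℝ} (hl : 0 < lam) (hL : 0 < Lam) (hK : 0 ≤ K) (hell : ∀ b, Ell {x} (w b) lam Lam)
    (hbd : ∀ i j k, |dd (bv k) (dd (bv i) (dd (bv j) (w false))) x| ≤ K) (hz : ∀ i j, |dd (bv i) (dd (bv j) z) x| ≤ p) (k : Fin n) :
    |LL w (dd (bv k) z) x| ≤ (n:ℝ) ^ 4 * (lam⁻¹ * lam⁻¹ * K) * p := by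
  rw [LL_z0 h hrel k x hx]
  have hb : ∀ i j p' q, |GI (w true) i p' x * dd (bv p') (dd (bv q) z) x * GI (w false) q j x * dd (bv k) (dd (bv i) (dd (bv j) (w false))) x|
      ≤ lam⁻¹ * p * lam⁻¹ * K := by
    intro i j p' q
    rw [abs_mul, abs_mul, abs_mul]
    have h1 := (h.ma true).GI_bound hx hl hL (hell true) i p'
    have h2 := (h.ma false).GI_bound hx hl hL (hell false) q j
    have h3 := hz p' q
    have h4 := hbd i j k
    have hp : 0 ≤ p := (abs_nonneg _).trans h3
    gcongr
  refine (Finset.abs_sum_le_sum_abs _ _).trans ?_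
  have h1 : ∀ i j, |∑ p', ∑ q, GI (w true) i p' x * dd (bv p') (dd (bv q) z) x * GI (w false) q j x * dd (bv k) (dd (bv i) (dd (bv j) (w false))) x|
      ≤ n * (n * (lam⁻¹ * p * lam⁻¹ * K)) := by
    intro i j
    refine (Finset.abs_sum_le_sum_abs _ _).trans ?_
    refine (Finset.sum_le_sum fun p' _ => (Finset.abs_sum_le_sum_abs _ _).trans (Finset.sum_le_sum fun q _ => hb i j p' q)).trans ?_
    simp
  refine (Finset.sum_le_sum fun i _ => (Finset.abs_sum_le_sum_abs _ _).trans (Finset.sum_le_sum fun j _ => h1 i j)).trans ?_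
  simp
  apply le_of_eq; ring

lemma zstep0 (n : ℕ) {r K lam Lam : ℝ} (hr : 0 < r) (hK : 0 ≤ K) (hl : 0 < lam) (hL : 0 < Lam) :
    ∃ C' : ℝ, 0 ≤ C' ∧ ∀ (U : Set (Euc n)) (w : Bool → Euc n → ℝ) (z : Euc n → ℝ) (y : Euc n), Cfg U w z → ZRel U w z → Metric.closedBall y r ⊆ U →
      (∀ b, Ell (Metric.closedBall y r) (w b) lam Lam) →
      (∀ b p q l, l.length ≤ 1 → ∀ x ∈ Metric.closedBall y r, |dl l (dd (bv p) (dd (bv q) (w b))) x| ≤ K) →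
      (∀ x ∈ Metric.closedBall y r, |z x| ≤ 1) →
      ∀ k, |dd (bv k) z y| ≤ C' := by
  have hC0 : 0 ≤ (n:ℝ) ^ 4 * (lam⁻¹ * lam⁻¹ * K) := by positivity
  obtain ⟨C', hC'0, hC'⟩ := bernst Unit (Fin n ⊕ Fin n) n (lam := Lam⁻¹) (Lam := lam⁻¹) (by positivity) (by positivity) hC0 zero_le_one hr
  refine ⟨C', hC'0, fun U w z y hcfg hrel hBU hell hbd hbz k => ?_⟩
  refine hC' U y (fun _ => z) hcfg.op hBU (fun _ => hcfg.sz) (fun _ => hbz) ?_ () k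
  intro x hx
  have hxU := hBU hx
  have hU := hcfg.op
  have hellx : ∀ b, Ell {x} (w b) lam Lam := fun b => (hell b).mono (by simpa using hx)
  obtain ⟨v, hv1, hv2, hv3⟩ := (hcfg.ma true).Gframe hxU hl hL (fun v => (hell true x hx v).1) (fun v => (hell true x hx v).2)
  obtain ⟨v', hv1', hv2', hv3'⟩ := (hcfg.ma false).Gframe hxU hl hL (fun v => (hell false x hx v).1) (fun v => (hell false x hx v).2)
  set a := ∑ s, dd (v s) (dd (v s) z) x with ha
  set b := ∑ s, dd (v' s) (dd (v' s) z) x with hb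
  have hab : a * b ≤ 0 := by
    obtain ⟨ε, c, hε, h0⟩ := hrel
    have s1 := (hcfg.ma true).sm
    have s2 := (hcfg.ma false).sm
    have sz := hcfg.sz
    have r2 : ∀ u, dd u (dd u (w true)) x - dd u (dd u (w false)) x = ε * dd u (dd u z) x := fun u => by
      have := ZRel.d1 hU (s1.dd hU _) (s2.dd hU _) (sz.dd hU _) (ZRel.d1 hU s1 s2 sz h0 u) u x hxU
      linarith
    have e1 : ε * a = ∑ s, dd (v s) (dd (v s) (w true)) x - ∑ s, dd (v s) (dd (v s) (w false)) x := by
      rw [ha, Finset.mul_sum, ← Finset.sum_sub_distrib]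
      exact Finset.sum_congr rfl fun s _ => (r2 _).symm
    have e2 : ε * b = ∑ s, dd (v' s) (dd (v' s) (w true)) x - ∑ s, dd (v' s) (dd (v' s) (w false)) x := by
      rw [hb, Finset.mul_sum, ← Finset.sum_sub_distrib]
      exact Finset.sum_congr rfl fun s _ => (r2 _).symm
    obtain ⟨t1, t2⟩ := frame_trace (hcfg.ma true) (hcfg.ma false) hxU hv1
    obtain ⟨t3, t4⟩ := frame_trace (hcfg.ma false) (hcfg.ma true) hxU hv1'
    have f1 : ε * a ≤ 0 := by rw [e1]; linarith
    have f2 : 0 ≤ ε * b := by rw [e2]; linarith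
    have hp : 0 < ε ^ 2 := by positivity
    have : ε ^ 2 * (a * b) ≤ 0 := by nlinarith
    by_contra hcon
    push Not at hcon
    nlinarith [mul_pos hp hcon]
  obtain ⟨s, hs0, hs1, hs⟩ := exists_comb hab
  have q1 : √(1 - s) ^ 2 = 1 - s := Real.sq_sqrt (by linarith)
  have q2 : √s ^ 2 = s := Real.sq_sqrt hs0
  refine ⟨Sum.elim (fun i => √(1 - s) • v i) (fun i => √s • v' i), ?_, ?_, ?_, ?_⟩
  · intro p
    simp only [Fintype.sum_sum_type, Sum.elim_inl, Sum.elim_inr, inner_smul_right, mul_pow, q1, q2, ← Finset.mul_sum]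
    rw [← div_eq_inv_mul, div_le_iff₀ hL]
    have := hv2 p
    have := hv2' p
    nlinarith
  · intro p
    simp only [Fintype.sum_sum_type, Sum.elim_inl, Sum.elim_inr, inner_smul_right, mul_pow, q1, q2, ← Finset.mul_sum]
    have := hv3 p
    have := hv3' p
    nlinarith
  · intro _
    have hcd := hcfg.sz.cda2 hU hxU
    simp only [Fintype.sum_sum_type, Sum.elim_inl, Sum.elim_inr, d2_smul hcd, q1, q2, ← Finset.mul_sum]
    rw [← ha, ← hb, hs, abs_zero]
    have := Real.sqrt_nonneg (gradSq (fun _ : Unit => z) x)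
    positivity
  · intro _ k
    have hcd := (hcfg.sz.dd hU (bv k)).cda2 hU hxU
    simp only [Fintype.sum_sum_type, Sum.elim_inl, Sum.elim_inr, d2_smul hcd, q1, q2, ← Finset.mul_sum]
    have hz : ∀ i j, |dd (bv i) (dd (bv j) z) x| ≤ √(hessSq (fun _ : Unit => z) x) := fun i j => le_hessSq (fun _ : Unit => z) x () j i
    have b1 := LLz_bound hcfg hrel hxU hl hL hK hellx (fun i j k => hbd false i j [k] (by simp) x hx) hz k
    have hcfg' : Cfg U (fun b => w (!b)) z := ⟨fun b => hcfg.ma _, hcfg.sz⟩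
    have hrel' : ZRel U (fun b => w (!b)) z := by
      obtain ⟨ε, c, hε, h0⟩ := hrel
      refine ⟨-ε, -c, neg_ne_zero.2 hε, fun x hx => ?_⟩
      have := h0 x hx
      simp only [Bool.not_true, Bool.not_false]; linarith
    have b2 := LLz_bound hcfg' hrel' hxU hl hL hK (fun b => hellx (!b)) (fun i j k => hbd true i j [k] (by simp) x hx) hz k
    rw [frame_LL hv1 hcd, frame_LL (w := fun b => w (!b)) hv1' hcd]
    have g0 := gradSq_nonneg (fun _ : Unit => z) x
    have g1 := Real.sqrt_nonneg (hessSq (fun _ : Unit => z) x)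
    refine (abs_add_le _ _).trans ?_
    rw [abs_mul, abs_mul, abs_of_nonneg hs0, abs_of_nonneg (by linarith : 0 ≤ 1 - s)]
    have e1 : (n:ℝ) ^ 4 * (lam⁻¹ * lam⁻¹ * K) * √(hessSq (fun _ : Unit => z) x) ≤ (n:ℝ) ^ 4 * (lam⁻¹ * lam⁻¹ * K) * (1 + gradSq (fun _ : Unit => z) x + √(hessSq (fun _ : Unit => z) x)) := by
      gcongr; linarith
    have := b1.trans e1
    have := b2.trans e1
    nlinarith
end SecQM

section SecQN
open Filter Topology Set
variable {n : ℕ}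
open Atm Ex

lemma cball_sub {y x : Euc n} {r s : ℝ} (hx : x ∈ Metric.closedBall y s) : Metric.closedBall x r ⊆ Metric.closedBall y (r + s) := by
  refine Metric.closedBall_subset_closedBall' ?_
  have := Metric.mem_closedBall.1 hx
  linarith

def ZB (n m : ℕ) (lam Lam r K : ℝ) : Prop :=
    ∀ (U : Set (Euc n)) (w : Bool → Euc n → ℝ) (z : Euc n → ℝ) (y : Euc n), Cfg U w z → ZRel U w z → Metric.closedBall y r ⊆ U →
      (∀ b, Ell (Metric.closedBall y r) (w b) lam Lam) →
      (∀ x ∈ Metric.closedBall y r, |z x| ≤ 1) →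
      ∀ k l, l.length ≤ m → |dl l (dd (bv k) z) y| ≤ K

lemma zbd (n m : ℕ) {lam Lam : ℝ} (hl : 0 < lam) (hL : 0 < Lam) : ∀ r : ℝ, 0 < r → ∃ K : ℝ, 0 ≤ K ∧ ZB n m lam Lam r K := by
  induction m with
  | zero =>
    intro r hr
    obtain ⟨K, hK, hb⟩ := wbd n 1 hl hL (r / 2) (by positivity)
    obtain ⟨C, hC, hc⟩ := zstep0 n (r := r / 2) (by positivity) hK hl hL
    refine ⟨C, hC, fun U w z y hcfg hrel hBU hell hz k l hlen => ?_⟩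
    have hl0 : l = [] := List.length_eq_zero_iff.1 (by omega)
    subst hl0
    have hsub : ∀ x ∈ Metric.closedBall y (r / 2), Metric.closedBall x (r / 2) ⊆ Metric.closedBall y r := by
      intro x hx
      simpa using cball_sub (r := r / 2) hx
    have hyy : y ∈ Metric.closedBall y (r / 2) := Metric.mem_closedBall_self (by positivity)
    refine hc U w z y hcfg hrel ((hsub y hyy).trans hBU) (fun b => (hell b).mono (hsub y hyy)) ?_ (fun x hx => hz x (hsub y hyy hx)) k
    intro b p q l hl x hx
    exact hb U (w b) x (hcfg.ma b) ((hsub x hx).trans hBU) ((hell b).mono (hsub x hx)) p q l hl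
  | succ m ih =>
    intro r hr
    obtain ⟨K1, hK1, hb⟩ := wbd n (m + 3) hl hL (r / 2) (by positivity)
    obtain ⟨K2, hK2, hz2⟩ := ih (r / 2) (by positivity)
    obtain ⟨C, hC, hc⟩ := zstep n m (r := r / 2) (K := K1 + K2) (by positivity) (by positivity) hl hL
    refine ⟨K2 + C, by positivity, fun U w z y hcfg hrel hBU hell hz k l hlen => ?_⟩
    have hsub : ∀ x ∈ Metric.closedBall y (r / 2), Metric.closedBall x (r / 2) ⊆ Metric.closedBall y r := by
      intro x hx
      simpa using cball_sub (r := r / 2) hx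
    have hyy : y ∈ Metric.closedBall y (r / 2) := Metric.mem_closedBall_self (by positivity)
    have hz' : ∀ k l, l.length ≤ m → ∀ x ∈ Metric.closedBall y (r / 2), |dl l (dd (bv k) z) x| ≤ K2 := fun k l hl x hx =>
      hz2 U w z x hcfg hrel ((hsub x hx).trans hBU) (fun b => (hell b).mono (hsub x hx)) (fun x' hx' => hz x' (hsub x hx hx')) k l hl
    rcases Nat.lt_or_ge l.length (m + 1) with h | h
    · exact (hz' k l (by omega) y hyy).trans (by linarith)
    · refine (hc U w z y hcfg hrel ((hsub y hyy).trans hBU) (fun b => (hell b).mono (hsub y hyy)) ?_ ?_ k l (by omega)).trans (by linarith)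
      · intro b p q l hl x hx
        exact (hb U (w b) x (hcfg.ma b) ((hsub x hx).trans hBU) ((hell b).mono (hsub x hx)) p q l hl).trans (by linarith)
      · intro k l hl x hx
        exact (hz' k l hl x hx).trans (by linarith)

lemma iter3 {U : Set (Euc n)} {f : Euc n → ℝ} (hf : Sm U f) (hU : IsOpen U) {x : Euc n} (hx : x ∈ U) (m : Fin 3 → Euc n) :
    iteratedFDeriv ℝ 3 f x m = dd (m 0) (dd (m 1) (dd (m 2) f)) x := by
  rw [iteratedFDeriv_succ_apply_left]
  have h1 : DifferentiableAt ℝ (iteratedFDeriv ℝ 2 f) x :=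
    (hf.cda hU hx 3).differentiableAt_iteratedFDeriv (by norm_num)
  have h2 : fderiv ℝ (fun y => iteratedFDeriv ℝ 2 f y (Fin.tail m)) x (m 0) = (fderiv ℝ (iteratedFDeriv ℝ 2 f) x (m 0)) (Fin.tail m) := by
    have := ((ContinuousMultilinearMap.apply ℝ (fun _ : Fin 2 => Euc n) ℝ (Fin.tail m)).hasFDerivAt.comp x h1.hasFDerivAt).fderiv
    have h3 : (fun y => iteratedFDeriv ℝ 2 f y (Fin.tail m)) = (ContinuousMultilinearMap.apply ℝ (fun _ : Fin 2 => Euc n) ℝ (Fin.tail m)) ∘ iteratedFDeriv ℝ 2 f := rfl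
    rw [h3, this]; rfl
  rw [← h2]
  refine dd_congr hU (fun z hz => ?_) (m 0) x hx
  rw [iteratedFDeriv_two_apply]
  have h1 : DifferentiableAt ℝ (fderiv ℝ f) z := ((hf.cda2 hU hz).fderiv_right (m := 1) (by norm_num [one_add_one_eq_two])).differentiableAt (by norm_num)
  have := (((ContinuousLinearMap.apply ℝ ℝ (m 2)).hasFDerivAt.comp z h1.hasFDerivAt)).fderiv
  change _ = fderiv ℝ ((ContinuousLinearMap.apply ℝ ℝ (m 2)) ∘ fderiv ℝ f) z (m 1)
  rw [this]; rfl

lemma comp_le (v : Euc n) (i : Fin n) : |v i| ≤ ‖v‖ := by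
  simpa using PiLp.norm_apply_le v i

lemma d3_norm {U : Set (Euc n)} {f : Euc n → ℝ} (hf : Sm U f) (hU : IsOpen U) {x : Euc n} (hx : x ∈ U) {C : ℝ} (hC : 0 ≤ C)
    (hb : ∀ i j k, |dd (bv i) (dd (bv j) (dd (bv k) f)) x| ≤ C) : ‖iteratedFDeriv ℝ 3 f x‖ ≤ n ^ 3 * C := by
  refine ContinuousMultilinearMap.opNorm_le_bound (by positivity) fun m => ?_
  rw [iter3 hf hU hx, d3_exp hf hU _ _ _ hx, Real.norm_eq_abs, Fin.prod_univ_three]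
  have h1 : ∀ i j k, |m 0 i * m 1 j * m 2 k * dd (EuclideanSpace.single i 1) (dd (EuclideanSpace.single j 1) (dd (EuclideanSpace.single k 1) f)) x|
      ≤ ‖m 0‖ * ‖m 1‖ * ‖m 2‖ * C := by
    intro i j k
    rw [abs_mul, abs_mul, abs_mul]
    have a1 := comp_le (m 0) i
    have a2 := comp_le (m 1) j
    have a3 := comp_le (m 2) k
    have a4 := hb i j k
    simp only [bv] at a4
    gcongr
  refine (Finset.abs_sum_le_sum_abs _ _).trans ?_
  refine (Finset.sum_le_sum fun i _ => (Finset.abs_sum_le_sum_abs _ _).trans (Finset.sum_le_sum fun j _ => (Finset.abs_sum_le_sum_abs _ _).trans (Finset.sum_le_sum fun k _ => h1 i j k))).trans ?_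
  simp
  apply le_of_eq; ring

lemma d2_norm {f : Euc n → ℝ} {x : Euc n} (hf : ContDiffAt ℝ 2 f x) {C : ℝ} (hC : 0 ≤ C)
    (hb : ∀ i j, |dd (bv i) (dd (bv j) f) x| ≤ C) (v : Euc n) : |dd v (dd v f) x| ≤ n ^ 2 * C * ‖v‖ ^ 2 := by
  have h0 : dd v (dd v f) x = ∑ i, ∑ j, v i * v j * dd (bv i) (dd (bv j) f) x := by
    rw [ddd_exp hf]
    refine Finset.sum_congr rfl fun i _ => Finset.sum_congr rfl fun j _ => ?_
    rw [hessianMatrix_apply hf]; rfl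
  have h1 : ∀ i j, |v i * v j * dd (bv i) (dd (bv j) f) x| ≤ ‖v‖ * ‖v‖ * C := by
    intro i j
    rw [abs_mul, abs_mul]
    have a1 := comp_le v i
    have a2 := comp_le v j
    have a4 := hb i j
    gcongr
  rw [h0]
  refine (Finset.abs_sum_le_sum_abs _ _).trans ?_
  refine (Finset.sum_le_sum fun i _ => (Finset.abs_sum_le_sum_abs _ _).trans (Finset.sum_le_sum fun j _ => h1 i j)).trans ?_
  simp
  apply le_of_eq; ring

theorem difference (n : ℕ) {lam Lam : ℝ} (hl : 0 < lam) (hL : 0 < Lam) {r : ℝ} (hr : 0 < r) : ∃ C : ℝ, 0 ≤ C ∧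
    ∀ (U : Set (Euc n)) (w1 w2 : Euc n → ℝ) (y : Euc n) (c ε : ℝ), 0 ≤ ε → MA U w1 → MA U w2 → Metric.closedBall y r ⊆ U →
      Ell (Metric.closedBall y r) w1 lam Lam → Ell (Metric.closedBall y r) w2 lam Lam →
      (∀ x ∈ Metric.closedBall y r, |w1 x - w2 x - c| ≤ ε) →
      (∀ v, |dd v (dd v (fun x => w1 x - w2 x)) y| ≤ C * ε * ‖v‖ ^ 2) ∧
      ‖iteratedFDeriv ℝ 3 (fun x => w1 x - w2 x) y‖ ≤ C * ε := by
  obtain ⟨K, hK, hz⟩ := zbd n 2 hl hL r hr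
  refine ⟨n ^ 2 * K + n ^ 3 * K, by positivity, fun U w1 w2 y c ε hε m1 m2 hBU e1 e2 hb => ?_⟩
  have hyU : y ∈ U := hBU (Metric.mem_closedBall_self hr.le)
  have hU := m1.op
  set f : Euc n → ℝ := fun x => w1 x - w2 x with hf
  have sf : Sm U f := m1.sm.sub m2.sm
  suffices h : ∀ ε' > ε, (∀ v, |dd v (dd v f) y| ≤ (n ^ 2 * K + n ^ 3 * K) * ε' * ‖v‖ ^ 2) ∧
      ‖iteratedFDeriv ℝ 3 f y‖ ≤ (n ^ 2 * K + n ^ 3 * K) * ε' by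
    have hcl : ∀ {a b : ℝ}, (∀ ε' > ε, a ≤ b * ε') → a ≤ b * ε := by
      intro a b h
      have h1 : Tendsto (fun e : ℝ => b * e) (𝓝[>] ε) (𝓝 (b * ε)) := (continuous_const.mul continuous_id).continuousWithinAt.tendsto
      refine ge_of_tendsto h1 ?_
      filter_upwards [self_mem_nhdsWithin] with e he using h e he
    refine ⟨fun v => ?_, hcl fun ε' h' => (h ε' h').2⟩
    have := hcl (a := |dd v (dd v f) y|) (b := (n ^ 2 * K + n ^ 3 * K) * ‖v‖ ^ 2) fun ε' h' => by
      have := (h ε' h').1 v; linarith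
    linarith
  intro ε' hε'
  have hp : 0 < ε' := lt_of_le_of_lt hε hε'
  set z : Euc n → ℝ := fun x => ε'⁻¹ * (f x - c) with hzd
  have sz : Sm U z := (Sm.const (U := U) ε'⁻¹).mul (sf.sub (Sm.const (U := U) c))
  have hcfg : Cfg U (fun b => if b then w1 else w2) z := ⟨fun b => by cases b <;> simpa, sz⟩
  have hrel : ZRel U (fun b => if b then w1 else w2) z := ⟨ε', c, hp.ne', fun x _ => by
    simp [hzd, hf]; field_simp; ring⟩
  have hb1 := hz U _ z y hcfg hrel hBU (fun b => by cases b <;> simpa) (fun x hx => by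
    simp only [hzd, abs_mul, abs_inv, abs_of_pos hp]
    rw [inv_mul_le_iff₀ hp]; have := hb x hx; simp only [hf]; linarith)
  have d1 : ∀ v, ∀ x ∈ U, dd v f x = ε' * dd v z x := by
    intro v x hx
    have : f = fun x => ε' * z x + c := by ext x; simp only [hzd]; field_simp; ring
    rw [this, dd_add ((sz.diff hU hx).const_mul _) (differentiableAt_const _), dd_cmul (sz.diff hU hx)]
    simp [dd_const]
  have d2 : ∀ u v, ∀ x ∈ U, dd u (dd v f) x = ε' * dd u (dd v z) x := by
    intro u v x hx
    rw [dd_congr hU (d1 v) u x hx, dd_cmul ((sz.dd hU v).diff hU hx)]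
  have d3 : ∀ t u v, ∀ x ∈ U, dd t (dd u (dd v f)) x = ε' * dd t (dd u (dd v z)) x := by
    intro t u v x hx
    rw [dd_congr hU (d2 u v) t x hx, dd_cmul (((sz.dd hU v).dd hU u).diff hU hx)]
  have hn2 : 0 ≤ (n:ℝ) ^ 2 * K * ε' := by positivity
  have hn3 : 0 ≤ (n:ℝ) ^ 3 * K * ε' := by positivity
  constructor
  · intro v
    refine (d2_norm (sf.cda2 hU hyU) (C := ε' * K) (by positivity) (fun i j => ?_) v).trans ?_
    · rw [d2 _ _ y hyU, abs_mul, abs_of_pos hp]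
      exact mul_le_mul_of_nonneg_left (hb1 j [i] (by simp)) hp.le
    · refine mul_le_mul_of_nonneg_right ?_ (by positivity)
      nlinarith
  · refine (d3_norm sf hU hyU (C := ε' * K) (by positivity) (fun i j k => ?_)).trans ?_
    · rw [d3 _ _ _ y hyU, abs_mul, abs_of_pos hp]
      exact mul_le_mul_of_nonneg_left (hb1 k [i, j] (by simp)) hp.le
    · nlinarith
end SecQN

section SecQO
open Filter Topology Set
variable {n : ℕ}

lemma dd_of_poly {f : Euc n → ℝ} {y v : Euc n} (hf : DifferentiableAt ℝ f y) {b c : ℝ}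
    (h : ∀ t : ℝ, f (y + t • v) = f y + t * b + t * t * c) : dd v f y = b := by
  have h1 : HasDerivAt (fun s : ℝ => f (y + s • v)) (dd v f (y + (0:ℝ) • v)) 0 := hasDerivAt_line (by simpa using hf)
  have h2 : HasDerivAt (fun s : ℝ => f (y + s • v)) b 0 := by
    have e : (fun s : ℝ => f (y + s • v)) = fun s => f y + s * b + s * s * c := funext h
    rw [e]
    have := (((hasDerivAt_id (0:ℝ)).mul_const b).const_add (f y)).add (((hasDerivAt_id (0:ℝ)).mul (hasDerivAt_id (0:ℝ))).mul_const c)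
    simp only [one_mul, id, mul_zero, zero_mul, add_zero] at this
    exact this
  have := h1.unique h2
  simpa using this

/-- quadratic barrier -/
def qb (a B C D : ℝ) (ξ p ν : Euc n) (y : Euc n) : ℝ :=
  a * ‖y - ξ‖ ^ 2 + B * (inner ℝ (p - y) ν) ^ 2 + C * inner ℝ (p - y) ν + D

section
variable (a B C D : ℝ) (ξ p ν : Euc n)

lemma qb_cd {k : WithTop ℕ∞} : ContDiff ℝ k (qb a B C D ξ p ν) := by
  unfold qb
  have h1 : ContDiff ℝ k (fun y : Euc n => ‖y - ξ‖ ^ 2) := (contDiff_norm_sq ℝ).comp (contDiff_id.sub contDiff_const)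
  have h2 : ContDiff ℝ k (fun y : Euc n => (inner ℝ (p - y) ν : ℝ)) := (contDiff_const.sub contDiff_id).inner ℝ contDiff_const
  exact (((contDiff_const.mul h1).add (contDiff_const.mul (h2.pow 2))).add (contDiff_const.mul h2)).add contDiff_const

lemma qb_dd (v y : Euc n) : dd v (qb a B C D ξ p ν) y =
    2 * a * inner ℝ (y - ξ) v - 2 * B * inner ℝ (p - y) ν * inner ℝ v ν - C * inner ℝ v ν := by
  refine dd_of_poly (c := a * ‖v‖ ^ 2 + B * inner ℝ v ν ^ 2) ((qb_cd a B C D ξ p ν (k := 1)).differentiable (by norm_num) y) fun t => ?_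
  have e1 : y + t • v - ξ = (y - ξ) + t • v := by abel
  have e2 : p - (y + t • v) = (p - y) - t • v := by abel
  simp only [qb]
  simp only [e1, e2, norm_add_sq_real, inner_sub_left, inner_smul_left, inner_smul_right, norm_smul, mul_pow]
  simp only [Real.norm_eq_abs, sq_abs, conj_trivial]
  ring

lemma qb_ddd (u v y : Euc n) : dd u (dd v (qb a B C D ξ p ν)) y = 2 * a * inner ℝ u v + 2 * B * inner ℝ u ν * inner ℝ v ν := by
  refine dd_of_poly (c := 0) ((contDiffAt_dd (m := 1) (qb_cd a B C D ξ p ν).contDiffAt v).differentiableAt (by norm_num)) fun t => ?_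
  have e1 : y + t • u - ξ = (y - ξ) + t • u := by abel
  have e2 : p - (y + t • u) = (p - y) - t • u := by abel
  simp only [qb_dd, e1, e2, inner_sub_left, inner_smul_left, inner_add_left]
  simp only [conj_trivial]
  ring

lemma rank1_det {a : ℝ} (ha : a ≠ 0) (B : ℝ) (ν : Fin n → ℝ) (H : Matrix (Fin n) (Fin n) ℝ)
    (h : ∀ i j, H i j = (if i = j then a else 0) + B * ν i * ν j) : H.det = a ^ n * (1 + B / a * (ν ⬝ᵥ ν)) := by
  have e : H = a • (1 + Matrix.replicateCol Unit ((B / a) • ν) * Matrix.replicateRow Unit ν) := by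
    ext i j
    rw [h]
    simp [Matrix.mul_apply, Matrix.one_apply, mul_add]
    field_simp
  rw [e, Matrix.det_smul, Matrix.det_one_add_replicateCol_mul_replicateRow]
  simp

lemma qb_det (ha : a ≠ 0) (hν : ‖ν‖ = 1) (y : Euc n) : hessDet (qb a B C D ξ p ν) y = (2 * a) ^ n * (1 + B / a) := by
  have h := rank1_det (n := n) (a := 2 * a) (by simpa using ha) (2 * B) ν.ofLp (hessianMatrix (qb a B C D ξ p ν) y) (fun i j => by
    rw [hessianMatrix_apply (qb_cd a B C D ξ p ν).contDiffAt, qb_ddd]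
    have e1 : (inner ℝ (EuclideanSpace.single i (1:ℝ) : Euc n) (EuclideanSpace.single j 1)) = if i = j then (1:ℝ) else 0 := by
      simp [EuclideanSpace.inner_single_left, Pi.single_apply]
    rw [e1]
    simp only [EuclideanSpace.inner_single_left]
    split_ifs <;> simp <;> ring)
  rw [hessDet, h]
  have : ν.ofLp ⬝ᵥ ν.ofLp = 1 := by
    have := EuclideanSpace.real_norm_sq_eq ν
    rw [hν] at this
    simp only [dotProduct]
    rw [← one_pow 2, this]
    exact Finset.sum_congr rfl fun i _ => by ring
  rw [this]; field_simp

lemma qb_det0 (y : Euc n) : hessDet (qb a 0 C D ξ p ν) y = (2 * a) ^ n := by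
  rw [hessDet]
  have : hessianMatrix (qb a 0 C D ξ p ν) y = (2 * a) • 1 := by
    ext i j
    rw [hessianMatrix_apply (qb_cd a 0 C D ξ p ν).contDiffAt, qb_ddd]
    have e1 : (inner ℝ (EuclideanSpace.single i (1:ℝ) : Euc n) (EuclideanSpace.single j 1)) = if i = j then (1:ℝ) else 0 := by
      simp [EuclideanSpace.inner_single_left, Pi.single_apply]
    rw [e1]
    simp [Matrix.one_apply]
  rw [this, Matrix.det_smul]; simp
end

lemma quad_cd (a D : ℝ) (ξ : Euc n) {k : WithTop ℕ∞} : ContDiff ℝ k (fun y : Euc n => a * ‖y - ξ‖ ^ 2 + D) := by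
  have := qb_cd a 0 0 D ξ 0 0 (k := k)
  have e : qb a 0 0 D ξ 0 0 = (fun y : Euc n => a * ‖y - ξ‖ ^ 2 + D) := by ext y; simp [qb]
  rwa [e] at this
lemma quad_det (a D : ℝ) (ξ y : Euc n) : hessDet (fun y : Euc n => a * ‖y - ξ‖ ^ 2 + D) y = (2 * a) ^ n := by
  have := qb_det0 a 0 D ξ 0 0 y
  have e : qb a 0 0 D ξ 0 0 = (fun y : Euc n => a * ‖y - ξ‖ ^ 2 + D) := by ext y; simp [qb]
  rwa [e] at this
lemma quad_conv {a : ℝ} (ha : 0 ≤ a) (D : ℝ) (ξ v y : Euc n) : 0 ≤ dd v (dd v (fun y : Euc n => a * ‖y - ξ‖ ^ 2 + D)) y := by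
  have := qb_ddd a 0 0 D ξ 0 0 v v y
  have e : qb a 0 0 D ξ 0 0 = (fun y : Euc n => a * ‖y - ξ‖ ^ 2 + D) := by ext y; simp [qb]
  rw [e] at this
  rw [this]
  have := real_inner_self_nonneg (x := v)
  simp; positivity

/-- Dirichlet solution on a normalized domain -/
structure Dir (Ω : Set (Euc n)) (ξ : Euc n) (W : Euc n → ℝ) : Prop where
  hn : 2 ≤ n
  op : IsOpen Ω
  cv : Convex ℝ Ω
  b1 : Metric.ball ξ 1 ⊆ Ω
  bn : Ω ⊆ Metric.ball ξ n
  sm : Sm Ω W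
  wcv : ConvexOn ℝ Ω W
  wc : ContinuousOn W (closure Ω)
  det : ∀ x ∈ Ω, hessDet W x = 1
  bd : ∀ x ∈ frontier Ω, W x = 0

namespace Dir
variable {Ω : Set (Euc n)} {ξ : Euc n} {W : Euc n → ℝ}

lemma ma (h : Dir Ω ξ W) : MA Ω W := ⟨h.op, h.sm, h.det, fun x hx v => convex_hess h.op h.wcv hx (h.sm.cda2 h.op hx) v⟩
lemma bdd (h : Dir Ω ξ W) : Bornology.IsBounded Ω := Metric.isBounded_ball.subset h.bn
lemma cl_bn (h : Dir Ω ξ W) : closure Ω ⊆ Metric.closedBall ξ n := (closure_mono h.bn).trans Metric.closure_ball_subset_closedBall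
lemma n0 (h : Dir Ω ξ W) : (2:ℝ) ≤ n := by exact_mod_cast h.hn

lemma lower (h : Dir Ω ξ W) : ∀ x ∈ closure Ω, ‖x - ξ‖ ^ 2 - n ^ 2 ≤ W x := by
  have := comparison h.op h.bdd (b := fun y => 1 * ‖y - ξ‖ ^ 2 + (-(n:ℝ)^2)) (u := W) ((quad_cd _ _ _ (k := 0)).continuous.continuousOn) h.wc
    (fun x _ => (quad_cd _ _ _).contDiffAt) (fun x hx => h.sm.cda2 h.op hx) (fun x _ v => quad_conv zero_le_one _ _ _ _)
    (fun x hx => by rw [quad_det, h.det x hx]; exact one_lt_pow₀ (by norm_num) (by have := h.hn; omega))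
    (fun x hx => by
      rw [h.bd x hx]
      have h1 := h.cl_bn (frontier_subset_closure hx)
      rw [Metric.mem_closedBall, dist_eq_norm] at h1
      have := pow_le_pow_left₀ (norm_nonneg _) h1 2
      linarith)
  intro x hx
  have := this x hx
  linarith

lemma lower' (h : Dir Ω ξ W) : ∀ x ∈ closure Ω, - (n:ℝ) ^ 2 ≤ W x := fun x hx => by
  have := h.lower x hx
  nlinarith [sq_nonneg ‖x - ξ‖]

lemma upper (h : Dir Ω ξ W) : ∀ x ∈ closure Ω, W x ≤ 0 := by
  have key : ∀ θ : ℝ, 0 < θ → θ < 1 → ∀ x ∈ closure Ω, W x ≤ θ * ‖x - ξ‖ ^ 2 := by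
    intro θ h0 h1 x hx
    have := comparison h.op h.bdd (b := W) (u := fun y => (θ / 2) * ‖y - ξ‖ ^ 2 + 0) h.wc ((quad_cd _ _ _ (k := 0)).continuous.continuousOn)
      (fun x hx => h.sm.cda2 h.op hx) (fun x _ => (quad_cd _ _ _).contDiffAt) h.ma.conv
      (fun x hx => by rw [quad_det, h.det x hx]; exact pow_lt_one₀ (by linarith) (by linarith) (by have := h.hn; omega))
      (fun x hx => by rw [h.bd x hx]; positivity) x hx
    nlinarith [sq_nonneg ‖x - ξ‖]
  intro x hx
  have h1 : Tendsto (fun θ : ℝ => θ * ‖x - ξ‖ ^ 2) (𝓝[>] 0) (𝓝 (0 * ‖x - ξ‖ ^ 2)) := (continuous_id.mul continuous_const).continuousWithinAt.tendsto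
  rw [zero_mul] at h1
  refine ge_of_tendsto h1 ?_
  filter_upwards [Ioo_mem_nhdsGT (show (0:ℝ) < 1 by norm_num)] with θ hθ using key θ hθ.1 hθ.2 x hx

lemma upper1 (h : Dir Ω ξ W) : ∀ x ∈ Metric.closedBall ξ 1, W x ≤ 1/2 * (‖x - ξ‖ ^ 2 - 1) := by
  have hcl : closure (Metric.ball ξ 1) = Metric.closedBall ξ 1 := closure_ball ξ one_ne_zero
  have key : ∀ θ : ℝ, 0 < θ → θ < 1 → ∀ x ∈ Metric.closedBall ξ 1, W x ≤ θ * (1/2 * (‖x - ξ‖ ^ 2 - 1)) := by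
    intro θ h0 h1 x hx
    have := comparison (Ω := Metric.ball ξ 1) Metric.isOpen_ball Metric.isBounded_ball (b := W) (u := fun y => (θ / 2) * ‖y - ξ‖ ^ 2 + (-θ/2))
      (h.wc.mono (closure_mono h.b1)) ((quad_cd _ _ _ (k := 0)).continuous.continuousOn)
      (fun x hx => h.sm.cda2 h.op (h.b1 hx)) (fun x _ => (quad_cd _ _ _).contDiffAt) (fun x hx => h.ma.conv x (h.b1 hx))
      (fun x hx => by rw [quad_det, h.det x (h.b1 hx)]; exact pow_lt_one₀ (by linarith) (by linarith) (by have := h.hn; omega))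
      (fun x hx => by
        have h2 := h.upper x (closure_mono h.b1 (frontier_subset_closure hx))
        rw [frontier_ball ξ one_ne_zero, mem_sphere_iff_norm] at hx
        rw [hx]; linarith) x (by rw [hcl]; exact hx)
    linarith
  intro x hx
  have h1 : Tendsto (fun θ : ℝ => θ * (1/2 * (‖x - ξ‖ ^ 2 - 1))) (𝓝[<] 1) (𝓝 (1 * (1/2 * (‖x - ξ‖ ^ 2 - 1)))) :=
    (continuous_id.mul continuous_const).continuousWithinAt.tendsto
  rw [one_mul] at h1
  refine ge_of_tendsto h1 ?_
  filter_upwards [Ioo_mem_nhdsLT (show (0:ℝ) < 1 by norm_num)] with θ hθ using key θ hθ.1 hθ.2 x hx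

lemma barrier (h : Dir Ω ξ W) {ε A : ℝ} (hε : 0 < ε) (hA : 0 ≤ A) (hd : 1 < (2 * ε) ^ n * (1 + A / ε)) {p : Euc n} (hp : p ∈ frontier Ω) :
    ∀ y ∈ closure Ω, - (2 * n * A * ‖p - y‖) - ε * n ^ 2 ≤ W y := by
  have hpn : p ∉ Ω := by rw [h.op.frontier_eq] at hp; exact hp.2
  obtain ⟨f, hf⟩ := geometric_hahn_banach_open_point h.cv h.op hpn
  set μ : Euc n := (InnerProductSpace.toDual ℝ (Euc n)).symm f with hμ
  have hμf : ∀ y, f y = inner ℝ y μ := fun y => by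
    rw [real_inner_comm, hμ, InnerProductSpace.toDual_symm_apply]
  have hξ : ξ ∈ Ω := h.b1 (Metric.mem_ball_self one_pos)
  have hμ0 : μ ≠ 0 := by
    intro h0
    have := hf ξ hξ
    rw [hμf, hμf, h0] at this
    simp at this
  set ν : Euc n := ‖μ‖⁻¹ • μ with hν
  have hν1 : ‖ν‖ = 1 := by rw [hν, norm_smul, norm_inv, norm_norm, inv_mul_cancel₀ (norm_ne_zero_iff.2 hμ0)]
  have hs0 : ∀ y ∈ closure Ω, 0 ≤ (inner ℝ (p - y) ν : ℝ) := by
    have hc : IsClosed {y : Euc n | 0 ≤ (inner ℝ (p - y) ν : ℝ)} :=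
      isClosed_le continuous_const ((continuous_const.sub continuous_id).inner continuous_const)
    refine fun y hy => closure_minimal (s := Ω) ?_ hc hy
    intro y hy
    have := hf y hy
    rw [hμf, hμf] at this
    simp only [mem_setOf_eq, hν, inner_smul_right, inner_sub_left]
    have : 0 < ‖μ‖⁻¹ := by positivity
    nlinarith
  have hsn : ∀ y, (inner ℝ (p - y) ν : ℝ) ≤ ‖p - y‖ := fun y => by
    have := real_inner_le_norm (p - y) ν
    rwa [hν1, mul_one] at this
  have hpy : ∀ y ∈ closure Ω, ‖p - y‖ ≤ 2 * n := fun y hy => by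
    have h1 := h.cl_bn (frontier_subset_closure hp)
    have h2 := h.cl_bn hy
    rw [Metric.mem_closedBall, dist_eq_norm] at h1 h2
    calc ‖p - y‖ = ‖(p - ξ) - (y - ξ)‖ := by congr 1; abel
      _ ≤ _ := (norm_sub_le _ _).trans (by linarith)
  have hball : ∀ y ∈ closure Ω, ‖y - ξ‖ ^ 2 ≤ n ^ 2 := fun y hy => by
    have h2 := h.cl_bn hy
    rw [Metric.mem_closedBall, dist_eq_norm] at h2
    exact pow_le_pow_left₀ (norm_nonneg _) h2 2
  have hcmp := comparison h.op h.bdd (b := qb ε A (-2 * n * A) (-ε * n ^ 2) ξ p ν) (u := W)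
    (qb_cd _ _ _ _ _ _ _ (k := 0)).continuous.continuousOn h.wc (fun x _ => (qb_cd _ _ _ _ _ _ _).contDiffAt) (fun x hx => h.sm.cda2 h.op hx)
    (fun x _ v => by
      rw [qb_ddd]
      have := real_inner_self_nonneg (x := v)
      have := mul_self_nonneg (inner ℝ v ν : ℝ)
      have : 0 ≤ 2 * A * (inner ℝ v ν * inner ℝ v ν) := by positivity
      have : 0 ≤ 2 * ε * inner ℝ v v := by positivity
      linarith)
    (fun x hx => by rw [qb_det _ _ _ _ _ _ _ hε.ne' hν1, h.det x hx]; exact hd)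
    (fun x hx => by
      have hx' := frontier_subset_closure hx
      rw [h.bd x hx, qb]
      have s0 := hs0 x hx'
      have s1 := (hsn x).trans (hpy x hx')
      have s2 := hball x hx'
      have : A * (inner ℝ (p - x) ν * (inner ℝ (p - x) ν - 2 * n)) ≤ 0 := mul_nonpos_of_nonneg_of_nonpos hA (mul_nonpos_of_nonneg_of_nonpos s0 (by linarith))
      nlinarith)
  intro y hy
  refine le_trans ?_ (hcmp y hy)
  rw [qb]
  have s0 := hs0 y hy
  have s1 := hsn y
  have : 0 ≤ ε * ‖y - ξ‖ ^ 2 := by positivity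
  have : 0 ≤ A * inner ℝ (p - y) ν ^ 2 := by positivity
  have : 2 * n * A * inner ℝ (p - y) ν ≤ 2 * n * A * ‖p - y‖ := mul_le_mul_of_nonneg_left s1 (by positivity)
  linarith

end Dir
end SecQO

section SecQP
open Filter Topology Set
variable {n : ℕ}

lemma conv_tangent {Ω : Set (Euc n)} {f : Euc n → ℝ} (hf : ConvexOn ℝ Ω f) {y v : Euc n} (hd : DifferentiableAt ℝ f y)
    (hy : y ∈ Ω) (hv : y + v ∈ Ω) : f y + dd v f y ≤ f (y + v) := by
  have h1 : HasDerivAt (fun s : ℝ => f (y + s • v)) (dd v f (y + (0:ℝ) • v)) 0 := hasDerivAt_line (by simpa using hd)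
  have h2 : ConvexOn ℝ (Icc (0:ℝ) 1) (fun s : ℝ => f (y + s • v)) := by
    have := hf.comp_affineMap (AffineMap.lineMap (k := ℝ) y (y + v))
    refine (this.subset ?_ (convex_Icc _ _)).congr ?_
    · intro t ht
      exact hf.1.segment_subset hy hv (by rw [segment_eq_image_lineMap]; exact ⟨t, ht, rfl⟩)
    · intro t ht
      simp [AffineMap.lineMap_apply, add_comm]
  have := h2.le_slope_of_hasDerivAt (by simp) (by simp) zero_lt_one h1
  simp [slope_def_field] at this
  linarith

lemma ball_of_frontier {Ω : Set (Euc n)} (ho : IsOpen Ω) {y : Euc n} {d : ℝ} (hd : 0 < d) (hy : y ∈ Ω) (h : ∀ p ∈ frontier Ω, d ≤ ‖p - y‖) :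
    Metric.ball y d ⊆ Ω := by
  have hc : IsPreconnected (Metric.ball y d) := (convex_ball y d).isPreconnected
  refine IsPreconnected.subset_left_of_subset_union (v := (closure Ω)ᶜ) ho isClosed_closure.isOpen_compl ?_ ?_ ?_ hc
  · exact disjoint_compl_right_iff_subset.2 subset_closure
  · intro z hz
    by_cases hzc : z ∈ closure Ω
    · left
      by_contra hn
      have := h z (by rw [ho.frontier_eq]; exact ⟨hzc, hn⟩)
      rw [Metric.mem_ball, dist_eq_norm] at hz
      linarith
    · right; exact hzc
  · exact ⟨y, Metric.mem_ball_self hd, hy⟩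

lemma Dir.dist (n : ℕ) (hn : 2 ≤ n) : ∃ d : ℝ, 0 < d ∧ ∀ (Ω : Set (Euc n)) (ξ : Euc n) (W : Euc n → ℝ), Dir Ω ξ W →
    ∀ y ∈ Ω, W y < -(1/16) → Metric.ball y d ⊆ Ω := by
  have hn0 : (0:ℝ) < n := by exact_mod_cast (by omega : 0 < n)
  set ε : ℝ := 1 / (32 * n ^ 2) with hε
  have he : 0 < ε := by positivity
  set A : ℝ := ε / (2 * ε) ^ n with hA
  have hA0 : 0 < A := by positivity
  refine ⟨1 / (64 * n * A), by positivity, fun Ω ξ W h y hy hw => ?_⟩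
  refine ball_of_frontier h.op (by positivity) hy fun p hp => ?_
  have := h.barrier he hA0.le (by
    have : (2 * ε) ^ n * (1 + A / ε) = (2 * ε) ^ n + 1 := by rw [hA]; field_simp
    rw [this]
    have : 0 < (2 * ε) ^ n := by positivity
    linarith) hp y (subset_closure hy)
  have e1 : ε * n ^ 2 = 1 / 32 := by rw [hε]; field_simp
  rw [e1] at this
  rw [div_le_iff₀ (by positivity)]
  nlinarith

lemma lower_ell {w : Euc n → ℝ} {x : Euc n} (hw : ContDiffAt ℝ 2 w x) (hc : ∀ v, 0 ≤ dd v (dd v w) x) (hd : hessDet w x = 1)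
    {Lam : ℝ} (hL : 0 < Lam) (hu : ∀ v, dd v (dd v w) x ≤ Lam * ‖v‖ ^ 2) (v : Euc n) :
    Lam / (2 * Lam) ^ n * ‖v‖ ^ 2 ≤ dd v (dd v w) x := by
  suffices h : ∀ e : Euc n, ‖e‖ = 1 → Lam / (2 * Lam) ^ n ≤ dd e (dd e w) x by
    by_cases hv : v = 0
    · subst hv; simpa using hc 0
    · have h1 := h (‖v‖⁻¹ • v) (by rw [norm_smul, norm_inv, norm_norm, inv_mul_cancel₀ (norm_ne_zero_iff.2 hv)])
      rw [d2_smul hw] at h1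
      have : 0 < ‖v‖ := norm_pos_iff.2 hv
      rw [inv_pow, ← div_eq_inv_mul, le_div_iff₀ (by positivity)] at h1
      exact h1
  intro e he
  set μ := dd e (dd e w) x with hμ
  have hμ0 : 0 ≤ μ := hc e
  have hee : e.ofLp ⬝ᵥ e.ofLp = 1 := by
    have := EuclideanSpace.real_norm_sq_eq e
    rw [he] at this
    simp only [dotProduct]
    rw [← one_pow 2, this]
    exact Finset.sum_congr rfl fun i _ => by ring
  let H : Matrix (Fin n) (Fin n) ℝ := Matrix.of fun i j => (if i = j then 2 * Lam else 0) + (2 * μ - 2 * Lam) * e i * e j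
  have hH := rank1_det (a := 2 * Lam) (by positivity) (2 * μ - 2 * Lam) e.ofLp H (fun i j => rfl)
  rw [hee] at hH
  have hmono := det_mono (hess_psd hw hc) (B := H) (by
    ext i j
    simp only [H, Matrix.transpose_apply, Matrix.of_apply]
    simp only [eq_comm (a := j) (b := i)]; ring) (fun v => by
    rw [qf_hess hw]
    set V : Euc n := WithLp.toLp 2 v
    set a : ℝ := v ⬝ᵥ e.ofLp with ha
    have e1 : v ⬝ᵥ H.mulVec v = 2 * Lam * (v ⬝ᵥ v) + (2 * μ - 2 * Lam) * a ^ 2 := by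
      simp only [dotProduct, Matrix.mulVec, H, Matrix.of_apply, ha]
      rw [sq, Finset.sum_mul_sum, Finset.mul_sum, Finset.mul_sum, ← Finset.sum_add_distrib]
      refine Finset.sum_congr rfl fun i _ => ?_
      simp only [add_mul, Finset.sum_add_distrib, ite_mul, zero_mul, Finset.sum_ite_eq, Finset.mem_univ, if_true, mul_add]
      rw [Finset.mul_sum, Finset.mul_sum]
      congr 1
      · ring
      · exact Finset.sum_congr rfl fun j _ => by ring
    have e2 : v ⬝ᵥ v = ‖V‖ ^ 2 := by
      rw [EuclideanSpace.real_norm_sq_eq]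
      simp only [dotProduct, V]
      exact Finset.sum_congr rfl fun i _ => by ring
    have e3 : (inner ℝ V e : ℝ) = a := by
      rw [ha]; simp [PiLp.inner_apply, dotProduct, V, mul_comm]
    rw [e1, e2]
    set y : Euc n := V - a • e with hy
    have hVy : V = (a • e) + (1:ℝ) • y := by rw [hy]; simp
    have hyn : ‖y‖ ^ 2 = ‖V‖ ^ 2 - a ^ 2 := by
      rw [hy, norm_sub_sq_real, inner_smul_right, e3, norm_smul, he]
      simp only [Real.norm_eq_abs, mul_one, sq_abs]; ring
    have hpar : dd ((a • e) + y) (dd ((a • e) + y) w) x + dd ((a • e) - y) (dd ((a • e) - y) w) x = 2 * dd (a • e) (dd (a • e) w) x + 2 * dd y (dd y w) x := by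
      simp only [ddd_exp hw]
      rw [← Finset.sum_add_distrib, Finset.mul_sum, Finset.mul_sum, ← Finset.sum_add_distrib]
      refine Finset.sum_congr rfl fun i _ => ?_
      rw [← Finset.sum_add_distrib, Finset.mul_sum, Finset.mul_sum, ← Finset.sum_add_distrib]
      refine Finset.sum_congr rfl fun j _ => ?_
      simp; ring
    rw [one_smul] at hVy
    rw [← hVy] at hpar
    have p1 := hc ((a • e) - y)
    rw [d2_smul hw, ← hμ] at hpar
    have p2 := hu y
    rw [hyn] at p2
    linarith)
  rw [hH, show (hessianMatrix w x).det = 1 from hd] at hmono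
  have h3 : (2 * Lam) ^ n * (1 + (2 * μ - 2 * Lam) / (2 * Lam) * 1) = (2 * Lam) ^ n * μ / Lam := by field_simp; ring
  rw [h3, le_div_iff₀ hL, one_mul] at hmono
  rw [div_le_iff₀ (by positivity)]
  linarith

lemma Dir.ell (n : ℕ) (hn : 2 ≤ n) : ∃ d lam Lam : ℝ, 0 < d ∧ 0 < lam ∧ 0 < Lam ∧ ∀ (Ω : Set (Euc n)) (ξ : Euc n) (W : Euc n → ℝ), Dir Ω ξ W →
    (∀ y ∈ Ω, W y < -(1/16) → Metric.ball y d ⊆ Ω) ∧ Ell {y ∈ Ω | W y < -(1/8)} W lam Lam := by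
  obtain ⟨d, hd, hb⟩ := Dir.dist n hn
  have hn0 : (0:ℝ) < n := by exact_mod_cast (by omega : 0 < n)
  set G : ℝ := 2 * n ^ 2 / d with hG
  have hG0 : 0 ≤ G := by positivity
  set Lam : ℝ := 16 * ((n + G) * Real.exp (1/2 * G ^ 2)) with hLam
  have hL : 0 < Lam := by positivity
  refine ⟨d, Lam / (2 * Lam) ^ n, Lam, hd, by positivity, hL, fun Ω ξ W h => ⟨hb Ω ξ W h, ?_⟩⟩
  rintro x ⟨hx, hxw⟩ v
  have hgrad : ∀ e : Euc n, ‖e‖ = 1 → ∀ x ∈ Ω, W x < -(1/16) → |dd e W x| ≤ G := by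
    intro e he y hy hw
    have hbd := hb Ω ξ W h y hy hw
    have key : ∀ t : ℝ, |t| = d / 2 → t * dd e W y ≤ n ^ 2 := by
      intro t ht
      have hm : y + t • e ∈ Ω := by
        apply hbd
        rw [Metric.mem_ball, dist_eq_norm, add_sub_cancel_left, norm_smul, he, Real.norm_eq_abs, ht]; linarith
      have h1 := conv_tangent h.wcv (v := t • e) (h.sm.diff h.op hy) hy hm
      rw [dd_smul_left] at h1
      have h2 := h.upper _ (subset_closure hm)
      have h3 := h.lower' _ (subset_closure hy)
      simp only at h1
      linarith
    have k1 := key (d / 2) (abs_of_pos (by positivity))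
    have k2 := key (-(d / 2)) (by rw [abs_neg]; exact abs_of_pos (by positivity))
    rw [abs_le, hG]
    constructor
    · rw [← neg_div, div_le_iff₀ hd]; linarith
    · rw [le_div_iff₀ hd]; linarith
  have hup : ∀ v, dd v (dd v W) x ≤ Lam * ‖v‖ ^ 2 := by
    have hunit : ∀ e : Euc n, ‖e‖ = 1 → dd e (dd e W) x ≤ Lam := by
      intro e he
      have hK : IsCompact (closure Ω ∩ W ⁻¹' Iic (-(1/16))) :=
        h.bdd.isCompact_closure.of_isClosed_subset (h.wc.preimage_isClosed_of_isClosed isClosed_closure isClosed_Iic) inter_subset_left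
      have hKO : closure Ω ∩ W ⁻¹' Iic (-(1/16)) ⊆ Ω := by
        rintro z ⟨hz1, hz2⟩
        by_contra hn
        have := h.bd z (by rw [h.op.frontier_eq]; exact ⟨hz1, hn⟩)
        simp only [mem_preimage, mem_Iic, this] at hz2
        norm_num at hz2
      have := pogorelov h.ma hK hKO (c := 1/16) hG0 (fun z hz hw => ⟨subset_closure hz, hw.le⟩) (e := e) (by rintro rfl; simp at he) (hgrad e he) x hx (by linarith)
      have h0 := h.ma.conv x hx e
      nlinarith
    intro v
    by_cases hv : v = 0
    · subst hv
      have : dd (0 : Euc n) (dd 0 W) x = 0 := by simp [dd]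
      rw [this]; simp
    · have h1 := hunit (‖v‖⁻¹ • v) (by rw [norm_smul, norm_inv, norm_norm, inv_mul_cancel₀ (norm_ne_zero_iff.2 hv)])
      rw [d2_smul (h.sm.cda2 h.op hx)] at h1
      have : 0 < ‖v‖ := norm_pos_iff.2 hv
      rw [inv_pow, ← div_eq_inv_mul, div_le_iff₀ (by positivity)] at h1
      exact h1
  exact ⟨lower_ell (h.sm.cda2 h.op hx) (h.ma.conv x hx) (h.det x hx) hL hup v, hup v⟩
end SecQP

section SecQQ
open Filter Topology Set
variable {n : ℕ}

lemma dd_aff {f : Euc n → ℝ} {x : Euc n} (hf : ContDiffAt ℝ 2 f x) (c d : ℝ) (u v : Euc n) :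
    dd u (dd v (fun x => c * f x + d)) x = c * dd u (dd v f) x := by
  have h1 : ∀ᶠ y in 𝓝 x, ContDiffAt ℝ 2 f y := hf.eventually (by simp)
  have h2 : dd v (fun x => c * f x + d) =ᶠ[𝓝 x] fun y => c * dd v f y := by
    filter_upwards [h1] with y hy
    have hd := hy.differentiableAt (by norm_num)
    rw [dd_add (hd.const_mul c) (differentiableAt_const _), dd_cmul hd, dd_const, add_zero]
  have h3 : dd u (dd v (fun x => c * f x + d)) x = dd u (fun y => c * dd v f y) x := by
    simp only [dd]; rw [Filter.EventuallyEq.fderiv_eq h2]; rfl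
  rw [h3, dd_cmul ((contDiffAt_dd (m := 1) hf v).differentiableAt (by norm_num))]

lemma cd_aff {f : Euc n → ℝ} {x : Euc n} (hf : ContDiffAt ℝ 2 f x) (c d : ℝ) : ContDiffAt ℝ 2 (fun x => c * f x + d) x :=
  (contDiffAt_const.mul hf).add contDiffAt_const

lemma hess_aff {f : Euc n → ℝ} {x : Euc n} (hf : ContDiffAt ℝ 2 f x) (c d : ℝ) :
    hessianMatrix (fun x => c * f x + d) x = c • hessianMatrix f x := by
  ext i j
  rw [hessianMatrix_apply (cd_aff hf c d), dd_aff hf, Matrix.smul_apply, hessianMatrix_apply hf, smul_eq_mul]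

lemma hessDet_aff {f : Euc n → ℝ} {x : Euc n} (hf : ContDiffAt ℝ 2 f x) (c d : ℝ) :
    hessDet (fun x => c * f x + d) x = c ^ n * hessDet f x := by
  rw [hessDet, hess_aff hf, Matrix.det_smul, hessDet]; simp

/-- normalized pair -/
structure Nd (Ω : Set (Euc n)) (ξ : Euc n) (W U : Euc n → ℝ) (m δ : ℝ) : Prop extends Dir Ω ξ W where
  ucd : ∀ x ∈ Ω, ContDiffAt ℝ 2 U x
  ucv : ConvexOn ℝ Ω U
  uc : ContinuousOn U (closure Ω)
  ub : ∀ x ∈ frontier Ω, U x = m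
  ud : ∃ φ : Euc n → ℝ, ∀ x ∈ Ω, hessDet U x = φ x ^ n ∧ |φ x - 1| ≤ δ
  z0 : (0 : Euc n) ∈ Ω
  U0 : U 0 = 0
  upos : ∀ x ∈ Ω, 0 ≤ U x

namespace Nd
variable {Ω : Set (Euc n)} {ξ : Euc n} {W U : Euc n → ℝ} {m δ : ℝ}

lemma le1 (h : Nd Ω ξ W U m δ) {δ' : ℝ} (h1 : δ < δ') : ∀ x ∈ closure Ω, (1 + δ') * W x ≤ U x - m := by
  obtain ⟨φ, hφ⟩ := h.ud
  have hd0 : 0 ≤ δ := (abs_nonneg _).trans (hφ 0 h.z0).2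
  intro x hx
  have := comparison h.op h.bdd (b := fun x => (1 + δ') * W x + m) (u := U)
    ((continuousOn_const.mul h.wc).add continuousOn_const) h.uc (fun x hx => cd_aff (h.sm.cda2 h.op hx) _ _) h.ucd
    (fun x hx v => by rw [dd_aff (h.sm.cda2 h.op hx)]; exact mul_nonneg (by linarith) (h.ma.conv x hx v))
    (fun x hx => by
      rw [hessDet_aff (h.sm.cda2 h.op hx), h.det x hx, mul_one, (hφ x hx).1]
      have h3 := (hφ x hx).2
      calc φ x ^ n ≤ |φ x| ^ n := by rw [← abs_pow]; exact le_abs_self _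
        _ < (1 + δ') ^ n := by
          refine pow_lt_pow_left₀ ?_ (abs_nonneg _) (by have := h.hn; omega)
          rw [abs_le] at h3; rw [abs_lt]; constructor <;> linarith)
    (fun x hx => by rw [h.bd x hx, h.ub x hx]; simp) x hx
  linarith

lemma le2 (h : Nd Ω ξ W U m δ) {δ' : ℝ} (h1 : δ < δ') (h2 : δ' < 1) : ∀ x ∈ closure Ω, U x - m ≤ (1 - δ') * W x := by
  obtain ⟨φ, hφ⟩ := h.ud
  have hd0 : 0 ≤ δ := (abs_nonneg _).trans (hφ 0 h.z0).2
  intro x hx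
  have := comparison h.op h.bdd (b := U) (u := fun x => (1 - δ') * W x + m) h.uc
    ((continuousOn_const.mul h.wc).add continuousOn_const) h.ucd (fun x hx => cd_aff (h.sm.cda2 h.op hx) _ _)
    (fun x hx v => convex_hess h.op h.ucv hx (h.ucd x hx) v)
    (fun x hx => by
      rw [hessDet_aff (h.sm.cda2 h.op hx), h.det x hx, mul_one, (hφ x hx).1]
      have h3 := (hφ x hx).2
      rw [abs_le] at h3
      exact pow_lt_pow_left₀ (by linarith) (by linarith) (by have := h.hn; omega))
    (fun x hx => by rw [h.bd x hx, h.ub x hx]; simp) x hx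
  linarith

lemma d0 (h : Nd Ω ξ W U m δ) : 0 ≤ δ := by
  obtain ⟨φ, hφ⟩ := h.ud
  exact (abs_nonneg _).trans (hφ 0 h.z0).2

lemma close (h : Nd Ω ξ W U m δ) (hδ : δ < 1) : ∀ x ∈ closure Ω, |U x - m - W x| ≤ δ * n ^ 2 := by
  intro x hx
  have key : ∀ δ' : ℝ, δ < δ' → δ' < 1 → |U x - m - W x| ≤ δ' * n ^ 2 := by
    intro δ' h1 h2
    have a1 := h.le1 h1 x hx
    have a2 := h.le2 h1 h2 x hx
    have a3 := h.lower' x hx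
    have := h.d0
    rw [abs_le]
    constructor <;> nlinarith
  have h1 : Tendsto (fun θ : ℝ => θ * (n:ℝ) ^ 2) (𝓝[>] δ) (𝓝 (δ * (n:ℝ) ^ 2)) := (continuous_id.mul continuous_const).continuousWithinAt.tendsto
  refine ge_of_tendsto h1 ?_
  filter_upwards [Ioo_mem_nhdsGT hδ] with θ hθ using key θ hθ.1 hθ.2

lemma u_le (h : Nd Ω ξ W U m δ) (hδ : δ < 1) : ∀ x ∈ closure Ω, U x ≤ m := by
  intro x hx
  have := h.le2 (δ' := (δ + 1) / 2) (by linarith) (by linarith) x hx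
  have := h.upper x hx
  nlinarith

lemma m_ge (h : Nd Ω ξ W U m δ) (hδ : δ < 1/5) : 2/5 ≤ m := by
  obtain ⟨φ, hφ⟩ := h.ud
  have := comparison (Ω := Metric.ball ξ 1) Metric.isOpen_ball Metric.isBounded_ball (b := U) (u := fun y => (2/5) * ‖y - ξ‖ ^ 2 + (m - 2/5))
      (h.uc.mono (closure_mono h.b1)) ((quad_cd _ _ _ (k := 0)).continuous.continuousOn)
      (fun x hx => h.ucd x (h.b1 hx)) (fun x _ => (quad_cd _ _ _).contDiffAt) (fun x hx v => convex_hess h.op h.ucv (h.b1 hx) (h.ucd x (h.b1 hx)) v)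
      (fun x hx => by
        rw [quad_det, (hφ x (h.b1 hx)).1]
        have h3 := (hφ x (h.b1 hx)).2
        rw [abs_le] at h3
        exact pow_lt_pow_left₀ (by linarith) (by norm_num) (by have := h.hn; omega))
      (fun x hx => by
        have h2 := h.u_le (by linarith) x (closure_mono h.b1 (frontier_subset_closure hx))
        rw [frontier_ball ξ one_ne_zero, mem_sphere_iff_norm] at hx
        rw [hx]; linarith) ξ (subset_closure (Metric.mem_ball_self one_pos))
  have h2 := h.upos ξ (h.b1 (Metric.mem_ball_self one_pos))
  simp at this
  linarith
end Nd

lemma mv01 {f f' : ℝ → ℝ} {M : ℝ} (h : ∀ t ∈ Icc (0:ℝ) 1, HasDerivAt f (f' t) t) (hb : ∀ t ∈ Icc (0:ℝ) 1, |f' t| ≤ M) :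
    ∀ t ∈ Icc (0:ℝ) 1, |f t - f 0| ≤ M := by
  intro t ht
  have := (convex_Icc (0:ℝ) 1).norm_image_sub_le_of_norm_hasDerivWithin_le (fun x hx => (h x hx).hasDerivWithinAt) (fun x hx => by simpa using hb x hx)
    (show (0:ℝ) ∈ Icc (0:ℝ) 1 by simp) ht
  rw [Real.norm_eq_abs, Real.norm_eq_abs, sub_zero, abs_of_nonneg ht.1] at this
  have hM : 0 ≤ M := (abs_nonneg _).trans (hb 0 (by simp))
  nlinarith [ht.2]

lemma taylor2 {U : Set (Euc n)} {f : Euc n → ℝ} (hf : Sm U f) (hU : IsOpen U) {x : Euc n} (hs : ∀ t ∈ Icc (0:ℝ) 1, t • x ∈ U) {M : ℝ}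
    (hb : ∀ t ∈ Icc (0:ℝ) 1, |dd x (dd x f) (t • x)| ≤ M) : |f x - f 0 - dd x f 0| ≤ M := by
  have D : ∀ g : Euc n → ℝ, Sm U g → ∀ t ∈ Icc (0:ℝ) 1, HasDerivAt (fun s : ℝ => g (s • x)) (dd x g (t • x)) t := by
    intro g hg t ht
    have := hasDerivAt_line (f := g) (x := 0) (v := x) (t := t) (by simpa using hg.diff hU (hs t ht))
    simpa using this
  have h1 := mv01 (D _ (hf.dd hU x)) hb
  have h2 : ∀ t ∈ Icc (0:ℝ) 1, HasDerivAt (fun s : ℝ => f (s • x) - s * dd x f 0) (dd x f (t • x) - dd x f 0) t := fun t ht => by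
    have := (D f hf t ht).sub ((hasDerivAt_id t).mul_const (dd x f 0))
    refine HasDerivAt.congr_deriv (f' := _) this ?_
    simp
  have := mv01 h2 (fun t ht => by simpa using h1 t ht) 1 (by simp)
  simp only [one_smul, zero_smul, one_mul, zero_mul, sub_zero] at this
  rwa [show f x - f 0 - dd x f 0 = f x - dd x f 0 - f 0 by ring]

lemma taylor3 {U : Set (Euc n)} {f : Euc n → ℝ} (hf : Sm U f) (hU : IsOpen U) {x : Euc n} (hs : ∀ t ∈ Icc (0:ℝ) 1, t • x ∈ U) {M : ℝ}
    (hb : ∀ t ∈ Icc (0:ℝ) 1, |dd x (dd x (dd x f)) (t • x)| ≤ M) : |f x - f 0 - dd x f 0 - dd x (dd x f) 0 / 2| ≤ M := by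
  have D : ∀ g : Euc n → ℝ, Sm U g → ∀ t ∈ Icc (0:ℝ) 1, HasDerivAt (fun s : ℝ => g (s • x)) (dd x g (t • x)) t := by
    intro g hg t ht
    have := hasDerivAt_line (f := g) (x := 0) (v := x) (t := t) (by simpa using hg.diff hU (hs t ht))
    simpa using this
  have h1 := mv01 (D _ ((hf.dd hU x).dd hU x)) hb
  have h2 : ∀ t ∈ Icc (0:ℝ) 1, HasDerivAt (fun s : ℝ => dd x f (s • x) - s * dd x (dd x f) 0) (dd x (dd x f) (t • x) - dd x (dd x f) 0) t := fun t ht => by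
    have := (D _ (hf.dd hU x) t ht).sub ((hasDerivAt_id t).mul_const (dd x (dd x f) 0))
    refine HasDerivAt.congr_deriv (f' := _) this ?_
    simp
  have h3 := mv01 h2 (fun t ht => by simpa using h1 t ht)
  have h4 : ∀ t ∈ Icc (0:ℝ) 1, HasDerivAt (fun s : ℝ => f (s • x) - s * dd x f 0 - s * s * (dd x (dd x f) 0 / 2)) (dd x f (t • x) - t * dd x (dd x f) 0 - dd x f 0) t := fun t ht => by
    have := ((D f hf t ht).sub ((hasDerivAt_id t).mul_const (dd x f 0))).sub (((hasDerivAt_id t).mul (hasDerivAt_id t)).mul_const (dd x (dd x f) 0 / 2))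
    refine HasDerivAt.congr_deriv (f' := _) this ?_
    simp; ring
  have := mv01 h4 (fun t ht => by simpa using h3 t ht) 1 (by simp)
  simp only [one_smul, zero_smul, one_mul, zero_mul, sub_zero] at this
  rwa [show f x - f 0 - dd x f 0 - dd x (dd x f) 0 / 2 = f x - dd x f 0 - dd x (dd x f) 0 / 2 - f 0 by ring]
end SecQQ

section SecQR
open Filter Topology Set
variable {n : ℕ}

namespace Nd
variable {Ω : Set (Euc n)} {ξ : Euc n} {W U : Euc n → ℝ} {m δ : ℝ}

lemma diff0 (h : Nd Ω ξ W U m δ) (hδ : δ < 1) {x : Euc n} (hx : x ∈ Ω) : |U x - (W x - W 0)| ≤ 2 * δ * n ^ 2 := by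
  have a := h.close hδ x (subset_closure hx)
  have b := h.close hδ 0 (subset_closure h.z0)
  rw [h.U0] at b
  rw [abs_le] at a b ⊢
  constructor <;> linarith

lemma grad (h : Nd Ω ξ W U m δ) (hδ : δ < 1) {r t lam Lam : ℝ} (hs : Metric.closedBall 0 r ⊆ Ω) (hl : 0 ≤ lam)
    (he : Ell (Metric.closedBall 0 r) W lam Lam) (ht : 0 < t) (htr : t ≤ r) (hd : δ ≤ t ^ 2) (x : Euc n) :
    |dd x W 0| ≤ (2 * n ^ 2 + Lam) * t * ‖x‖ := by
  have key : ∀ x : Euc n, x ≠ 0 → dd x W 0 ≤ (2 * n ^ 2 + Lam) * t * ‖x‖ := by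
    intro x hx
    have hx0 : 0 < ‖x‖ := norm_pos_iff.2 hx
    set y : Euc n := (-(t / ‖x‖)) • x with hy
    have hyn : ‖y‖ = t := by
      rw [hy, norm_smul, norm_neg, Real.norm_of_nonneg (by positivity)]; field_simp
    have hmem : ∀ s ∈ Icc (0:ℝ) 1, s • y ∈ Metric.closedBall (0 : Euc n) r := fun s hs' => by
      rw [mem_closedBall_zero_iff, norm_smul, hyn, Real.norm_of_nonneg hs'.1]
      nlinarith [hs'.2]
    have hyB : y ∈ Metric.closedBall (0 : Euc n) r := by simpa using hmem 1 (by simp)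
    have h2 := taylor2 h.sm h.op (x := y) (fun s hs' => hs (hmem s hs')) (M := Lam * t ^ 2) (fun s hs' => by
      obtain ⟨a, b⟩ := he _ (hmem s hs') y
      rw [hyn] at a b
      rw [abs_le]; constructor
      · have : 0 ≤ lam * t ^ 2 := by positivity
        linarith
      · exact b)
    have h3 := h.diff0 hδ (hs hyB)
    have h4 := h.upos _ (hs hyB)
    have h5 : dd y W 0 = -(t / ‖x‖) * dd x W 0 := by rw [hy, dd_smul_left]
    rw [abs_le] at h2 h3
    have hn2 : (0:ℝ) ≤ n ^ 2 := by positivity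
    have h6 : (t / ‖x‖) * dd x W 0 ≤ (2 * n ^ 2 + Lam) * t ^ 2 := by
      nlinarith [h2.1, h3.2, mul_le_mul_of_nonneg_right hd hn2]
    have h7 : dd x W 0 = (t / ‖x‖) * dd x W 0 * (‖x‖ / t) := by field_simp
    rw [h7]
    calc _ ≤ (2 * n ^ 2 + Lam) * t ^ 2 * (‖x‖ / t) := mul_le_mul_of_nonneg_right h6 (by positivity)
      _ = _ := by field_simp
  by_cases hx : x = 0
  · subst hx; simp [dd]
  · have a := key x hx
    have b := key (-x) (neg_ne_zero.2 hx)
    rw [norm_neg, dd_neg_left] at b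
    rw [abs_le]; constructor <;> linarith

lemma core (h : Nd Ω ξ W U m δ) (hδ : δ < 1) {r t ρ lam Lam hc : ℝ} (hs : Metric.closedBall 0 (r + r) ⊆ Ω) (hl : 0 < lam) (hL : 0 ≤ Lam)
    (he : Ell (Metric.closedBall 0 (r + r)) W lam Lam) (ht : 0 < t) (htr : t ≤ r) (ht1 : t ≤ 1) (hd : δ ≤ t ^ 2) (hρ : 0 < ρ) (hρr : ρ ≤ r)
    (hC : √(40 * n * Lam ^ 3 / (lam * r ^ 2)) * ρ ≤ lam / 16) (hhc : hc = lam * ρ ^ 2 / 4)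
    (htc : (2 * n ^ 2 + Lam) * t * (ρ + 1) ≤ hc / 16) :
    ∀ x : Euc n, ‖x‖ ≤ ρ → |U x - dd x (dd x W) 0 / 2| ≤ 3 * hc / 8 := by
  intro x hx
  have hr : 0 < r := by linarith
  set C3 := √(40 * n * Lam ^ 3 / (lam * r ^ 2)) with hC3
  have hC30 : 0 ≤ C3 := Real.sqrt_nonneg _
  have hmem : ∀ s ∈ Icc (0:ℝ) 1, s • x ∈ Metric.closedBall (0 : Euc n) r := fun s hs' => by
    rw [mem_closedBall_zero_iff, norm_smul, Real.norm_of_nonneg hs'.1]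
    nlinarith [hs'.2, norm_nonneg x]
  have hrr : Metric.closedBall (0 : Euc n) r ⊆ Metric.closedBall 0 (r + r) := Metric.closedBall_subset_closedBall (by linarith)
  have h3 := taylor3 h.sm h.op (x := x) (fun s hs' => hs (hrr (hmem s hs'))) (M := hc / 4) (fun s hs' => by
    have hb := cball_sub (r := r) (hmem s hs')
    refine (d3_bound h.ma hr hl (hb.trans hs) (fun z hz => he z (hb hz)) x).trans ?_
    have h1 : ‖x‖ ^ 3 ≤ ρ ^ 3 := pow_le_pow_left₀ (norm_nonneg _) hx 3
    calc C3 * ‖x‖ ^ 3 ≤ C3 * ρ ^ 3 := by gcongr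
      _ = C3 * ρ * ρ ^ 2 := by ring
      _ ≤ lam / 16 * ρ ^ 2 := by gcongr
      _ = hc / 4 := by rw [hhc]; ring)
  have hxB : x ∈ Metric.closedBall (0 : Euc n) (r + r) := hrr (by simpa using hmem 1 (by simp))
  have h4 := h.diff0 hδ (hs hxB)
  have h5 := h.grad hδ hs hl.le he ht (by linarith) hd x
  have h6 : (2 * n ^ 2 + Lam) * t * ‖x‖ ≤ hc / 16 := by
    refine le_trans ?_ htc; gcongr; linarith
  have h7 : 2 * δ * n ^ 2 ≤ hc / 16 := by
    calc 2 * δ * n ^ 2 ≤ 2 * (t * 1) * n ^ 2 := by gcongr; nlinarith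
      _ ≤ (2 * n ^ 2 + Lam) * t * (ρ + 1) := by
        have : 0 ≤ (n:ℝ) ^ 2 * t * ρ := by positivity
        have : 0 ≤ Lam * t * (ρ + 1) := by positivity
        nlinarith
      _ ≤ _ := htc
  rw [abs_le] at h3 h4 h5 ⊢
  constructor <;> linarith [h3.1, h3.2, h4.1, h4.2, h5.1, h5.2]
end Nd

lemma Nd.step (n : ℕ) (hn : 2 ≤ n) : ∃ lam Lam hc c : ℝ, 0 < lam ∧ 0 < Lam ∧ 0 < hc ∧ hc ≤ 1/5 ∧ 0 < c ∧ c ≤ 1/10 ∧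
    (∀ (Ω : Set (Euc n)) (W : Euc n → ℝ), Dir Ω 0 W → Ell (Metric.closedBall 0 (1/2)) W lam Lam) ∧
    ∀ (Ω : Set (Euc n)) (ξ : Euc n) (W U : Euc n → ℝ) (m δ : ℝ), Nd Ω ξ W U m δ → δ ≤ c → 2/5 ≤ m →
      (∀ x, dd x (dd x W) 0 < hc → x ∈ Ω ∧ U x < hc) ∧
      (∀ x ∈ Ω, U x < hc → dd x (dd x W) 0 < 4 * hc) ∧
      Ell {x | dd x (dd x W) 0 < hc} W lam Lam ∧ Ell {0} W lam Lam := by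
  obtain ⟨d, lam, Lam, hd, hl, hL, H⟩ := Dir.ell n hn
  have hn0 : (0:ℝ) < n := by exact_mod_cast (by omega : 0 < n)
  set r : ℝ := d / 8 with hr
  have hr0 : 0 < r := by positivity
  set C3 := √(40 * n * Lam ^ 3 / (lam * r ^ 2)) with hC3
  have hC30 : 0 ≤ C3 := Real.sqrt_nonneg _
  set ρ : ℝ := min (min r 1) (min (4 / (5 * lam)) ((lam / 16) / (C3 + 1))) with hρ
  have hρ0 : 0 < ρ := by positivity
  have hρr : ρ ≤ r := (min_le_left _ _).trans (min_le_left _ _)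
  have hρ1 : ρ ≤ 1 := (min_le_left _ _).trans (min_le_right _ _)
  have hρl : ρ ≤ 4 / (5 * lam) := (min_le_right _ _).trans (min_le_left _ _)
  have hρC : ρ ≤ (lam / 16) / (C3 + 1) := (min_le_right _ _).trans (min_le_right _ _)
  rw [le_div_iff₀ (by positivity)] at hρl hρC
  set hc : ℝ := lam * ρ ^ 2 / 4 with hhc
  have hc0 : 0 < hc := by positivity
  set t : ℝ := min (min r 1) (hc / (16 * (2 * n ^ 2 + Lam) * (ρ + 1))) with ht
  have ht0 : 0 < t := by positivity
  have htr : t ≤ r := (min_le_left _ _).trans (min_le_left _ _)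
  have ht1 : t ≤ 1 := (min_le_left _ _).trans (min_le_right _ _)
  have htc : t ≤ hc / (16 * (2 * n ^ 2 + Lam) * (ρ + 1)) := min_le_right _ _
  rw [le_div_iff₀ (by positivity)] at htc
  refine ⟨lam, Lam, hc, min (min (t ^ 2) (1/10)) (1 / (5 * n ^ 2)), hl, hL, hc0, ?_, by positivity, (min_le_left _ _).trans (min_le_right _ _), ?_, ?_⟩
  · have : lam * ρ ^ 2 ≤ lam * ρ := by nlinarith [mul_pos hl hρ0]
    rw [hhc]; linarith
  · intro Ω W h x hx v
    refine (H Ω 0 W h).2 x ⟨h.b1 ?_, ?_⟩ v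
    · exact Metric.closedBall_subset_ball (by norm_num) hx
    · have h1 := h.upper1 x (Metric.closedBall_subset_closedBall (by norm_num) hx)
      rw [mem_closedBall_zero_iff] at hx
      rw [sub_zero] at h1
      nlinarith [norm_nonneg x]
  · intro Ω ξ W U m δ h hδ hm
    have hδt : δ ≤ t ^ 2 := hδ.trans ((min_le_left _ _).trans (min_le_left _ _))
    have hδ1 : δ < 1 := lt_of_le_of_lt (hδ.trans ((min_le_left _ _).trans (min_le_right _ _))) (by norm_num)
    have hδn : δ * n ^ 2 ≤ 1/5 := by
      have : δ ≤ 1 / (5 * n ^ 2) := hδ.trans (min_le_right _ _)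
      rw [le_div_iff₀ (by positivity)] at this
      linarith
    obtain ⟨H1, H2⟩ := H Ω ξ W h.toDir
    have hW0 : W 0 ≤ -(1/5) := by
      have := h.close hδ1 0 (subset_closure h.z0)
      rw [h.U0, abs_le] at this
      linarith
    have hball := H1 0 h.z0 (by linarith)
    have hsub : ∀ x ∈ Metric.closedBall (0 : Euc n) (r + r), x ∈ Ω ∧ W x < -(1/8) := by
      intro x hx
      rw [mem_closedBall_zero_iff] at hx
      have h3 : (3:ℝ) • x ∈ Ω := hball (by rw [mem_ball_zero_iff, norm_smul]; norm_num; linarith)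
      refine ⟨hball (by rw [mem_ball_zero_iff]; linarith), ?_⟩
      have := h.wcv.2 h.z0 h3 (show (0:ℝ) ≤ 2/3 by norm_num) (show (0:ℝ) ≤ 1/3 by norm_num) (by norm_num)
      rw [smul_zero, zero_add, smul_smul, smul_eq_mul, smul_eq_mul] at this
      norm_num at this
      have h5 := h.upper _ (subset_closure h3)
      linarith
    have he : Ell (Metric.closedBall 0 (r + r)) W lam Lam := fun x hx => H2 x (hsub x hx)
    have core := h.core hδ1 (fun x hx => (hsub x hx).1) hl hL.le he ht0 htr ht1 hδt hρ0 hρr (by rw [← hC3]; nlinarith) hhc (by linarith)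
    have h0 : (0 : Euc n) ∈ Metric.closedBall (0 : Euc n) (r + r) := Metric.mem_closedBall_self (by linarith)
    have q0 := he 0 h0
    have qs : ∀ x, dd x (dd x W) 0 ≤ 4 * hc → ‖x‖ ≤ ρ := fun x hx => by
      have h1 := (q0 x).1
      have : lam * ‖x‖ ^ 2 ≤ lam * ρ ^ 2 := by rw [hhc] at hx; linarith
      exact le_of_sq_le_sq (le_of_mul_le_mul_left this hl) hρ0.le
    have qb : ∀ x, ‖x‖ ≤ ρ → x ∈ Metric.closedBall (0 : Euc n) (r + r) := fun x hx => by rw [mem_closedBall_zero_iff]; linarith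
    refine ⟨fun x hx => ?_, fun x hx hu => ?_, fun x hx => he x (qb x (qs x (by have : dd x (dd x W) 0 < hc := hx; linarith))), ?_⟩
    · have h1 := qs x (by linarith)
      have h2 := core x h1
      rw [abs_le] at h2
      exact ⟨(hsub x (qb x h1)).1, by linarith⟩
    · by_contra hcon
      push Not at hcon
      set Q := dd x (dd x W) 0 with hQ
      have hQ0 : 0 < Q := by linarith
      set s := √(4 * hc / Q) with hs
      have hs2 : s ^ 2 = 4 * hc / Q := Real.sq_sqrt (by positivity)
      have hs0 : 0 ≤ s := Real.sqrt_nonneg _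
      have hs1 : s ≤ 1 := Real.sqrt_le_one.2 ((div_le_one hQ0).2 hcon)
      have hq : dd (s • x) (dd (s • x) W) 0 = 4 * hc := by
        rw [d2_smul (h.sm.cda2 h.op h.z0), ← hQ, hs2]; field_simp
      have h1 := core _ (qs _ hq.le)
      rw [hq, abs_le] at h1
      have h2 := h.ucv.2 hx h.z0 hs0 (by linarith : 0 ≤ 1 - s) (by ring)
      rw [smul_zero, add_zero, h.U0, smul_eq_mul, smul_zero, add_zero] at h2
      have h3 := h.upos x hx
      nlinarith
    · intro x hx; rw [mem_singleton_iff] at hx; subst hx; exact q0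
end SecQR

section SecQS
open Filter Topology Set
variable {n : ℕ}

/-- linear map of a matrix -/
def lmx (B : Matrix (Fin n) (Fin n) ℝ) : Euc n →L[ℝ] Euc n := Matrix.toEuclideanCLM (𝕜 := ℝ) B

lemma lmx_eq (B : Matrix (Fin n) (Fin n) ℝ) (x : Euc n) : Matrix.toEuclideanLin B x = lmx B x := rfl

lemma lmx_mul (A B : Matrix (Fin n) (Fin n) ℝ) (x : Euc n) : lmx (A * B) x = lmx A (lmx B x) := by
  simp [lmx]

lemma lmx_one (x : Euc n) : lmx (1 : Matrix (Fin n) (Fin n) ℝ) x = x := by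
  simp [lmx]

lemma lmx_smul (c : ℝ) (A : Matrix (Fin n) (Fin n) ℝ) (x : Euc n) : lmx (c • A) x = c • lmx A x := by
  simp [lmx]

lemma lmx_app (B : Matrix (Fin n) (Fin n) ℝ) (x : Euc n) (i : Fin n) : lmx B x i = B.mulVec x i := by
  simp [lmx, Matrix.toEuclideanCLM]; rfl

lemma lmx_inv {A : Matrix (Fin n) (Fin n) ℝ} (h : A.det ≠ 0) (x : Euc n) : lmx A (lmx A⁻¹ x) = x := by
  rw [← lmx_mul, Matrix.mul_nonsing_inv _ (isUnit_iff_ne_zero.2 h), lmx_one]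

lemma lmx_inv' {A : Matrix (Fin n) (Fin n) ℝ} (h : A.det ≠ 0) (x : Euc n) : lmx A⁻¹ (lmx A x) = x := by
  rw [← lmx_mul, Matrix.nonsing_inv_mul _ (isUnit_iff_ne_zero.2 h), lmx_one]

/-- the homeomorphism -/
def hmx (A : Matrix (Fin n) (Fin n) ℝ) (h : A.det ≠ 0) : Euc n ≃ₜ Euc n where
  toFun := lmx A
  invFun := lmx A⁻¹
  left_inv := lmx_inv' h
  right_inv := lmx_inv h
  continuous_toFun := (lmx A).continuous
  continuous_invFun := (lmx A⁻¹).continuous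

lemma mem_img {A : Matrix (Fin n) (Fin n) ℝ} (h : A.det ≠ 0) {S : Set (Euc n)} {y : Euc n} : y ∈ lmx A '' S ↔ lmx A⁻¹ y ∈ S := by
  constructor
  · rintro ⟨x, hx, rfl⟩; rwa [lmx_inv' h]
  · intro hy; exact ⟨_, hy, lmx_inv h y⟩

lemma img_closure {A : Matrix (Fin n) (Fin n) ℝ} (h : A.det ≠ 0) (S : Set (Euc n)) : closure (lmx A '' S) = lmx A '' closure S :=
  ((hmx A h).image_closure S).symm
lemma img_frontier {A : Matrix (Fin n) (Fin n) ℝ} (h : A.det ≠ 0) (S : Set (Euc n)) : frontier (lmx A '' S) = lmx A '' frontier S :=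
  ((hmx A h).image_frontier S).symm
lemma img_open {A : Matrix (Fin n) (Fin n) ℝ} (h : A.det ≠ 0) {S : Set (Euc n)} (hS : IsOpen S) : IsOpen (lmx A '' S) :=
  (hmx A h).isOpenMap S hS

lemma cd_comp {m : WithTop ℕ∞} {f : Euc n → ℝ} (L : Euc n →L[ℝ] Euc n) {y : Euc n} (hf : ContDiffAt ℝ m f (L y)) (c : ℝ) :
    ContDiffAt ℝ m (fun y => c * f (L y)) y :=
  contDiffAt_const.mul (hf.comp y L.contDiff.contDiffAt)

lemma dd_comp {f : Euc n → ℝ} (L : Euc n →L[ℝ] Euc n) {y : Euc n} (hf : DifferentiableAt ℝ f (L y)) (c : ℝ) (v : Euc n) :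
    dd v (fun y => c * f (L y)) y = c * dd (L v) f (L y) := by
  have h1 : HasFDerivAt (fun y => f (L y)) ((fderiv ℝ f (L y)).comp L) y := hf.hasFDerivAt.comp y L.hasFDerivAt
  have := (h1.const_mul c).fderiv
  simp only [dd, this]; simp

lemma ddd_comp {f : Euc n → ℝ} (L : Euc n →L[ℝ] Euc n) {y : Euc n} (hf : ContDiffAt ℝ 2 f (L y)) (c : ℝ) (u v : Euc n) :
    dd u (dd v (fun y => c * f (L y))) y = c * dd (L u) (dd (L v) f) (L y) := by
  have h1 : ∀ᶠ y in 𝓝 y, ContDiffAt ℝ 2 f (L y) := L.continuous.continuousAt.eventually (hf.eventually (by simp))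
  have h2 : dd v (fun y => c * f (L y)) =ᶠ[𝓝 y] fun y => c * dd (L v) f (L y) := by
    filter_upwards [h1] with z hz using dd_comp L (hz.differentiableAt (by norm_num)) c v
  have h3 : dd u (dd v (fun y => c * f (L y))) y = dd u (fun y => c * dd (L v) f (L y)) y := by
    rw [dd, h2.fderiv_eq]; rfl
  rw [h3, dd_comp L ((contDiffAt_dd (m := 1) hf (L v)).differentiableAt (by norm_num))]

lemma qf_hessian {f : Euc n → ℝ} {x : Euc n} (hf : ContDiffAt ℝ 2 f x) (u v : Euc n) :
    inner ℝ u (lmx (hessianMatrix f x) v) = dd u (dd v f) x := by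
  rw [ddd_exp hf, PiLp.inner_apply]
  refine Finset.sum_congr rfl fun i _ => ?_
  rw [lmx_app, Matrix.mulVec, dotProduct]
  simp only [RCLike.inner_apply, conj_trivial]
  rw [Finset.sum_mul]
  refine Finset.sum_congr rfl fun j _ => ?_
  rw [hessianMatrix_apply hf]
  try ring

lemma hess_comp {f : Euc n → ℝ} (B : Matrix (Fin n) (Fin n) ℝ) {y : Euc n} (hf : ContDiffAt ℝ 2 f (lmx B y)) (c : ℝ) :
    hessianMatrix (fun y => c * f (lmx B y)) y = c • (B.transpose * hessianMatrix f (lmx B y) * B) := by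
  ext i j
  rw [hessianMatrix_apply (cd_comp _ hf c), ddd_comp _ hf, ddd_exp hf]
  have hB : ∀ i j, lmx B (EuclideanSpace.single j 1) i = B i j := fun i j => by rw [lmx_app]; simp
  simp only [Matrix.smul_apply, Matrix.mul_apply, Matrix.transpose_apply, smul_eq_mul, hB, Finset.sum_mul, hessianMatrix_apply hf]
  congr 1
  rw [Finset.sum_comm]
  refine Finset.sum_congr rfl fun a _ => Finset.sum_congr rfl fun b _ => ?_
  ring

lemma hessDet_affFT (hn : 2 ≤ n) {f : Euc n → ℝ} {A : Matrix (Fin n) (Fin n) ℝ} (hA : 0 < A.det) {y : Euc n} (hf : ContDiffAt ℝ 2 f (lmx A⁻¹ y)) :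
    hessDet (affFT A f) y = hessDet f (lmx A⁻¹ y) := by
  have h := hess_comp A⁻¹ hf (A.det ^ ((2:ℝ) / n))
  have h' : hessianMatrix (affFT A f) y = _ := h
  rw [hessDet, h', Matrix.det_smul, Matrix.det_mul, Matrix.det_mul, Matrix.det_transpose, Matrix.det_nonsing_inv, Ring.inverse_eq_inv', hessDet]
  have h2 : (A.det ^ ((2:ℝ) / n)) ^ (Fintype.card (Fin n)) = A.det ^ 2 := by
    rw [Fintype.card_fin, ← Real.rpow_natCast, ← Real.rpow_mul hA.le, div_mul_cancel₀ _ (by positivity)]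
    norm_num
  rw [h2]; field_simp

/-- section data -/
structure Sec (S : Set (Euc n)) (V w : Euc n → ℝ) (h δ : ℝ) : Prop where
  op : IsOpen S
  cv : Convex ℝ S
  z0 : (0 : Euc n) ∈ S
  vcd : ∀ x ∈ S, ContDiffAt ℝ 2 V x
  vcv : ConvexOn ℝ S V
  vc : ContinuousOn V (closure S)
  vb : ∀ x ∈ frontier S, V x = V 0 + h
  vpos : ∀ x ∈ S, V 0 ≤ V x
  vd : ∃ φ : Euc n → ℝ, ∀ x ∈ S, hessDet V x = φ x ^ n ∧ |φ x - 1| ≤ δ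
  sm : Sm S w
  wcv : ConvexOn ℝ S w
  wc : ContinuousOn w (closure S)
  det : ∀ x ∈ S, hessDet w x = 1
  bd : ∀ x ∈ frontier S, w x = 0

/-- normalised V -/
def nV (A : Matrix (Fin n) (Fin n) ℝ) (V : Euc n → ℝ) (y : Euc n) : ℝ := A.det ^ ((2 : ℝ) / n) * V (lmx A⁻¹ y) + -(A.det ^ ((2 : ℝ) / n) * V 0)

lemma convexOn_comp {S : Set (Euc n)} {f : Euc n → ℝ} (hf : ConvexOn ℝ S f) {A : Matrix (Fin n) (Fin n) ℝ} (hA : A.det ≠ 0) {c : ℝ} (hc : 0 ≤ c) :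
    ConvexOn ℝ (lmx A '' S) (fun y => c * f (lmx A⁻¹ y)) := by
  have h1 := hf.comp_linearMap (lmx A⁻¹ : Euc n →ₗ[ℝ] Euc n)
  have h2 : (lmx A '' S) = (lmx A⁻¹ : Euc n →ₗ[ℝ] Euc n) ⁻¹' S := by ext y; rw [mem_img hA]; rfl
  rw [h2]
  exact h1.smul hc

lemma contOn_comp {S : Set (Euc n)} {f : Euc n → ℝ} (hf : ContinuousOn f S) {A : Matrix (Fin n) (Fin n) ℝ} (hA : A.det ≠ 0) (c : ℝ) :
    ContinuousOn (fun y => c * f (lmx A⁻¹ y)) (lmx A '' S) :=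
  continuousOn_const.mul (hf.comp (lmx A⁻¹).continuous.continuousOn (fun y hy => (mem_img hA).1 hy))

namespace Sec
variable {S : Set (Euc n)} {V w : Euc n → ℝ} {h δ : ℝ} {A : Matrix (Fin n) (Fin n) ℝ}

lemma dir (H : Sec S V w h δ) (hn : 2 ≤ n) (hA : 0 < A.det) {ξ : Euc n} (h1 : Metric.ball ξ 1 ⊆ lmx A '' S) (h2 : lmx A '' S ⊆ Metric.ball ξ n) :
    Dir (lmx A '' S) ξ (affFT A w) where
  hn := hn
  op := img_open hA.ne' H.op
  cv := H.cv.linear_image (lmx A : Euc n →ₗ[ℝ] Euc n)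
  b1 := h1
  bn := h2
  sm := fun y hy => (cd_comp (lmx A⁻¹) ((H.sm _ ((mem_img hA.ne').1 hy)).contDiffAt (H.op.mem_nhds ((mem_img hA.ne').1 hy))) _).contDiffWithinAt
  wcv := convexOn_comp H.wcv hA.ne' (Real.rpow_nonneg hA.le _)
  wc := by rw [img_closure hA.ne']; exact contOn_comp H.wc hA.ne' _
  det := fun y hy => by
    have hy' := (mem_img hA.ne').1 hy
    rw [hessDet_affFT hn hA (H.sm.cda2 H.op hy'), H.det _ hy']
  bd := fun y hy => by
    rw [img_frontier hA.ne', mem_img hA.ne'] at hy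
    show _ * w (lmx A⁻¹ y) = 0
    rw [H.bd _ hy, mul_zero]

lemma nd (H : Sec S V w h δ) (hn : 2 ≤ n) (hA : 0 < A.det) {ξ : Euc n} (h1 : Metric.ball ξ 1 ⊆ lmx A '' S) (h2 : lmx A '' S ⊆ Metric.ball ξ n) :
    Nd (lmx A '' S) ξ (affFT A w) (nV A V) (A.det ^ ((2 : ℝ) / n) * h) δ where
  toDir := H.dir hn hA h1 h2
  ucd := fun y hy => (cd_comp (lmx A⁻¹) (H.vcd _ ((mem_img hA.ne').1 hy)) _).add contDiffAt_const
  ucv := (convexOn_comp H.vcv hA.ne' (Real.rpow_nonneg hA.le _)).add_const _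
  uc := by rw [img_closure hA.ne']; exact (contOn_comp H.vc hA.ne' _).add continuousOn_const
  ub := fun y hy => by
    rw [img_frontier hA.ne', mem_img hA.ne'] at hy
    rw [nV, H.vb _ hy]; ring
  ud := by
    obtain ⟨φ, hφ⟩ := H.vd
    refine ⟨fun y => φ (lmx A⁻¹ y), fun y hy => ?_⟩
    have hy' := (mem_img hA.ne').1 hy
    refine ⟨?_, (hφ _ hy').2⟩
    rw [← (hφ _ hy').1, ← hessDet_affFT hn hA (H.vcd _ hy')]
    have hcd : ContDiffAt ℝ 2 (affFT A V) y := cd_comp (lmx A⁻¹) (H.vcd _ hy') _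
    have := hessDet_aff hcd 1 (-(A.det ^ ((2 : ℝ) / n) * V 0))
    rw [one_pow, one_mul] at this
    rw [← this]
    congr 1
    ext z; simp only [nV, affFT, one_mul, lmx_eq]
  z0 := by rw [mem_img hA.ne']; simpa using H.z0
  U0 := by simp [nV]
  upos := fun y hy => by
    have := H.vpos _ ((mem_img hA.ne').1 hy)
    have h3 := mul_le_mul_of_nonneg_left this (Real.rpow_nonneg hA.le ((2:ℝ) / n))
    rw [nV]; linarith
end Sec
end SecQS

section SecQT
open Filter Topology Set
variable {n : ℕ}

lemma inner_lmx (T : Matrix (Fin n) (Fin n) ℝ) (u v : Euc n) : inner ℝ (lmx T u) v = inner ℝ u (lmx T.transpose v) := by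
  have h : lmx T.transpose = star (lmx T) := by
    rw [lmx, lmx, ← map_star, Matrix.star_eq_conjTranspose, Matrix.conjTranspose_eq_transpose_of_trivial]
  rw [h, ContinuousLinearMap.star_eq_adjoint, ContinuousLinearMap.adjoint_inner_right]

lemma T_norm {T : Matrix (Fin n) (Fin n) ℝ} (hT : T.PosSemidef) {f : Euc n → ℝ} {hc : ℝ} (hf : ContDiffAt ℝ 2 f 0)
    (h2 : T * T = hc⁻¹ • hessianMatrix f 0) (v : Euc n) : ‖lmx T v‖ ^ 2 = hc⁻¹ * dd v (dd v f) 0 := by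
  have ht : T.transpose = T := by
    have := hT.isHermitian
    rwa [Matrix.IsHermitian, Matrix.conjTranspose_eq_transpose_of_trivial] at this
  rw [← real_inner_self_eq_norm_sq, inner_lmx, ht, ← lmx_mul, h2, lmx_smul, real_inner_smul_right, qf_hessian hf]

lemma Sec.mA {S : Set (Euc n)} {V w : Euc n → ℝ} {h δ : ℝ} {A : Matrix (Fin n) (Fin n) ℝ} (H : Sec S V w h δ) (hn : 2 ≤ n) (hA : 0 < A.det) :
    MA (lmx A '' S) (affFT A w) := by
  have hop := img_open hA.ne' H.op
  have hsm : Sm (lmx A '' S) (affFT A w) := fun y hy => (cd_comp (lmx A⁻¹) ((H.sm _ ((mem_img hA.ne').1 hy)).contDiffAt (H.op.mem_nhds ((mem_img hA.ne').1 hy))) _).contDiffWithinAt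
  refine ⟨hop, hsm, fun y hy => ?_, fun x hx v => convex_hess hop (convexOn_comp H.wcv hA.ne' (Real.rpow_nonneg hA.le _)) hx (hsm.cda2 hop hx) v⟩
  have hy' := (mem_img hA.ne').1 hy
  rw [hessDet_affFT hn hA (H.sm.cda2 H.op hy'), H.det _ hy']

set_option maxHeartbeats 2000000 in
theorem one_step (n : ℕ) (hn : 2 ≤ n) : ∃ lam Lam hc c C5 : ℝ, 0 < lam ∧ 0 < Lam ∧ 0 < hc ∧ hc ≤ 1/5 ∧ 0 < c ∧ c ≤ 1/10 ∧ 0 < C5 ∧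
    ∀ (S S' : Set (Euc n)) (V w w' : Euc n → ℝ) (h h' δ δ' : ℝ) (A T : Matrix (Fin n) (Fin n) ℝ) (ξ : Euc n),
      Sec S V w h δ → Sec S' V w' h' δ' → 0 < A.det → Metric.ball ξ 1 ⊆ lmx A '' S → lmx A '' S ⊆ Metric.ball ξ n →
      T.PosSemidef → T * T = hc⁻¹ • hessianMatrix (affFT A w) 0 → (∀ z, z ∈ S' ↔ z ∈ S ∧ V z < V 0 + h') →
      A.det ^ ((2:ℝ) / n) * h' = hc → 2/5 ≤ A.det ^ ((2:ℝ) / n) * h → δ ≤ c → δ' ≤ δ →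
      0 < T.det ∧ (T * A).det ^ ((2:ℝ) / n) = hc⁻¹ * A.det ^ ((2:ℝ) / n) ∧
      Metric.ball 0 1 ⊆ lmx (T * A) '' S' ∧ lmx (T * A) '' S' ⊆ Metric.ball 0 2 ∧
      Ell {0} (affFT A w) lam Lam ∧ (∀ v, dd v (dd v (affFT (T * A) w)) 0 = ‖v‖ ^ 2) ∧
      ∀ y ∈ Metric.ball (0 : Euc n) (1/4),
        (∀ v, |dd v (dd v (fun z => affFT (T * A) w' z - affFT (T * A) w z)) y| ≤ C5 * δ / hc * ‖v‖ ^ 2) ∧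
        ‖iteratedFDeriv ℝ 3 (fun z => affFT (T * A) w' z - affFT (T * A) w z) y‖ ≤ C5 * δ / hc := by
  obtain ⟨lam, Lam, hc, c, hl, hL, hc0, hc5, h0c, hc10, E1, E2⟩ := Nd.step n hn
  have hl' : 0 < min lam (lam / Lam) := by positivity
  have hL' : 0 < max Lam (Lam / lam) := lt_max_of_lt_left hL
  obtain ⟨C, hC, HD⟩ := difference n hl' hL' (r := 1/4) (by norm_num)
  have hn0 : (0:ℝ) < n := by exact_mod_cast (by omega : 0 < n)
  refine ⟨lam, Lam, hc, c, 2 * n ^ 2 * C + 1, hl, hL, hc0, hc5, h0c, hc10, by positivity, ?_⟩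
  intro S S' V w w' h h' δ δ' A T ξ H H' hA hb1 hbn hT hTT hSS hh hm hδ hδ'
  have N := H.nd hn hA hb1 hbn
  have hcd : ContDiffAt ℝ 2 (affFT A w) 0 := N.sm.cda2 N.op N.z0
  have tn := T_norm hT hcd hTT
  obtain ⟨i1, i2, i3, i4⟩ := E2 _ _ _ _ _ _ N hδ hm
  have d2 : T.det ^ 2 = (hc⁻¹) ^ n := by
    have h1 : hessDet (affFT A w) 0 = 1 := N.det _ N.z0
    rw [pow_two, ← Matrix.det_mul, hTT, Matrix.det_smul, ← hessDet, h1]; simp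
  have dT : 0 < T.det := by
    have h1 : T.det ≠ 0 := fun h0 => by
      rw [h0] at d2
      have : 0 < (hc⁻¹) ^ n := by positivity
      rw [← d2] at this; norm_num at this
    exact lt_of_le_of_ne hT.det_nonneg h1.symm
  have dTA : 0 < (T * A).det := by rw [Matrix.det_mul]; positivity
  have dp : (T * A).det ^ ((2:ℝ) / n) = hc⁻¹ * A.det ^ ((2:ℝ) / n) := by
    rw [Matrix.det_mul, Real.mul_rpow dT.le hA.le]
    congr 1
    rw [div_eq_mul_inv, Real.rpow_mul dT.le, show (2:ℝ) = ((2:ℕ):ℝ) by norm_num, Real.rpow_natCast, d2,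
      Real.pow_rpow_inv_natCast (by positivity) (by omega)]
  have inv : ∀ y, lmx (T * A)⁻¹ y = lmx A⁻¹ (lmx T⁻¹ y) := fun y => by rw [Matrix.mul_inv_rev, lmx_mul]
  have c0 : 0 < A.det ^ ((2:ℝ) / n) := Real.rpow_pos_of_pos hA _
  -- membership in image of the section
  have mem' : ∀ y, y ∈ lmx (T * A) '' S' ↔ lmx T⁻¹ y ∈ lmx A '' S ∧ nV A V (lmx T⁻¹ y) < hc := fun y => by
    rw [mem_img dTA.ne', hSS, inv, mem_img hA.ne']
    refine and_congr_right fun _ => ?_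
    rw [nV, ← hh]
    constructor
    · intro h1; nlinarith
    · intro h1
      by_contra h2
      push Not at h2
      nlinarith
  have qT : ∀ y, dd (lmx T⁻¹ y) (dd (lmx T⁻¹ y) (affFT A w)) 0 = hc * ‖y‖ ^ 2 := fun y => by
    have := tn (lmx T⁻¹ y)
    rw [lmx_inv dT.ne'] at this
    rw [this]; field_simp
  have b1 : Metric.ball 0 1 ⊆ lmx (T * A) '' S' := fun y hy => by
    rw [mem_ball_zero_iff] at hy
    rw [mem']
    refine i1 _ ?_
    rw [qT]
    have : ‖y‖ ^ 2 < 1 := by nlinarith [norm_nonneg y]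
    nlinarith
  have b2 : lmx (T * A) '' S' ⊆ Metric.ball 0 2 := fun y hy => by
    rw [mem'] at hy
    have := i2 _ hy.1 hy.2
    rw [qT] at this
    rw [mem_ball_zero_iff]
    by_contra h2
    push Not at h2
    have : 2 ^ 2 ≤ ‖y‖ ^ 2 := pow_le_pow_left₀ (by norm_num) h2 2
    nlinarith
  have hW2 : affFT (T * A) w = fun y => hc⁻¹ * affFT A w (lmx T⁻¹ y) := by
    ext y
    simp only [affFT, lmx_eq]
    rw [dp, inv]; ring
  have mA2 : MA (Metric.ball 0 1) (affFT (T * A) w) := (H.mA hn dTA).mono Metric.isOpen_ball (b1.trans (image_mono fun z hz => ((hSS z).1 hz).1))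
  have mA1 : MA (Metric.ball 0 1) (affFT (T * A) w') := (H'.mA hn dTA).mono Metric.isOpen_ball b1
  have N' := H'.nd hn dTA (ξ := 0) b1 (b2.trans (Metric.ball_subset_ball (by exact_mod_cast hn)))
  have hmem : ∀ y ∈ Metric.ball (0 : Euc n) 1, lmx T⁻¹ y ∈ lmx A '' S := fun y hy => ((mem' y).1 (b1 hy)).1
  have dd2 : ∀ y ∈ Metric.ball (0 : Euc n) 1, ∀ v, dd v (dd v (affFT (T * A) w)) y = hc⁻¹ * dd (lmx T⁻¹ v) (dd (lmx T⁻¹ v) (affFT A w)) (lmx T⁻¹ y) := fun y hy v => by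
    rw [hW2, ddd_comp _ (N.sm.cda2 N.op (hmem y hy))]
  have e2 : Ell (Metric.ball 0 1) (affFT (T * A) w) (lam / Lam) (Lam / lam) := fun y hy v => by
    rw [dd2 y hy v]
    have hy' : ‖y‖ < 1 := by rwa [mem_ball_zero_iff] at hy
    have q1 : dd (lmx T⁻¹ y) (dd (lmx T⁻¹ y) (affFT A w)) 0 < hc := by
      rw [qT]
      have : ‖y‖ ^ 2 < 1 := by nlinarith [norm_nonneg y]
      nlinarith
    obtain ⟨a1, a2⟩ := i3 _ q1 (lmx T⁻¹ v)
    obtain ⟨a3, a4⟩ := i4 0 rfl (lmx T⁻¹ v)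
    rw [qT] at a3 a4
    set X := ‖lmx T⁻¹ v‖ ^ 2
    set D := dd (lmx T⁻¹ v) (dd (lmx T⁻¹ v) (affFT A w)) (lmx T⁻¹ y)
    constructor
    · calc lam / Lam * ‖v‖ ^ 2 = lam / Lam * (hc⁻¹ * (hc * ‖v‖ ^ 2)) := by field_simp
        _ ≤ lam / Lam * (hc⁻¹ * (Lam * X)) := by gcongr
        _ = hc⁻¹ * (lam * X) := by field_simp
        _ ≤ _ := by gcongr
    · calc hc⁻¹ * D ≤ hc⁻¹ * (Lam * X) := by gcongr
        _ = Lam / lam * (hc⁻¹ * (lam * X)) := by field_simp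
        _ ≤ Lam / lam * (hc⁻¹ * (hc * ‖v‖ ^ 2)) := by gcongr
        _ = _ := by field_simp
  have e1 := E1 _ _ N'.toDir
  have d0' := N'.d0
  have hε : 0 ≤ 2 * n ^ 2 * δ / hc := by have : 0 ≤ δ := N.d0; positivity
  refine ⟨dT, dp, b1, b2, i4, fun v => ?_, fun y hy => ?_⟩
  · rw [dd2 0 (Metric.mem_ball_self one_pos), map_zero, qT]; field_simp
  · rw [mem_ball_zero_iff] at hy
    have hB : Metric.closedBall y (1/4) ⊆ Metric.closedBall 0 (1/2) := Metric.closedBall_subset_closedBall' (by rw [dist_zero_right]; linarith)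
    have hB1 : Metric.closedBall (0 : Euc n) (1/2) ⊆ Metric.ball 0 1 := Metric.closedBall_subset_ball (by norm_num)
    obtain ⟨r1, r2⟩ := HD (Metric.ball 0 1) (affFT (T * A) w') (affFT (T * A) w) y
      (-((T * A).det ^ ((2:ℝ) / n) * h') + hc⁻¹ * (A.det ^ ((2:ℝ) / n) * h)) (2 * n ^ 2 * δ / hc) hε mA1 mA2 (hB.trans hB1)
      (fun z hz v => ⟨(mul_le_mul_of_nonneg_right (min_le_left _ _) (by positivity)).trans (e1 z (hB hz) v).1,
        (e1 z (hB hz) v).2.trans (mul_le_mul_of_nonneg_right (le_max_left _ _) (by positivity))⟩)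
      (fun z hz v => ⟨(mul_le_mul_of_nonneg_right (min_le_right _ _) (by positivity)).trans (e2 z (hB1 (hB hz)) v).1,
        (e2 z (hB1 (hB hz)) v).2.trans (mul_le_mul_of_nonneg_right (le_max_right _ _) (by positivity))⟩)
      (fun z hz => by
        have hz1 := hB1 (hB hz)
        have a := N'.close (by linarith) z (subset_closure (b1 hz1))
        have b := N.close (by linarith) (lmx T⁻¹ z) (subset_closure (hmem z hz1))
        have hU : nV (T * A) V z = hc⁻¹ * nV A V (lmx T⁻¹ z) := by
          simp only [nV]; rw [dp, inv]; ring
        have hWz : affFT (T * A) w z = hc⁻¹ * affFT A w (lmx T⁻¹ z) := by rw [hW2]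
        rw [hU] at a
        rw [hWz]
        have hi : 1 ≤ hc⁻¹ := by rw [one_le_inv₀ hc0]; linarith
        have b' : |hc⁻¹ * (nV A V (lmx T⁻¹ z) - A.det ^ ((2:ℝ) / n) * h - affFT A w (lmx T⁻¹ z))| ≤ hc⁻¹ * (δ * n ^ 2) := by
          rw [abs_mul, abs_of_pos (by positivity)]; gcongr
        have e : 2 * n ^ 2 * δ / hc = hc⁻¹ * (δ * n ^ 2) + hc⁻¹ * (δ * n ^ 2) := by field_simp; ring
        have a' : δ' * n ^ 2 ≤ hc⁻¹ * (δ * n ^ 2) := by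
          calc δ' * n ^ 2 ≤ 1 * (δ * n ^ 2) := by rw [one_mul]; gcongr
            _ ≤ _ := by have : 0 ≤ δ := N.d0; gcongr
        rw [e]
        rw [abs_le] at a b' ⊢
        constructor <;> nlinarith [a.1, a.2, b'.1, b'.2])
    have hCC : C * (2 * n ^ 2 * δ / hc) ≤ (2 * n ^ 2 * C + 1) * δ / hc := by
      have : 0 ≤ δ := N.d0
      rw [show C * (2 * n ^ 2 * δ / hc) = (2 * n ^ 2 * C) * δ / hc by ring]
      gcongr; linarith
    exact ⟨fun v => (r1 v).trans (mul_le_mul_of_nonneg_right hCC (by positivity)), r2.trans hCC⟩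
end SecQT

section SecQU
open Filter Topology Set
variable {n : ℕ}

lemma d2_sub {U : Set (Euc n)} {f g : Euc n → ℝ} (hU : IsOpen U) (hf : Sm U f) (hg : Sm U g) {x : Euc n} (hx : x ∈ U) (u v : Euc n) :
    dd u (dd v (fun z => f z - g z)) x = dd u (dd v f) x - dd u (dd v g) x := by
  rw [dd_congr hU (fun y hy => dd_sub (hf.diff hU hy) (hg.diff hU hy) v) u x hx, dd_sub ((hf.dd hU v).diff hU hx) ((hg.dd hU v).diff hU hx)]

lemma opn_le {H : Matrix (Fin n) (Fin n) ℝ} {K : ℝ} (hK : 0 ≤ K) (h : ∀ v, ‖lmx H v‖ ^ 2 ≤ K * ‖v‖ ^ 2) : matOpNorm H ^ 2 ≤ K := by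
  have : matOpNorm H ≤ √K := by
    refine ContinuousLinearMap.opNorm_le_bound _ (Real.sqrt_nonneg _) fun v => ?_
    have h1 := Real.sqrt_le_sqrt (h v)
    rw [Real.sqrt_sq (norm_nonneg _), Real.sqrt_mul hK, Real.sqrt_sq (norm_nonneg _)] at h1
    exact h1
  calc matOpNorm H ^ 2 ≤ (√K) ^ 2 := pow_le_pow_left₀ (norm_nonneg _) this 2
    _ = K := Real.sq_sqrt hK

lemma opn_bil {H : Matrix (Fin n) (Fin n) ℝ} {K : ℝ} (hK : 0 ≤ K) (h : ∀ u v : Euc n, ‖u‖ ≤ 1 → ‖v‖ ≤ 1 → |inner ℝ u (lmx H v)| ≤ K) : matOpNorm H ≤ K := by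
  refine ContinuousLinearMap.opNorm_le_of_unit_norm hK fun v hv => ?_
  change ‖lmx H v‖ ≤ K
  by_cases h0 : lmx H v = 0
  · rw [h0, norm_zero]; exact hK
  · have h1 : 0 < ‖lmx H v‖ := norm_pos_iff.2 h0
    have := h (‖lmx H v‖⁻¹ • lmx H v) v (by rw [norm_smul, norm_inv, norm_norm, inv_mul_cancel₀ h1.ne']) hv.le
    rw [real_inner_smul_left, real_inner_self_eq_norm_sq] at this
    have e : ‖lmx H v‖⁻¹ * ‖lmx H v‖ ^ 2 = ‖lmx H v‖ := by field_simp
    rw [e] at this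
    exact (le_abs_self _).trans this

set_option maxHeartbeats 2000000 in
theorem asm (n : ℕ) (hn : 2 ≤ n) :
    ∃ hc Cmc c₂ C₂ C₅ C₇ : ℝ,
      0 < hc ∧ hc ≤ 1 / 5 ∧ 0 < Cmc ∧ Cmc ≤ 1/10 ∧ 0 < c₂ ∧ 0 < C₂ ∧ 0 < C₅ ∧ 0 < C₇ ∧
      ∀ (h₀ : ℝ) (_ : 2/5 ≤ h₀) (ξ : Euc n) (V : Euc n → ℝ)
        (S : ℕ → Set (Euc n)) (w : ℕ → Euc n → ℝ) (δ M : ℕ → ℝ)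
        (P T : ℕ → Matrix (Fin n) (Fin n) ℝ),
        S 0 = {z : Euc n | V z < V 0 + h₀} →
        (∀ k : ℕ, 1 ≤ k → S k = {z : Euc n | V z < V 0 + hc ^ k}) →
        Metric.ball ξ 1 ⊆ S 0 → S 0 ⊆ Metric.ball ξ (n : ℝ) →
        Sec (S 0) V (w 0) h₀ (δ 0) →
        (∀ k, Sec (S (k + 1)) V (w (k + 1)) (hc ^ (k + 1)) (δ (k + 1))) →
        (∀ k, δ (k + 1) ≤ δ k) →
        δ 0 ≤ Cmc →
        (∀ k : ℕ,
          M k = Real.exp (1.12 * (C₅ / hc) * ∑ j ∈ Finset.range (k - 1), δ j)) →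
        P 0 = 1 →
        (∀ k : ℕ, (T k).PosSemidef ∧
          T k * T k = hc⁻¹ • hessianMatrix (affFT (P k) (w k)) 0) →
        (∀ k : ℕ, P (k + 1) = T k * P k) →
        (∀ k : ℕ, 1 ≤ k →
          (Metric.ball (0 : Euc n) 1 ⊆
              (fun x => Matrix.toEuclideanLin (P k) x) '' S k ∧
            (fun x => Matrix.toEuclideanLin (P k) x) '' S k ⊆
              Metric.ball (0 : Euc n) 2) ∧
          (matOpNorm ((T k)⁻¹) ≤ 6 / 5 * Real.sqrt hc ∧
            6 / 5 * Real.sqrt hc < 1) ∧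
          (matOpNorm (breve (P k)) ^ 2 ≤ C₂ * M k ∧
            matOpNorm ((breve (P k))⁻¹) ^ 2 ≤ c₂⁻¹ * M k)) ∧
        (∀ k : ℕ,
          matOpNorm (hessianMatrix (w (k + 1)) 0 - hessianMatrix (w k) 0) ≤
            C₂ * (M (k + 2) - M (k + 1)) ∧
          ∀ y ∈ Metric.ball (0 : Euc n) (1 / 4),
            ‖iteratedFDeriv ℝ 3
                (fun z => affFT (P (k + 1)) (w (k + 1)) z -
                  affFT (P (k + 1)) (w k) z) y‖ ≤ C₇ * δ k / hc) := by
  obtain ⟨lam, Lam, hc, c, C5, hl, hL, hc0, hc5, h0c, hc10, hC5, ST⟩ := one_step n hn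
  have hn0 : (0:ℝ) < n := by exact_mod_cast (by omega : 0 < n)
  refine ⟨hc, min c (hc / (10 * C5)), lam, 3 * Lam, C5, C5, hc0, hc5, by positivity, (min_le_left _ _).trans hc10, hl, by positivity, hC5, hC5, ?_⟩
  intro h₀ hh₀ ξ V S w δ M P T hS0 hS hb1 hbn sec0 secs hδm hδ0 hM hP0 hT hP
  have hδle : ∀ k, δ k ≤ δ 0 := fun k => by
    induction k with
    | zero => exact le_rfl
    | succ k ih => exact (hδm k).trans ih
  have hδc : ∀ k, δ k ≤ c := fun k => (hδle k).trans (hδ0.trans (min_le_left _ _))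
  set hk : ℕ → ℝ := fun k => if k = 0 then h₀ else hc ^ k with hhk
  have sec : ∀ k, Sec (S k) V (w k) (hk k) (δ k) := fun k => by
    cases k with
    | zero => simpa [hhk] using sec0
    | succ k => simpa [hhk] using secs k
  have hδn : ∀ k, 0 ≤ δ k := fun k => by
    obtain ⟨φ, hφ⟩ := (sec k).vd
    exact (abs_nonneg _).trans (hφ 0 (sec k).z0).2
  set s : ℕ → ℝ := fun k => C5 * δ k / hc with hs
  have hs0 : ∀ k, 0 ≤ s k := fun k => by have := hδn k; positivity
  have hs1 : ∀ k, s k ≤ 1/10 := fun k => by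
    have : δ k ≤ hc / (10 * C5) := (hδle k).trans (hδ0.trans (min_le_right _ _))
    rw [le_div_iff₀ (by positivity)] at this
    simp only [hs]; rw [div_le_iff₀ hc0]; linarith
  have hSk : ∀ k, S k = {z | V z < V 0 + hk k} := fun k => by
    cases k with
    | zero => simpa [hhk] using hS0
    | succ k => simpa [hhk] using hS (k + 1) (by omega)
  have hklt : ∀ k, hc ^ (k + 1) ≤ hk k := fun k => by
    cases k with
    | zero => simp [hhk]; linarith
    | succ k =>
      simp only [hhk, Nat.succ_ne_zero, if_false]
      rw [pow_succ hc (k + 1)]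
      have : 0 < hc ^ (k + 1) := by positivity
      nlinarith
  have hSS : ∀ k z, z ∈ S (k + 1) ↔ z ∈ S k ∧ V z < V 0 + hc ^ (k + 1) := fun k z => by
    rw [hS (k + 1) (by omega), hSk k]
    simp only [mem_setOf_eq]
    have := hklt k
    constructor
    · intro h; exact ⟨by linarith, h⟩
    · exact fun h => h.2
  -- one step at level k
  have step : ∀ k (ξ' : Euc n), 0 < (P k).det → (P k).det ^ ((2:ℝ) / n) = (hc ^ k)⁻¹ → Metric.ball ξ' 1 ⊆ lmx (P k) '' S k → lmx (P k) '' S k ⊆ Metric.ball ξ' n → _ :=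
    fun k ξ' h1 h2 h3 h4 => ST (S k) (S (k + 1)) V (w k) (w (k + 1)) (hk k) (hc ^ (k + 1)) (δ k) (δ (k + 1)) (P k) (T k) ξ' (sec k) (secs k) h1 h3 h4 (hT k).1 (hT k).2
      (hSS k) (by rw [h2, pow_succ]; field_simp) (by
        rw [h2]
        cases k with
        | zero => simpa [hhk] using hh₀
        | succ k => simp only [hhk, Nat.succ_ne_zero, if_false]; rw [inv_mul_cancel₀ (by positivity)]; norm_num) (hδc k) (hδm k)
  have inv : ∀ k, 0 < (P k).det ∧ (P k).det ^ ((2:ℝ) / n) = (hc ^ k)⁻¹ ∧ ∃ ξ' : Euc n, Metric.ball ξ' 1 ⊆ lmx (P k) '' S k ∧ lmx (P k) '' S k ⊆ Metric.ball ξ' n := by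
    intro k
    induction k with
    | zero =>
      have : lmx (P 0) '' S 0 = S 0 := by
        rw [hP0]; ext y; simp [lmx_one]
      rw [this, hP0]
      refine ⟨by simp, by simp, ξ, hb1, hbn⟩
    | succ k ih =>
      obtain ⟨h1, h2, ξ', h3, h4⟩ := ih
      obtain ⟨a1, a2, a3, a4, -⟩ := step k ξ' h1 h2 h3 h4
      rw [hP k]
      refine ⟨by rw [Matrix.det_mul]; positivity, ?_, 0, a3, a4.trans (Metric.ball_subset_ball (by exact_mod_cast hn))⟩
      rw [a2, h2, pow_succ]; field_simp
  have R : ∀ k, _ := fun k => step k (inv k).2.2.choose (inv k).1 (inv k).2.1 (inv k).2.2.choose_spec.1 (inv k).2.2.choose_spec.2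
  set cc : ℕ → ℝ := fun k => (P k).det ^ ((2:ℝ) / n) with hcc
  have cc0 : ∀ k, 0 < cc k := fun k => Real.rpow_pos_of_pos (inv k).1 _
  set q : ℕ → Euc n → ℝ := fun k x => dd x (dd x (w k)) 0 with hq
  have cdw : ∀ k, ContDiffAt ℝ 2 (w k) 0 := fun k => (sec k).sm.cda2 (sec k).op (sec k).z0
  have affq : ∀ k j v, dd v (dd v (affFT (P k) (w j))) 0 = cc k * q j (lmx (P k)⁻¹ v) := fun k j v => by
    have := ddd_comp (lmx (P k)⁻¹) (y := 0) (f := w j) (by rw [map_zero]; exact cdw j) (cc k) v v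
    rw [map_zero] at this
    exact this
  have F1 : ∀ k x, cc (k + 1) * q k x = ‖lmx (P (k + 1)) x‖ ^ 2 := fun k x => by
    obtain ⟨-, -, -, -, -, h6, -⟩ := R k
    rw [← hP k] at h6
    have := h6 (lmx (P (k + 1)) x)
    rw [affq, lmx_inv' (inv (k + 1)).1.ne'] at this
    exact this
  have sm' : ∀ k, Sm (S (k + 1)) (w k) := fun k => (sec k).sm.mono (fun z hz => ((hSS k z).1 hz).1)
  have smd : ∀ k, Sm (S (k + 1)) (fun z => w (k + 1) z - w k z) := fun k => (secs k).sm.sub (sm' k)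
  have gq : ∀ k u v, dd u (dd v (fun z => w (k + 1) z - w k z)) 0 = dd u (dd v (w (k + 1))) 0 - dd u (dd v (w k)) 0 := fun k u v =>
    d2_sub (secs k).op (secs k).sm (sm' k) (secs k).z0 u v
  have Fd : ∀ k v, dd v (dd v (fun z => affFT (P (k + 1)) (w (k + 1)) z - affFT (P (k + 1)) (w k) z)) 0
      = cc (k + 1) * (q (k + 1) (lmx (P (k + 1))⁻¹ v) - q k (lmx (P (k + 1))⁻¹ v)) := fun k v => by
    have := ddd_comp (lmx (P (k + 1))⁻¹) (y := 0) (f := fun z => w (k + 1) z - w k z) (by rw [map_zero]; exact (smd k).cda2 (secs k).op (secs k).z0) (cc (k + 1)) v v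
    rw [map_zero, gq] at this
    rw [← this]
    congr 2
    ext z; simp only [affFT, lmx_eq, hcc]; ring
  have F2 : ∀ k x, |q (k + 1) x - q k x| ≤ s k * q k x := fun k x => by
    obtain ⟨-, -, -, -, -, -, h7⟩ := R k
    rw [← hP k] at h7
    have := (h7 0 (Metric.mem_ball_self (by norm_num))).1 (lmx (P (k + 1)) x)
    rw [Fd, lmx_inv' (inv (k + 1)).1.ne', ← F1, abs_mul, abs_of_pos (cc0 (k + 1))] at this
    refine le_of_mul_le_mul_left (this.trans (le_of_eq ?_)) (cc0 (k + 1))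
    simp only [hs]; ring
  have M1 : M 1 = 1 := by rw [hM]; simp
  have Ms : ∀ k, M (k + 2) = M (k + 1) * Real.exp (1.12 * s k) := fun k => by
    rw [hM, hM, ← Real.exp_add]
    congr 1
    rw [show k + 2 - 1 = k + 1 by omega, show k + 1 - 1 = k by omega, Finset.sum_range_succ]
    simp only [hs]; ring
  have M0 : ∀ k, 0 < M k := fun k => by rw [hM]; exact Real.exp_pos _
  have ex : ∀ k, 1 + 1.12 * s k ≤ Real.exp (1.12 * s k) := fun k => by have := Real.add_one_le_exp (1.12 * s k); linarith
  have q0 : ∀ k x, 0 ≤ q k x := fun k x => by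
    have := F1 k x
    have h2 : 0 ≤ ‖lmx (P (k + 1)) x‖ ^ 2 := by positivity
    rw [← this] at h2
    exact nonneg_of_mul_nonneg_right h2 (cc0 (k + 1))
  have qb : ∀ k x, lam * ‖x‖ ^ 2 ≤ M (k + 1) * q k x ∧ q k x ≤ M (k + 1) * (Lam * ‖x‖ ^ 2) := by
    intro k
    induction k with
    | zero =>
      intro x
      obtain ⟨-, -, -, -, h5, -⟩ := R 0
      have := h5 0 rfl x
      rw [affq, hP0, inv_one, lmx_one] at this
      simp only [hcc, hP0, Matrix.det_one, Real.one_rpow, one_mul] at this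
      rw [zero_add, M1, one_mul, one_mul]
      exact this
    | succ k ih =>
      intro x
      obtain ⟨a, b⟩ := ih x
      have f2 := F2 k x
      rw [abs_le] at f2
      have e1 := ex k
      have s0 := hs0 k
      have s1 := hs1 k
      have m0 := M0 (k + 1)
      have qq := q0 k x
      have E0 := Real.exp_pos (1.12 * s k)
      rw [show k + 1 + 1 = k + 2 by omega, Ms k]
      set E := Real.exp (1.12 * s k)
      constructor
      · refine a.trans ?_
        rw [mul_assoc]
        refine mul_le_mul_of_nonneg_left ?_ m0.le
        have h1 : (1 - s k) * q k x ≤ q (k + 1) x := by linarith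
        have h2 : 1 ≤ E * (1 - s k) := by nlinarith
        calc q k x ≤ E * (1 - s k) * q k x := by nlinarith
          _ ≤ _ := by rw [mul_assoc]; gcongr
      · have h1 : q (k + 1) x ≤ E * q k x := by nlinarith
        refine h1.trans ?_
        calc E * q k x ≤ E * (M (k + 1) * (Lam * ‖x‖ ^ 2)) := by gcongr
          _ = _ := by ring
  have brn : ∀ k x, ‖lmx (breve (P (k + 1))) x‖ ^ 2 = q k x := fun k x => by
    have hd := (inv (k + 1)).1
    rw [breve, lmx_smul, norm_smul, mul_pow, ← F1 k x, Real.norm_of_nonneg (Real.rpow_nonneg hd.le _), ← mul_assoc]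
    have : ((P (k + 1)).det ^ (-(1:ℝ) / n)) ^ 2 * cc (k + 1) = 1 := by
      simp only [hcc]
      rw [← Real.rpow_natCast, ← Real.rpow_mul hd.le, ← Real.rpow_add hd]
      rw [show -(1:ℝ) / n * ((2:ℕ):ℝ) + 2 / n = 0 by push_cast; ring, Real.rpow_zero]
    rw [this, one_mul]
  have brd : ∀ k, (breve (P (k + 1))).det ≠ 0 := fun k => by
    have hd := (inv (k + 1)).1
    rw [breve, Matrix.det_smul]
    have : 0 < (P (k + 1)).det ^ (-(1:ℝ) / n) := Real.rpow_pos_of_pos hd _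
    positivity
  refine ⟨fun k hk1 => ?_, fun k => ⟨?_, fun y hy => ?_⟩⟩
  · obtain ⟨k, rfl⟩ : ∃ j, k = j + 1 := ⟨k - 1, by omega⟩
    obtain ⟨-, -, a3, a4, -⟩ := R k
    rw [← hP k] at a3 a4
    refine ⟨⟨a3, a4⟩, ⟨?_, ?_⟩, ?_, ?_⟩
    · -- bound for the inverse of T
      obtain ⟨t0, -⟩ := R (k + 1)
      have hcd : ContDiffAt ℝ 2 (affFT (P (k + 1)) (w (k + 1))) 0 := cd_comp (lmx (P (k + 1))⁻¹) (by rw [map_zero]; exact cdw _) _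
      have tn := T_norm (hT (k + 1)).1 hcd (hT (k + 1)).2
      refine ContinuousLinearMap.opNorm_le_bound _ (by positivity) fun v => ?_
      change ‖lmx (T (k + 1))⁻¹ v‖ ≤ _
      have h1 := tn (lmx (T (k + 1))⁻¹ v)
      rw [lmx_inv t0.ne', affq] at h1
      set y := lmx (T (k + 1))⁻¹ v
      set x := lmx (P (k + 1))⁻¹ y with hx
      have f2 := F2 k x
      rw [abs_le] at f2
      have f1 := F1 k x
      rw [hx, lmx_inv (inv (k + 1)).1.ne', ← hx] at f1
      have h2 : 25/36 * q k x ≤ q (k + 1) x := by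
        have := mul_le_mul_of_nonneg_right (hs1 k) (q0 k x)
        have := q0 k x
        linarith
      have h3 : hc⁻¹ * (25/36 * ‖y‖ ^ 2) ≤ ‖v‖ ^ 2 := by
        rw [h1, ← f1]
        have := mul_le_mul_of_nonneg_left h2 (cc0 (k + 1)).le
        have : 25/36 * (cc (k + 1) * q k x) ≤ cc (k + 1) * q (k + 1) x := by linarith
        gcongr
      have h4 : ‖y‖ ^ 2 ≤ (6/5 * √hc * ‖v‖) ^ 2 := by
        rw [mul_pow, mul_pow, Real.sq_sqrt hc0.le]
        calc ‖y‖ ^ 2 = 36/25 * hc * (hc⁻¹ * (25/36 * ‖y‖ ^ 2)) := by field_simp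
          _ ≤ 36/25 * hc * ‖v‖ ^ 2 := by gcongr
          _ = _ := by ring
      exact le_of_sq_le_sq h4 (by positivity)
    · have : √hc ≤ 1/2 := by
        rw [Real.sqrt_le_left (by norm_num)]; norm_num; linarith
      linarith
    · refine opn_le (by have := M0 (k + 1); positivity) fun v => ?_
      rw [brn]
      refine (qb k v).2.trans ?_
      have : 0 ≤ M (k + 1) * (Lam * ‖v‖ ^ 2) := by have := M0 (k + 1); positivity
      linarith
    · refine opn_le (by have := M0 (k + 1); positivity) fun v => ?_
      have h1 := (qb k (lmx (breve (P (k + 1)))⁻¹ v)).1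
      rw [← brn k, lmx_inv (brd k)] at h1
      rw [mul_assoc, ← div_eq_inv_mul, le_div_iff₀ hl]
      linarith
  · have m0 := M0 (k + 1)
    have s0 := hs0 k
    refine (opn_bil (K := 3 * (s k * (M (k + 1) * Lam))) (by positivity) fun u v hu hv => ?_).trans ?_
    · have e : lmx (hessianMatrix (w (k + 1)) 0 - hessianMatrix (w k) 0) v = lmx (hessianMatrix (w (k + 1)) 0) v - lmx (hessianMatrix (w k) 0) v := by
        simp [lmx]
      rw [e, inner_sub_right, qf_hessian (cdw _), qf_hessian (cdw _), ← gq]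
      refine d2_polar (smd k) (secs k).op (secs k).z0 (by positivity) (fun x => ?_) u v hu hv
      rw [gq]
      refine (F2 k x).trans ?_
      rw [mul_assoc, mul_assoc]
      exact mul_le_mul_of_nonneg_left (qb k x).2 s0
    · rw [Ms k]
      have := ex k
      have h2 : M (k + 1) * Lam * s k ≤ M (k + 1) * Lam * (Real.exp (1.12 * s k) - 1) := by
        gcongr; linarith
      linarith
  · obtain ⟨-, -, -, -, -, -, h7⟩ := R k
    rw [← hP k] at h7
    exact (h7 y hy).2
end SecQU

section SecQV
open Filter Topology Set
variable {n : ℕ}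

section
variable {V Φ : Euc n → ℝ} {c : ℝ} {S K : Set (Euc n)} {ξ : Euc n}

lemma rel_open (hS : S = {z | V z < c}) (hK : K = closure S) (hcont : ContinuousOn V K) {z : Euc n} (hz : z ∈ S) :
    ∃ ρ > 0, K ∩ Metric.ball z ρ ⊆ S := by
  have hzK : z ∈ K := hK ▸ subset_closure hz
  have h1 : {x | V x < c} ∈ 𝓝[K] z := (hcont z hzK).eventually (isOpen_Iio.mem_nhds (by rw [hS] at hz; exact hz))
  rw [Metric.mem_nhdsWithin_iff] at h1
  obtain ⟨ρ, hρ, h⟩ := h1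
  exact ⟨ρ, hρ, fun x hx => hS ▸ h ⟨hx.2, hx.1⟩⟩

lemma int_K (hS : S = {z | V z < c}) (hK : K = closure S) (hcont : ContinuousOn V K) {z : Euc n} (hz : z ∈ S) (hi : z ∈ interior K) :
    z ∈ interior S := by
  obtain ⟨ρ, hρ, h⟩ := rel_open hS hK hcont hz
  rw [mem_interior_iff_mem_nhds] at hi ⊢
  filter_upwards [hi, Metric.ball_mem_nhds z hρ] with x h1 h2 using h ⟨h1, h2⟩

lemma fderiv_zero_bad (hS : S = {z | V z < c}) (hK : K = closure S) {z : Euc n} (hz : z ∈ S) (hi : z ∉ interior K) :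
    fderiv ℝ V z = 0 := by
  refine fderiv_zero_of_not_differentiableAt fun hd => hi ?_
  have h1 := hd.continuousAt.eventually (isOpen_Iio.mem_nhds (show V z ∈ Iio c by rw [hS] at hz; exact hz))
  rw [mem_interior_iff_mem_nhds]
  filter_upwards [h1] with x hx
  rw [hK]; exact subset_closure (by rw [hS]; exact hx)

/-- a bad point where the gradient map is continuous is the minimum -/
lemma bad_min (hS : S = {z | V z < c}) (hK : K = closure S) (hcv : ConvexOn ℝ K V) (hcd : ContDiffOn ℝ 2 V K) (hξ : ξ ∈ interior K)
    {z : Euc n} (hz : z ∈ S) (hi : z ∉ interior K) (hd : ContinuousAt (fderiv ℝ V) z) : ∀ x ∈ K, V z ≤ V x := by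
  intro x hx
  have hzK : z ∈ K := hK ▸ subset_closure hz
  have h0 := fderiv_zero_bad hS hK hz hi
  set y : ℝ → Euc n := fun t => z + t • (ξ - z) with hy
  have hyI : ∀ t ∈ Ioc (0:ℝ) 1, y t ∈ interior K := fun t ht => hcv.1.add_smul_sub_mem_interior hzK hξ ht
  have hyc : Tendsto y (𝓝[>] 0) (𝓝 z) := by
    have : Continuous y := by fun_prop
    have h2 := this.tendsto 0
    simp only [hy, zero_smul, add_zero] at h2
    exact h2.mono_left nhdsWithin_le_nhds
  have hev : ∀ᶠ t in 𝓝[>] (0:ℝ), t ∈ Ioc (0:ℝ) 1 := Ioc_mem_nhdsGT one_pos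
  have hyw : Tendsto y (𝓝[>] 0) (𝓝[K] z) := tendsto_nhdsWithin_iff.2 ⟨hyc, hev.mono fun t ht => interior_subset (hyI t ht)⟩
  have l1 : Tendsto (fun t => V (y t)) (𝓝[>] 0) (𝓝 (V z)) := (hcd.continuousOn z hzK).tendsto.comp hyw
  have l2 : Tendsto (fun t => fderiv ℝ V (y t)) (𝓝[>] 0) (𝓝 0) := by
    have := hd.tendsto.comp hyc
    rwa [h0] at this
  have l3 : Tendsto (fun t => V (y t) + (fderiv ℝ V (y t)) (x - y t)) (𝓝[>] 0) (𝓝 (V z + (0 : Euc n →L[ℝ] ℝ) (x - z))) :=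
    l1.add ((isBoundedBilinearMap_apply.continuous.tendsto ((0 : Euc n →L[ℝ] ℝ), x - z)).comp (l2.prodMk_nhds (tendsto_const_nhds.sub hyc)))
  simp only [ContinuousLinearMap.zero_apply, add_zero] at l3
  refine le_of_tendsto l3 ?_
  filter_upwards [hev] with t ht
  have hdt : DifferentiableAt ℝ V (y t) := (hcd.contDiffAt (mem_interior_iff_mem_nhds.1 (hyI t ht))).differentiableAt (by norm_num)
  have := conv_tangent hcv hdt (interior_subset (hyI t ht)) (v := x - y t) (by simpa using hx)
  simpa [dd] using this

lemma hess_bad (hn : 2 ≤ n) {z : Euc n} (hd : ¬ DifferentiableAt ℝ (fderiv ℝ V) z) : hessDet V z = 0 := by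
  have hm : hessianMatrix V z = 0 := by
    ext i j
    simp only [hessianMatrix, Matrix.of_apply, Matrix.zero_apply]
    rw [iteratedFDeriv_two_apply, fderiv_zero_of_not_differentiableAt hd]; simp
  haveI : Nonempty (Fin n) := ⟨⟨0, by omega⟩⟩
  rw [hessDet, hm, Matrix.det_zero]

lemma phi_bad (hn : 2 ≤ n) {z : Euc n} (hd : ¬ DifferentiableAt ℝ (fderiv ℝ V) z) (hΦ : hessDet V z = Φ z ^ n) : |Φ z - 1| = 1 := by
  rw [hess_bad hn hd] at hΦ
  rw [pow_eq_zero_iff (by omega) |>.1 hΦ.symm]; simp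

lemma phi_int (hn : 2 ≤ n) (hKc : IsCompact K) (hcv : Convex ℝ K) (hcd : ContDiffOn ℝ 2 V K) (hξ : ξ ∈ interior K) :
    ∃ B : ℝ, ∀ z ∈ interior K, hessDet V z = Φ z ^ n → |Φ z - 1| ≤ B := by
  have hud : UniqueDiffOn ℝ K := uniqueDiffOn_convex hcv ⟨ξ, hξ⟩
  have hc := hcd.continuousOn_iteratedFDerivWithin (m := 2) le_rfl hud
  have hc2 : ContinuousOn (fun z => (Matrix.of fun i j => iteratedFDerivWithin ℝ 2 V K z ![EuclideanSpace.single i 1, EuclideanSpace.single j 1] : Matrix (Fin n) (Fin n) ℝ).det) K := by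
    rw [continuousOn_iff_continuous_restrict] at hc ⊢
    refine Continuous.matrix_det (continuous_matrix fun i j => ?_)
    exact (ContinuousMultilinearMap.apply ℝ (fun _ : Fin 2 => Euc n) ℝ ![EuclideanSpace.single i 1, EuclideanSpace.single j 1]).continuous.comp hc
  obtain ⟨B, hB⟩ := hKc.exists_bound_of_continuousOn hc2
  refine ⟨B + 2, fun z hz hΦ => ?_⟩
  have h1 := hB z (interior_subset hz)
  have h2 : iteratedFDerivWithin ℝ 2 V K z = iteratedFDeriv ℝ 2 V z :=
    iteratedFDerivWithin_eq_iteratedFDeriv hud (hcd.contDiffAt (mem_interior_iff_mem_nhds.1 hz)) (interior_subset hz)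
  rw [h2] at h1
  have h3 : |Φ z| ^ n ≤ B := by
    rw [← abs_pow, ← hΦ]; exact h1
  have h4 : |Φ z| ≤ B + 1 := by
    by_cases h : |Φ z| ≤ 1
    · have : 0 ≤ |Φ z| ^ n := by positivity
      linarith
    · push Not at h
      have := le_self_pow₀ h.le (by omega : n ≠ 0)
      linarith
  have := abs_sub (Φ z) 1
  rw [abs_one] at this
  linarith

lemma no_lone (hn : 2 ≤ n) (hS : S = {z | V z < c}) (hK : K = closure S) (hcv : Convex ℝ K) (hSc : Convex ℝ S) (hcont : ContinuousOn V K) (hξ : ξ ∈ interior S)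
    {z : Euc n} (hz : z ∈ S) (h : ∀ x ∈ S, x ≠ z → x ∈ interior S) : z ∈ interior S := by
  by_contra hcon
  have hne : ξ ≠ z := fun h => hcon (h ▸ hξ)
  have hd : 0 < ‖ξ - z‖ := norm_pos_iff.2 (sub_ne_zero.2 hne)
  obtain ⟨ρ, hρ, hr⟩ := rel_open hS hK hcont hz
  set r := min (ρ / 2) ‖ξ - z‖ with hrd
  have hr0 : 0 < r := by positivity
  have hrρ : r < ρ := lt_of_le_of_lt (min_le_left _ _) (by linarith)
  have hrξ : r ≤ ‖ξ - z‖ := min_le_right _ _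
  have hzK : z ∈ K := hK ▸ subset_closure hz
  have hξK : ξ ∈ K := hK ▸ subset_closure (interior_subset hξ)
  have hrank : 1 < Module.rank ℝ (Euc n) := by
    rw [← Module.finrank_eq_rank, finrank_euclideanSpace, Fintype.card_fin]
    exact_mod_cast hn
  have hpre := isPreconnected_sphere hrank z r
  have hKS : ∀ p ∈ Metric.sphere z r, p ∈ K → p ∈ interior S := fun p hp hpK => by
    refine h p (hr ⟨hpK, ?_⟩) ?_
    · rw [Metric.mem_ball, Metric.mem_sphere.1 hp]; exact hrρ
    · rintro rfl; rw [Metric.mem_sphere, dist_self] at hp; linarith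
  have hKcl : IsClosed K := hK ▸ isClosed_closure
  set p1 : Euc n := z + (r / ‖ξ - z‖) • (ξ - z) with hp1
  have hp1s : p1 ∈ Metric.sphere z r := by
    rw [mem_sphere_iff_norm, hp1, add_sub_cancel_left, norm_smul, Real.norm_of_nonneg (by positivity)]; field_simp
  have hp1K : p1 ∈ K := hcv.add_smul_sub_mem hzK hξK ⟨by positivity, (div_le_one hd).2 hrξ⟩
  have hsub : Metric.sphere z r ⊆ interior S := by
    refine hpre.subset_left_of_subset_union isOpen_interior hKcl.isOpen_compl ?_ ?_ ⟨p1, hp1s, hKS p1 hp1s hp1K⟩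
    · refine disjoint_left.2 fun x hx hx' => hx' ?_
      rw [hK]; exact subset_closure (interior_subset hx)
    · intro p hp
      by_cases hpK : p ∈ K
      · exact Or.inl (hKS p hp hpK)
      · exact Or.inr hpK
  set p2 : Euc n := z - (r / ‖ξ - z‖) • (ξ - z) with hp2
  have hp2s : p2 ∈ Metric.sphere z r := by
    rw [mem_sphere_iff_norm, hp2, sub_sub_cancel_left, norm_neg, norm_smul, Real.norm_of_nonneg (by positivity)]; field_simp
  have := hSc.interior (hsub hp1s) (hsub hp2s) (show (0:ℝ) ≤ 1/2 by norm_num) (show (0:ℝ) ≤ 1/2 by norm_num) (by norm_num)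
  refine hcon ?_
  convert this using 1
  rw [hp1, hp2]; module

/-- openness and bounds -/
lemma S_open (hn : 2 ≤ n) (hS : S = {z | V z < c}) (hK : K = closure S) (hsc : StrictConvexOn ℝ K V) (hcd : ContDiffOn ℝ 2 V K)
    (hb1 : Metric.ball ξ 1 ⊆ S) (hbn : S ⊆ Metric.ball ξ n) (hΦ : ∀ z ∈ S, hessDet V z = Φ z ^ n)
    (hδ : sSup ((fun z => |Φ z - 1|) '' S) < 1) : IsOpen S ∧ BddAbove ((fun z => |Φ z - 1|) '' S) := by
  have hSK : S ⊆ K := hK ▸ subset_closure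
  have hcont := hcd.continuousOn
  have hSc : Convex ℝ S := by
    have hcl := hsc.convexOn.convex_lt c
    refine (congrArg (Convex ℝ) (Set.ext fun x => ?_)).mpr hcl
    constructor
    · intro hx; exact ⟨hSK hx, by rw [hS] at hx; exact hx⟩
    · rintro ⟨-, hx⟩; rw [hS]; exact hx
  have hKc : IsCompact K := by
    rw [hK]; exact (Metric.isBounded_ball.subset hbn).isCompact_closure
  have hξS : ξ ∈ interior S := mem_interior.2 ⟨_, hb1, Metric.isOpen_ball, Metric.mem_ball_self one_pos⟩
  have hξ : ξ ∈ interior K := interior_mono hSK hξS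
  obtain ⟨B, hB⟩ := phi_int (Φ := Φ) hn hKc hsc.1 hcd hξ
  -- exceptional points
  have exc : ∀ z ∈ S, z ∉ interior K → DifferentiableAt ℝ (fderiv ℝ V) z → ∀ x ∈ K, V z ≤ V x := fun z hz hi hd =>
    bad_min hS hK hsc.convexOn hcd hξ hz hi hd.continuousAt
  have uniq : ∀ z ∈ S, (∀ x ∈ K, V z ≤ V x) → ∀ z' ∈ S, (∀ x ∈ K, V z' ≤ V x) → z = z' := fun z hz h z' hz' h' =>
    hsc.eq_of_isMinOn (fun x hx => h x hx) (fun x hx => h' x hx) (hSK hz) (hSK hz')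
  have bdd : BddAbove ((fun z => |Φ z - 1|) '' S) := by
    by_cases hE : ∃ z0 ∈ S, ∀ x ∈ K, V z0 ≤ V x
    · obtain ⟨z0, hz0, hm⟩ := hE
      refine ⟨max (max B 1) (|Φ z0 - 1|), ?_⟩
      rintro _ ⟨z, hz, rfl⟩
      by_cases hi : z ∈ interior K
      · exact (hB z hi (hΦ z hz)).trans ((le_max_left _ _).trans (le_max_left _ _))
      · by_cases hd : DifferentiableAt ℝ (fderiv ℝ V) z
        · rw [uniq z hz (exc z hz hi hd) z0 hz0 hm]; exact le_max_right _ _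
        · exact (phi_bad hn hd (hΦ z hz)).le.trans ((le_max_right _ _).trans (le_max_left _ _))
    · refine ⟨max B 1, ?_⟩
      rintro _ ⟨z, hz, rfl⟩
      by_cases hi : z ∈ interior K
      · exact (hB z hi (hΦ z hz)).trans (le_max_left _ _)
      · by_cases hd : DifferentiableAt ℝ (fderiv ℝ V) z
        · exact absurd ⟨z, hz, exc z hz hi hd⟩ hE
        · exact (phi_bad hn hd (hΦ z hz)).le.trans (le_max_right _ _)
  refine ⟨?_, bdd⟩
  have good : ∀ z ∈ S, z ∉ interior S → ∀ x ∈ K, V z ≤ V x := fun z hz hi => by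
    have hi' : z ∉ interior K := fun h => hi (int_K hS hK hcont hz h)
    refine exc z hz hi' ?_
    by_contra hd
    have h1 := phi_bad hn hd (hΦ z hz)
    have h2 := le_csSup bdd ⟨z, hz, rfl⟩
    simp only [h1] at h2
    linarith
  rw [← subset_interior_iff_isOpen]
  intro z hz
  by_contra hcon
  refine hcon (no_lone hn hS hK hsc.1 hSc hcont hξS hz fun x hx hne => ?_)
  by_contra hx'
  exact hne (uniq x hx (good x hx hx') z hz (good z hz hcon))
end

/-- sublevel sections -/
lemma mkSec {V Φ w : Euc n → ℝ} {h₀ a δ : ℝ} {S S' : Set (Euc n)} (hS : S = {z | V z < V 0 + h₀}) (hop : IsOpen S)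
    (hcv : ConvexOn ℝ (closure S) V) (hcd : ContDiffOn ℝ 2 V (closure S)) (hg : gradient V 0 = 0) (hΦ : ∀ z ∈ S, hessDet V z = Φ z ^ n)
    (hbd : BddAbove ((fun z => |Φ z - 1|) '' S)) (ha : 0 < a) (hah : a ≤ h₀) (hS' : S' = {z | V z < V 0 + a})
    (hδ : δ = sSup ((fun z => |Φ z - 1|) '' S'))
    (hw : ConvexOn ℝ S' w ∧ ContDiffOn ℝ (⊤ : ℕ∞) w S' ∧ ContinuousOn w (closure S') ∧ (∀ z ∈ S', hessDet w z = 1) ∧ (∀ z ∈ frontier S', w z = 0)) :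
    Sec S' V w a δ ∧ S' ⊆ S := by
  have hsub : S' ⊆ S := fun z hz => by
    rw [hS'] at hz; rw [hS]; simp only [mem_setOf_eq] at hz ⊢; linarith
  have hSK : S ⊆ closure S := subset_closure
  have h0S' : (0 : Euc n) ∈ S' := by rw [hS']; simpa using ha
  have hcdS : ∀ x ∈ S, ContDiffAt ℝ 2 V x := fun x hx => (hcd.mono hSK).contDiffAt (hop.mem_nhds hx)
  have hcont : ContinuousOn V S := (hcd.mono hSK).continuousOn
  have hop' : IsOpen S' := by
    have := hcont.isOpen_inter_preimage hop (isOpen_Iio (a := V 0 + a))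
    convert this using 1
    ext x; constructor
    · intro hx; exact ⟨hsub hx, by rw [hS'] at hx; exact hx⟩
    · rintro ⟨-, hx⟩; rw [hS']; exact hx
  have hcv' : Convex ℝ S' := by
    have hcl := hcv.convex_lt (V 0 + a)
    refine (congrArg (Convex ℝ) (Set.ext fun x => ?_)).mpr hcl
    constructor
    · intro hx; exact ⟨hSK (hsub hx), by rw [hS'] at hx; exact hx⟩
    · rintro ⟨-, hx⟩; rw [hS']; exact hx
  have hf0 : fderiv ℝ V 0 = 0 := by
    rw [gradient] at hg
    exact (LinearIsometryEquiv.map_eq_zero_iff _).1 hg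
  refine ⟨?_, hsub⟩
  refine
    { op := hop'
      cv := hcv'
      z0 := h0S'
      vcd := fun x hx => hcdS x (hsub hx)
      vcv := hcv.subset (hsub.trans hSK) hcv'
      vc := hcd.continuousOn.mono (closure_mono hsub)
      vb := fun x hx => ?_
      vpos := fun x hx => ?_
      vd := ⟨Φ, fun x hx => ⟨hΦ x (hsub hx), ?_⟩⟩
      sm := hw.2.1
      wcv := hw.1
      wc := hw.2.2.1
      det := hw.2.2.2.1
      bd := hw.2.2.2.2 }
  · rw [hop'.frontier_eq] at hx
    have hc : ContinuousWithinAt V S' x := (hcd.continuousOn x (closure_mono hsub hx.1)).mono (hsub.trans hSK)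
    refine le_antisymm ?_ ?_
    · exact ContinuousWithinAt.closure_le hx.1 hc continuousWithinAt_const (fun y hy => by rw [hS'] at hy; exact le_of_lt hy)
    · by_contra h
      push Not at h
      exact hx.2 (by rw [hS']; exact h)
  · have := conv_tangent hcv (y := 0) (v := x) ((hcdS 0 (hsub h0S')).differentiableAt (by norm_num)) (hSK (hsub h0S')) (by simpa using hSK (hsub hx))
    simpa [dd, hf0] using this
  · rw [hδ]
    exact le_csSup (hbd.mono (image_mono hsub)) ⟨x, hx, rfl⟩

theorem iteration_lemma (n : ℕ) (hn : 2 ≤ n) :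
    ∃ hc Cmc c₂ C₂ C₅ C₇ : ℝ,
      0 < hc ∧ hc ≤ 1 / 5 ∧ 0 < Cmc ∧ 0 < c₂ ∧ 0 < C₂ ∧ 0 < C₅ ∧ 0 < C₇ ∧
      ∀ (h₀ : ℝ) (_ : 0 < h₀) (ξ : Euc n) (V Φ : Euc n → ℝ)
        (S : ℕ → Set (Euc n)) (w : ℕ → Euc n → ℝ) (δ M : ℕ → ℝ)
        (P T : ℕ → Matrix (Fin n) (Fin n) ℝ),
        S 0 = {z : Euc n | V z < V 0 + h₀} →
        (∀ k : ℕ, 1 ≤ k → S k = {z : Euc n | V z < V 0 + hc ^ k}) →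
        StrictConvexOn ℝ (closure (S 0)) V →
        ContDiffOn ℝ 2 V (closure (S 0)) →
        Metric.ball ξ 1 ⊆ S 0 → S 0 ⊆ Metric.ball ξ (n : ℝ) →
        (∀ z ∈ S 0, hessDet V z = Φ z ^ n) →
        gradient V 0 = 0 → Φ 0 = 1 →
        (∀ k : ℕ, δ k = sSup ((fun z => |Φ z - 1|) '' S k)) →
        δ 0 ≤ Cmc →
        (∀ k : ℕ, ConvexOn ℝ (S k) (w k) ∧ ContDiffOn ℝ (⊤ : ℕ∞) (w k) (S k) ∧
          ContinuousOn (w k) (closure (S k)) ∧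
          (∀ z ∈ S k, hessDet (w k) z = 1) ∧
          (∀ z ∈ frontier (S k), w k z = 0)) →
        (∀ k : ℕ,
          M k = Real.exp (1.12 * (C₅ / hc) * ∑ j ∈ Finset.range (k - 1), δ j)) →
        P 0 = 1 →
        (∀ k : ℕ, (hessianMatrix (affFT (P k) (w k)) 0).PosDef) →
        (∀ k : ℕ, (T k).PosSemidef ∧
          T k * T k = hc⁻¹ • hessianMatrix (affFT (P k) (w k)) 0) →
        (∀ k : ℕ, P (k + 1) = T k * P k) →
        (∀ k : ℕ, 1 ≤ k →
          (Metric.ball (0 : Euc n) 1 ⊆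
              (fun x => Matrix.toEuclideanLin (P k) x) '' S k ∧
            (fun x => Matrix.toEuclideanLin (P k) x) '' S k ⊆
              Metric.ball (0 : Euc n) 2) ∧
          (matOpNorm ((T k)⁻¹) ≤ 6 / 5 * Real.sqrt hc ∧
            6 / 5 * Real.sqrt hc < 1) ∧
          (matOpNorm (breve (P k)) ^ 2 ≤ C₂ * M k ∧
            matOpNorm ((breve (P k))⁻¹) ^ 2 ≤ c₂⁻¹ * M k)) ∧
        (∀ k : ℕ,
          matOpNorm (hessianMatrix (w (k + 1)) 0 - hessianMatrix (w k) 0) ≤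
            C₂ * (M (k + 2) - M (k + 1)) ∧
          ∀ y ∈ Metric.ball (0 : Euc n) (1 / 4),
            ‖iteratedFDeriv ℝ 3
                (fun z => affFT (P (k + 1)) (w (k + 1)) z -
                  affFT (P (k + 1)) (w k) z) y‖ ≤ C₇ * δ k / hc) := by
  obtain ⟨hc, Cmc, c₂, C₂, C₅, C₇, p1, p2, p3, p4, p5, p6, p7, p8, H⟩ := asm n hn
  refine ⟨hc, Cmc, c₂, C₂, C₅, C₇, p1, p2, p3, p5, p6, p7, p8, ?_⟩
  intro h₀ hh₀ ξ V Φ S w δ M P T hS0 hS hsc hcd hb1 hbn hΦ hg _ hδ hδ0 hw hM hP0 _ hT hP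
  obtain ⟨hop, hbd⟩ := S_open hn hS0 rfl hsc hcd hb1 hbn hΦ (by rw [← hδ 0]; linarith)
  have sec0 := (mkSec hS0 hop hsc.convexOn hcd hg hΦ hbd hh₀ le_rfl hS0 (hδ 0) (hw 0)).1
  have hh : 2/5 ≤ h₀ := by
    have e : lmx (1 : Matrix (Fin n) (Fin n) ℝ) '' S 0 = S 0 := by ext y; simp [lmx_one]
    have := (sec0.nd hn (A := 1) (by simp) (ξ := ξ) (by rw [e]; exact hb1) (by rw [e]; exact hbn)).m_ge (by linarith)
    simpa using this
  have hpow : ∀ k, hc ^ (k + 1) ≤ 1/5 := fun k => by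
    rw [pow_succ]
    have : hc ^ k ≤ 1 := pow_le_one₀ p1.le (by linarith)
    nlinarith
  have secs := fun k => mkSec (w := w (k + 1)) hS0 hop hsc.convexOn hcd hg hΦ hbd (show 0 < hc ^ (k + 1) by positivity) (by have := hpow k; linarith)
    (hS (k + 1) (by omega)) (hδ (k + 1)) (hw (k + 1))
  have hmono : ∀ k, S (k + 1) ⊆ S k := fun k => by
    cases k with
    | zero => exact (secs 0).2
    | succ k =>
      rw [hS (k + 1) (by omega), hS (k + 1 + 1) (by omega)]
      intro z hz
      simp only [mem_setOf_eq] at hz ⊢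
      have : hc ^ (k + 1 + 1) ≤ hc ^ (k + 1) := pow_le_pow_of_le_one p1.le (by linarith) (by omega)
      linarith
  have hmono0 : ∀ k, S k ⊆ S 0 := fun k => by
    cases k with
    | zero => exact Subset.rfl
    | succ k => exact (secs k).2
  have hδm : ∀ k, δ (k + 1) ≤ δ k := fun k => by
    rw [hδ, hδ]
    exact csSup_le_csSup (hbd.mono (image_mono (hmono0 k))) ⟨_, 0, (secs k).1.z0, rfl⟩ (image_mono (hmono k))
  exact H h₀ hh ξ V S w δ M P T hS0 hS hb1 hbn sec0 (fun k => (secs k).1) hδm hδ0 hM hP0 hT hP
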